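/- Let n ≥ 14 and let ρ : Fin r → Equiv.Perm (Fin n) be a string C-group with transitive generated subgroup G and r ≥ n/2. Suppose n = k * m with k ≥ 2 and m ≥ 2, that b : Fin n → Fin m is a surjection each of whose fibers has exactly k elements, that for every g ∈ G and x, y, b x = b y implies b (g x) = b (g y), and that every fiber of b is a maximal block: any X ⊆ Fin n satisfying MulAction.IsBlock for the action of G and containing a fiber of b equals that fiber or Set.univ. Then k = 2 or m = 2. -/

import Mathlib

/-- A string group generated by involutions (sggi): each generator has order 2 and
nonconsecutive generators commute. -/
def IsSggi {n r : ℕ} (ρ : Fin r → Equiv.Perm (Fin n)) : Prop :=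
  (∀ i, orderOf (ρ i) = 2) ∧
  ∀ i j : Fin r, 1 < |((i : ℕ) : ℤ) - ((j : ℕ) : ℤ)| → (ρ i * ρ j) ^ 2 = 1

/-- A string C-group: an sggi satisfying the intersection property. -/
def IsStringC {n r : ℕ} (ρ : Fin r → Equiv.Perm (Fin n)) : Prop :=
  IsSggi ρ ∧ ∀ J K : Set (Fin r),
    Subgroup.closure (ρ '' J) ⊓ Subgroup.closure (ρ '' K) =
      Subgroup.closure (ρ '' (J ∩ K))

set_option linter.unusedSectionVars false

namespace StringPerm

open Equiv
open scoped Pointwise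

variable {X : Type*}

/-- The subgroup generated by the `ρ i` with `i ∈ S`. -/
def gen (ρ : ℤ → Perm X) (S : Finset ℤ) : Subgroup (Perm X) :=
  Subgroup.closure (Set.image ρ (S : Set ℤ))

/-- No generator lies in the subgroup generated by the others. -/
def Indep (ρ : ℤ → Perm X) (S : Finset ℤ) : Prop :=
  ∀ i ∈ S, ρ i ∉ gen ρ (S.erase i)

/-- Generators with nonconsecutive indices commute. -/
def Str (ρ : ℤ → Perm X) (S : Finset ℤ) : Prop :=
  ∀ i ∈ S, ∀ j ∈ S, i + 1 < j → Commute (ρ i) (ρ j)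

/-- The generators indexed by `A` commute with those indexed by `B`. -/
def Comm (ρ : ℤ → Perm X) (A B : Finset ℤ) : Prop :=
  ∀ i ∈ A, ∀ j ∈ B, Commute (ρ i) (ρ j)

/-- `H` carries any point of `Y` to any other. -/
def Tr (H : Subgroup (Perm X)) (Y : Set X) : Prop :=
  ∀ x ∈ Y, ∀ y ∈ Y, ∃ g ∈ H, g x = y

/-- `H` preserves `Y`. -/
def Inv (H : Subgroup (Perm X)) (Y : Set X) : Prop :=
  ∀ g ∈ H, ∀ x ∈ Y, g x ∈ Y

/-- Only the identity of `H` fixes `Y` pointwise. -/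
def Faith (H : Subgroup (Perm X)) (Y : Set X) : Prop :=
  ∀ g ∈ H, (∀ x ∈ Y, g x = x) → g = 1

/-- The orbit of a point. -/
def orb (H : Subgroup (Perm X)) (x : X) : Set X :=
  {y | ∃ g ∈ H, g x = y}

/-- The number of orbits of `H` that meet `Y`. -/
noncomputable def norb (H : Subgroup (Perm X)) (Y : Set X) : ℕ :=
  (orb H '' Y).ncard

section Basic

variable {ρ : ℤ → Perm X} {A B S T : Finset ℤ} {H K : Subgroup (Perm X)} {Y Y' : Set X}

theorem mem_gen {i : ℤ} (hi : i ∈ S) : ρ i ∈ gen ρ S :=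
  Subgroup.subset_closure ⟨i, hi, rfl⟩

theorem gen_mono (h : S ⊆ T) : gen ρ S ≤ gen ρ T :=
  Subgroup.closure_mono (Set.image_mono (by exact_mod_cast h))

theorem gen_le : gen ρ S ≤ H ↔ ∀ i ∈ S, ρ i ∈ H := by
  rw [gen, Subgroup.closure_le]
  constructor
  · exact fun h i hi => h ⟨i, hi, rfl⟩
  · rintro h _ ⟨i, hi, rfl⟩
    exact h i hi

@[simp] theorem gen_empty : gen ρ ∅ = ⊥ := by simp [gen]

theorem Indep.mono (h : Indep ρ S) (hT : T ⊆ S) : Indep ρ T := fun i hi hm =>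
  h i (hT hi) (gen_mono (Finset.erase_subset_erase i hT) hm)

theorem Indep.not_mem (h : Indep ρ S) (hT : T ⊆ S) {i : ℤ} (hi : i ∈ S) (hiT : i ∉ T) :
    ρ i ∉ gen ρ T := fun hm =>
  h i hi (gen_mono (fun _ hj => Finset.mem_erase.2 ⟨by rintro rfl; exact hiT hj, hT hj⟩) hm)

theorem Indep.ne_one (h : Indep ρ S) {i : ℤ} (hi : i ∈ S) : ρ i ≠ 1 := fun e =>
  h i hi (e ▸ one_mem _)

theorem Indep.injOn (h : Indep ρ S) {i j : ℤ} (hi : i ∈ S) (hj : j ∈ S) (e : ρ i = ρ j) :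
    i = j := by
  by_contra hne
  exact h i hi (e ▸ mem_gen (Finset.mem_erase.2 ⟨fun e => hne e.symm, hj⟩))

theorem Str.mono (h : Str ρ S) (hT : T ⊆ S) : Str ρ T := fun i hi j hj =>
  h i (hT hi) j (hT hj)

theorem Comm.symm (h : Comm ρ A B) : Comm ρ B A := fun i hi j hj => (h j hj i hi).symm

theorem commute_gen {g : Perm X} (h : ∀ i ∈ A, Commute (ρ i) g) {a : Perm X}
    (ha : a ∈ gen ρ A) : Commute a g := by
  have : gen ρ A ≤ Subgroup.centralizer {g} := gen_le.2 fun i hi => by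
    rw [Subgroup.mem_centralizer_singleton_iff]; exact h i hi
  exact Subgroup.mem_centralizer_singleton_iff.1 (this ha)

theorem Comm.commute (h : Comm ρ A B) {a b : Perm X} (ha : a ∈ gen ρ A) (hb : b ∈ gen ρ B) :
    Commute a b :=
  commute_gen (fun i hi => (commute_gen (fun j hj => (h i hi j hj).symm) hb).symm) ha

theorem Comm.exists_mul (h : Comm ρ A B) {g : Perm X} (hg : g ∈ gen ρ (A ∪ B)) :
    ∃ a ∈ gen ρ A, ∃ b ∈ gen ρ B, g = a * b := by
  rw [gen, Finset.coe_union] at hg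
  induction hg using Subgroup.closure_induction with
  | mem x hx =>
    obtain ⟨i, hi | hi, rfl⟩ := hx
    · exact ⟨_, mem_gen hi, 1, one_mem _, (mul_one _).symm⟩
    · exact ⟨1, one_mem _, _, mem_gen hi, (one_mul _).symm⟩
  | one => exact ⟨1, one_mem _, 1, one_mem _, (mul_one _).symm⟩
  | mul x y _ _ hx hy =>
    obtain ⟨a, ha, b, hb, rfl⟩ := hx
    obtain ⟨a', ha', b', hb', rfl⟩ := hy
    refine ⟨a * a', mul_mem ha ha', b * b', mul_mem hb hb', ?_⟩
    have := (h.commute ha' hb).eq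
    rw [mul_assoc, ← mul_assoc b, ← this]; group
  | inv x _ hx =>
    obtain ⟨a, ha, b, hb, rfl⟩ := hx
    refine ⟨a⁻¹, inv_mem ha, b⁻¹, inv_mem hb, ?_⟩
    rw [mul_inv_rev]
    exact ((h.commute ha hb).inv_inv).eq.symm

theorem mem_orb_self (x : X) : x ∈ orb H x := ⟨1, one_mem _, rfl⟩

theorem apply_mem_orb {g : Perm X} (hg : g ∈ H) (x : X) : g x ∈ orb H x := ⟨g, hg, rfl⟩

theorem mem_orb_trans {x y z : X} (h : y ∈ orb H x) (h' : z ∈ orb H y) : z ∈ orb H x := by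
  obtain ⟨g, hg, rfl⟩ := h
  obtain ⟨g', hg', rfl⟩ := h'
  exact ⟨g' * g, mul_mem hg' hg, rfl⟩

theorem mem_orb_symm {x y : X} (h : y ∈ orb H x) : x ∈ orb H y := by
  obtain ⟨g, hg, rfl⟩ := h
  exact ⟨g⁻¹, inv_mem hg, by simp⟩

theorem orb_eq_iff {x y : X} : orb H x = orb H y ↔ y ∈ orb H x := by
  constructor
  · intro h; rw [h]; exact mem_orb_self y
  · intro h
    ext z
    exact ⟨fun hz => mem_orb_trans (mem_orb_symm h) hz, fun hz => mem_orb_trans h hz⟩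

theorem orb_eq_of_mem {x y : X} (h : y ∈ orb H x) : orb H y = orb H x :=
  (orb_eq_iff.2 h).symm

theorem orb_mono (h : H ≤ K) (x : X) : orb H x ⊆ orb K x := fun _ ⟨g, hg, e⟩ => ⟨g, h hg, e⟩

theorem Tr.mono (h : Tr H Y) (hK : H ≤ K) : Tr K Y := fun x hx y hy =>
  let ⟨g, hg, e⟩ := h x hx y hy
  ⟨g, hK hg, e⟩

theorem Inv.mono (h : Inv K Y) (hK : H ≤ K) : Inv H Y := fun g hg => h g (hK hg)

theorem Faith.mono (h : Faith K Y) (hK : H ≤ K) : Faith H Y := fun g hg => h g (hK hg)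

theorem Inv.orb_subset (h : Inv H Y) {x : X} (hx : x ∈ Y) : orb H x ⊆ Y := by
  rintro _ ⟨g, hg, rfl⟩
  exact h g hg x hx

theorem Inv.apply_mem_iff (h : Inv H Y) {g : Perm X} (hg : g ∈ H) {x : X} :
    g x ∈ Y ↔ x ∈ Y :=
  ⟨fun hx => by simpa using h _ (inv_mem hg) _ hx, h g hg x⟩

theorem inv_orb (x : X) : Inv H (orb H x) := fun _ hg _ hy =>
  mem_orb_trans hy (apply_mem_orb hg _)

theorem tr_orb (x : X) : Tr H (orb H x) := fun _ hy _ hz =>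
  mem_orb_trans (mem_orb_symm hy) hz

theorem Tr.orb_eq (h : Tr H Y) (hi : Inv H Y) {x : X} (hx : x ∈ Y) : orb H x = Y :=
  (hi.orb_subset hx).antisymm fun y hy => h x hx y hy

theorem tr_of_orb {x : X} (h : Y ⊆ orb H x) : Tr H Y := fun _ hy _ hz =>
  tr_orb x _ (h hy) _ (h hz)

theorem inv_univ : Inv H Set.univ := fun _ _ _ _ => trivial

theorem faith_univ : Faith H Set.univ := fun _ _ h => Equiv.ext fun x => h x trivial

theorem orb_bot (x : X) : orb (⊥ : Subgroup (Perm X)) x = {x} := by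
  ext y; constructor
  · rintro ⟨g, hg, rfl⟩
    rw [Subgroup.mem_bot.1 hg]; rfl
  · rintro rfl; exact mem_orb_self _

/-- If every generator moves points within the orbits of `H`, so does the generated group. -/
theorem apply_mem_orb_of_gens (hinv : Inv (gen ρ S) Y) (h : ∀ i ∈ S, ∀ x ∈ Y, ρ i x ∈ orb H x)
    {g : Perm X} (hg : g ∈ gen ρ S) : ∀ x ∈ Y, g x ∈ orb H x := by
  have key : ∀ g ∈ gen ρ S, (∀ x ∈ Y, g x ∈ orb H x) := by
    intro g hg
    have hg' := hg
    rw [gen] at hg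
    induction hg using Subgroup.closure_induction with
    | mem x hx =>
      obtain ⟨i, hi, rfl⟩ := hx
      exact h i hi
    | one => exact fun x _ => mem_orb_self x
    | mul a b ha hb iha ihb =>
      intro x hx
      exact mem_orb_trans (ihb hb x hx) (iha ha _ (hinv b hb x hx))
    | inv a ha iha =>
      intro x hx
      have := iha ha _ (hinv _ hg' x hx)
      rw [← Perm.mul_apply, mul_inv_cancel, Perm.one_apply] at this
      exact mem_orb_symm this
  exact key g hg

theorem inv_gen_of [Finite X] (h : ∀ i ∈ S, ∀ x ∈ Y, ρ i x ∈ Y) : Inv (gen ρ S) Y := by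
  have : gen ρ S ≤ MulAction.stabilizer (Perm X) Y := by
    refine gen_le.2 fun i hi => ?_
    rw [MulAction.mem_stabilizer_set_iff_smul_set_subset Y.toFinite]
    rintro _ ⟨x, hx, rfl⟩
    exact h i hi x hx
  intro g hg x hx
  have h1 := MulAction.mem_stabilizer_iff.1 (this hg)
  rw [← h1]
  exact ⟨x, hx, rfl⟩

/-- A point fixed by all generators is fixed by the generated group. -/
theorem fix_of_gens {x : X} (h : ∀ i ∈ S, ρ i x = x) {g : Perm X} (hg : g ∈ gen ρ S) :
    g x = x := by
  have : gen ρ S ≤ MulAction.stabilizer (Perm X) x := gen_le.2 fun i hi =>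
    MulAction.mem_stabilizer_iff.2 (h i hi)
  exact MulAction.mem_stabilizer_iff.1 (this hg)

theorem image_orb_eq (h : H ≤ K) :
    orb K '' Y = (fun O => ⋃ z ∈ O, orb K z) '' (orb H '' Y) := by
  rw [Set.image_image]
  refine Set.image_congr fun x _ => ?_
  ext y
  simp only [Set.mem_iUnion]
  constructor
  · exact fun hy => ⟨x, mem_orb_self x, hy⟩
  · rintro ⟨z, hz, hy⟩
    exact mem_orb_trans (orb_mono h x hz) hy

theorem orb_image_of_commute {a : Perm X} (h : ∀ b ∈ H, Commute a b) (x : X) :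
    orb H (a x) = a '' orb H x := by
  ext y
  constructor
  · rintro ⟨b, hb, rfl⟩
    exact ⟨b x, ⟨b, hb, rfl⟩, by rw [← Perm.mul_apply, (h b hb).eq, Perm.mul_apply]⟩
  · rintro ⟨_, ⟨b, hb, rfl⟩, rfl⟩
    exact ⟨b, hb, by rw [← Perm.mul_apply, ← (h b hb).eq, Perm.mul_apply]⟩

theorem Comm.faith_orb (h : Comm ρ A B) (htr : Tr (gen ρ (A ∪ B)) Y)
    (hf : Faith (gen ρ B) Y) {x : X} (hx : x ∈ Y) :
    Faith (gen ρ B) (orb (gen ρ B) x) := by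
  intro c hc hfix
  refine hf c hc fun y hy => ?_
  obtain ⟨g, hg, rfl⟩ := htr x hx y hy
  obtain ⟨a, ha, b, hb, rfl⟩ := h.exists_mul hg
  rw [Perm.mul_apply, ← Perm.mul_apply c, ← (h.commute ha hc).eq, Perm.mul_apply,
    hfix _ (apply_mem_orb hb x)]

/-- A group commuting with a transitive one is semiregular. -/
theorem eq_one_of_fix (htr : Tr K Y) (hf : Faith H Y) (hc : ∀ a ∈ K, ∀ b ∈ H, Commute a b)
    {b : Perm X} (hb : b ∈ H) {x : X} (hx : x ∈ Y) (e : b x = x) : b = 1 := by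
  refine hf b hb fun y hy => ?_
  obtain ⟨a, ha, rfl⟩ := htr x hx y hy
  rw [← Perm.mul_apply, ← (hc a ha b hb).eq, Perm.mul_apply, e]

theorem card_eq_ncard_orb (x : X) (h : ∀ b ∈ H, b x = x → b = 1) :
    Nat.card H = (orb H x).ncard := by
  rw [← Nat.card_coe_set_eq]
  refine Nat.card_congr (Equiv.ofBijective (fun g : H => ⟨g.1 x, apply_mem_orb g.2 x⟩) ⟨?_, ?_⟩)
  · intro g g' e
    have e' : g.1 x = g'.1 x := congrArg Subtype.val e
    have := h (g'.1⁻¹ * g.1) (mul_mem (inv_mem g'.2) g.2) (by simp [e'])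
    exact Subtype.ext (inv_mul_eq_one.1 this).symm
  · rintro ⟨_, g, hg, rfl⟩
    exact ⟨⟨g, hg⟩, rfl⟩

theorem Comm.ncard_orb_eq (h : Comm ρ A B) (htr : Tr (gen ρ (A ∪ B)) Y)
    {x y : X} (hx : x ∈ Y) (hy : y ∈ Y) :
    (orb (gen ρ B) y).ncard = (orb (gen ρ B) x).ncard := by
  obtain ⟨g, hg, rfl⟩ := htr x hx y hy
  obtain ⟨a, ha, b, hb, rfl⟩ := h.exists_mul hg
  rw [Perm.mul_apply, orb_image_of_commute (fun c hc => h.commute ha hc),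
    orb_eq_of_mem (apply_mem_orb hb x)]
  exact Set.ncard_image_of_injective _ a.injective

end Basic

section Count

variable [Finite X] {ρ : ℤ → Perm X} {A B S T : Finset ℤ} {H K : Subgroup (Perm X)} {Y Y' : Set X}

theorem norb_pos (hY : Y.Nonempty) : 1 ≤ norb H Y :=
  (Set.ncard_pos (Set.toFinite _)).2 (hY.image _)

theorem norb_anti (h : H ≤ K) : norb K Y ≤ norb H Y := by
  rw [norb, image_orb_eq h]
  exact Set.ncard_image_le (Set.toFinite _)

theorem norb_mono_set (h : Y ⊆ Y') : norb H Y ≤ norb H Y' :=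
  Set.ncard_le_ncard (Set.image_mono h) (Set.toFinite _)

theorem norb_le_ncard : norb H Y ≤ Y.ncard := Set.ncard_image_le (Set.toFinite _)

theorem norb_lt (h : H ≤ K) {x y : X} (hx : x ∈ Y) (hy : y ∈ Y) (hK : y ∈ orb K x)
    (hH : y ∉ orb H x) : norb K Y < norb H Y := by
  refine lt_of_le_of_ne (norb_anti h) fun e => hH ?_
  rw [norb, image_orb_eq h, norb, Set.ncard_image_iff (Set.toFinite _)] at e
  have hun : ∀ z, (⋃ w ∈ orb H z, orb K w) = orb K z := by
    intro z; ext u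
    simp only [Set.mem_iUnion]
    constructor
    · rintro ⟨w, hw, hu⟩
      exact mem_orb_trans (orb_mono h z hw) hu
    · exact fun hu => ⟨z, mem_orb_self z, hu⟩
  have := e ⟨x, hx, rfl⟩ ⟨y, hy, rfl⟩ (by simp only [hun]; exact orb_eq_iff.2 hK)
  exact orb_eq_iff.1 this

theorem tr_of_norb_le_one (h : norb H Y ≤ 1) : Tr H Y := by
  intro x hx y hy
  have := (Set.ncard_le_one (Set.toFinite _)).1 h _ ⟨x, hx, rfl⟩ _ ⟨y, hy, rfl⟩
  exact orb_eq_iff.1 this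

/-- Removing essential generators one at a time increases the number of orbits. -/
theorem card_add_one_le_norb {E : Finset ℤ} (hE : E ⊆ S) (hY : Y.Nonempty)
    (hinv : Inv (gen ρ S) Y) (hess : ∀ e ∈ E, ¬ Tr (gen ρ (S.erase e)) Y) (htr : Tr (gen ρ S) Y) :
    E.card + 1 ≤ norb (gen ρ (S \ E)) Y := by
  induction E using Finset.induction_on with
  | empty => simpa using norb_pos hY
  | insert e E he ih =>
    have hES : E ⊆ S := fun i hi => hE (Finset.mem_insert_of_mem hi)
    have heS : e ∈ S := hE (Finset.mem_insert_self e E)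
    have h1 := ih hES fun i hi => hess i (Finset.mem_insert_of_mem hi)
    rw [Finset.card_insert_of_notMem he]
    suffices norb (gen ρ (S \ E)) Y < norb (gen ρ (S \ insert e E)) Y by omega
    have hle : gen ρ (S \ insert e E) ≤ gen ρ (S \ E) :=
      gen_mono (Finset.sdiff_subset_sdiff le_rfl (Finset.subset_insert e E))
    by_contra hnot
    refine hess e (Finset.mem_insert_self e E) fun x hx y hy => ?_
    obtain ⟨g, hg, rfl⟩ := htr x hx y hy
    refine apply_mem_orb_of_gens hinv (H := gen ρ (S.erase e)) ?_ hg x hx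
    intro i hi z hz
    by_cases hie : i = e
    · subst hie
      have hz' : ρ i z ∈ Y := hinv _ (mem_gen hi) z hz
      by_contra hno
      refine hnot (norb_lt hle hz hz' (apply_mem_orb (mem_gen ?_) z) fun hmem => hno ?_)
      · exact Finset.mem_sdiff.2 ⟨hi, he⟩
      · refine orb_mono (gen_mono ?_) z hmem
        intro j hj
        simp only [Finset.mem_sdiff, Finset.mem_insert, not_or] at hj
        exact Finset.mem_erase.2 ⟨hj.2.1, hj.1⟩
    · exact apply_mem_orb (mem_gen (Finset.mem_erase.2 ⟨hie, hi⟩)) z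

/-- When all orbits have the same size, the sizes multiply up. -/
theorem norb_mul_eq {c : ℕ} (hinv : Inv H Y) (h : ∀ x ∈ Y, (orb H x).ncard = c) :
    norb H Y * c = Y.ncard := by
  classical
  have hf := Y.toFinite
  have h1 := Finset.card_eq_sum_card_image (orb H) hf.toFinset
  rw [Set.ncard_eq_toFinset_card Y hf, h1, Finset.sum_const_nat (m := c)]
  · rw [norb, Set.ncard_eq_toFinset_card _ (Set.toFinite _)]
    congr 2
    ext O; simp
  · intro O hO
    obtain ⟨x, hx, rfl⟩ := Finset.mem_image.1 hO
    rw [Set.Finite.mem_toFinset] at hx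
    rw [← h x hx, ← Set.ncard_coe_finset]
    congr 1
    ext y
    simp only [Finset.coe_filter, Set.Finite.mem_toFinset, Set.mem_ofPred_eq]
    constructor
    · rintro ⟨_, e⟩
      exact orb_eq_iff.1 e.symm
    · exact fun hy => ⟨hinv.orb_subset hx hy, orb_eq_of_mem hy⟩

theorem one_le_ncard_orb (x : X) : 1 ≤ (orb H x).ncard :=
  (Set.ncard_pos (Set.toFinite _)).2 ⟨x, mem_orb_self x⟩

theorem Comm.norb_le (h : Comm ρ A B) (htr : Tr (gen ρ (A ∪ B)) Y)
    {x : X} (hx : x ∈ Y) : norb (gen ρ B) Y ≤ norb (gen ρ B) (orb (gen ρ A) x) := by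
  refine Set.ncard_le_ncard ?_ (Set.toFinite _)
  rintro _ ⟨y, hy, rfl⟩
  obtain ⟨g, hg, rfl⟩ := htr x hx y hy
  obtain ⟨a, ha, b, hb, rfl⟩ := h.exists_mul hg
  refine ⟨a x, apply_mem_orb ha x, ?_⟩
  rw [(h.commute ha hb).eq, Perm.mul_apply]
  exact (orb_eq_of_mem (apply_mem_orb hb _)).symm

theorem two_mul_card_le (h : H ≤ K) {g : Perm X} (hg : g ∈ K) (hgH : g ∉ H) :
    2 * Nat.card H ≤ Nat.card K := by
  have h3 := Subgroup.card_mul_index (H.subgroupOf K)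
  rw [Nat.card_congr (Subgroup.subgroupOfEquivOfLe h).toEquiv] at h3
  rw [← h3, mul_comm]
  refine Nat.mul_le_mul le_rfl ?_
  have h4 : (H.subgroupOf K).index ≠ 0 := Subgroup.index_ne_zero_of_finite
  have h5 : (H.subgroupOf K).index ≠ 1 := by
    rw [Ne, Subgroup.index_eq_one, Subgroup.subgroupOf_eq_top]
    exact fun hh => hgH (hh hg)
  omega

theorem two_pow_le_card (h : Indep ρ S) : 2 ^ S.card ≤ Nat.card (gen ρ S) := by
  induction S using Finset.induction_on with
  | empty => simp
  | insert i S hi ih =>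
    rw [Finset.card_insert_of_notMem hi, pow_succ]
    have h1 := ih (h.mono (Finset.subset_insert i S))
    have h2 := h.not_mem (Finset.subset_insert i S) (Finset.mem_insert_self i S) hi
    have h3 := two_mul_card_le (gen_mono (Finset.subset_insert i S))
      (mem_gen (Finset.mem_insert_self i S)) h2
    omega

theorem ncard_orb_le_card (x : X) : (orb H x).ncard ≤ Nat.card H := by
  rw [← Nat.card_coe_set_eq]
  refine Nat.card_le_card_of_surjective (fun g : H => ⟨g.1 x, apply_mem_orb g.2 x⟩) ?_
  rintro ⟨_, g, hg, rfl⟩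
  exact ⟨⟨g, hg⟩, rfl⟩

end Count

end StringPerm

namespace StringPerm

open Equiv
open scoped Pointwise

variable {X : Type*} {ρ : ℤ → Perm X} {A B S T : Finset ℤ} {H K : Subgroup (Perm X)} {Y Y' : Set X}

/-- The indices of `S` below `i`. -/
def low (S : Finset ℤ) (i : ℤ) : Finset ℤ := S.filter (· < i)

/-- The indices of `S` above `i`. -/
def high (S : Finset ℤ) (i : ℤ) : Finset ℤ := S.filter (i < ·)

theorem mem_low {i j : ℤ} : j ∈ low S i ↔ j ∈ S ∧ j < i := Finset.mem_filter

theorem mem_high {i j : ℤ} : j ∈ high S i ↔ j ∈ S ∧ i < j := Finset.mem_filter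

theorem low_subset (i : ℤ) : low S i ⊆ S := Finset.filter_subset _ _

theorem high_subset (i : ℤ) : high S i ⊆ S := Finset.filter_subset _ _

theorem erase_eq_low_union_high (i : ℤ) : S.erase i = low S i ∪ high S i := by
  ext j
  simp only [Finset.mem_erase, Finset.mem_union, mem_low, mem_high]
  have : j ≠ i ↔ j < i ∨ i < j := lt_or_lt_iff_ne.symm
  tauto

theorem Str.comm_low_high (h : Str ρ S) (i : ℤ) : Comm ρ (low S i) (high S i) := by
  intro j hj l hl
  rw [mem_low] at hj
  rw [mem_high] at hl
  exact h j hj.1 l hl.1 (by omega)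

theorem card_split {i : ℤ} (hi : i ∈ S) : (low S i).card + (high S i).card + 1 = S.card := by
  rw [← Finset.card_union_of_disjoint, ← erase_eq_low_union_high, Finset.card_erase_add_one hi]
  rw [Finset.disjoint_left]
  intro j hj hj'
  rw [mem_low] at hj
  rw [mem_high] at hj'
  omega

theorem Faith.exists_ne (h : Faith H Y) {g : Perm X} (hg : g ∈ H) (h1 : g ≠ 1) :
    ∃ x ∈ Y, g x ≠ x := by
  by_contra hh
  push Not at hh
  exact h1 (h g hg hh)

/-- A transitive abelian group contains whatever commutes with it. -/
theorem mem_of_abelian (hY : Y.Nonempty) (htr : Tr H Y) (hab : ∀ a ∈ H, ∀ b ∈ H, Commute a b)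
    {z : Perm X} (hz : ∀ a ∈ H, Commute a z) (hzY : ∀ y ∈ Y, z y ∈ Y)
    (hf : ∀ a ∈ H, (∀ y ∈ Y, z y = a y) → z = a) : z ∈ H := by
  obtain ⟨x, hx⟩ := hY
  obtain ⟨a, ha, e⟩ := htr x hx _ (hzY x hx)
  rw [hf a ha fun y hy => ?_]
  · exact ha
  · obtain ⟨c, hc, rfl⟩ := htr x hx y hy
    rw [← Perm.mul_apply, ← (hz c hc).eq, Perm.mul_apply, ← e, ← Perm.mul_apply, ← Perm.mul_apply,
      (hab c hc a ha).eq]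

section

variable [Finite X]

theorem Comm.norb_mul (h : Comm ρ A B) (htr : Tr (gen ρ (A ∪ B)) Y)
    (hinv : Inv (gen ρ (A ∪ B)) Y) {x : X} (hx : x ∈ Y) :
    norb (gen ρ B) Y * (orb (gen ρ B) x).ncard = Y.ncard :=
  norb_mul_eq (hinv.mono (gen_mono Finset.subset_union_right)) fun _ hy => h.ncard_orb_eq htr hx hy

theorem two_le_norb (h : ¬ Tr H Y) : 2 ≤ norb H Y := by
  by_contra hh
  exact h (tr_of_norb_le_one (by omega))

theorem norb_lt_ncard {g : Perm X} (hg : g ∈ H) (hinv : Inv H Y) {x : X} (hx : x ∈ Y)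
    (h : g x ≠ x) : norb H Y + 1 ≤ Y.ncard := by
  have h1 := norb_lt (Y := Y) (bot_le : ⊥ ≤ H) hx (hinv g hg x hx) (apply_mem_orb hg x)
    (by rw [orb_bot]; exact h)
  have h2 := norb_le_ncard (H := (⊥ : Subgroup (Perm X))) (Y := Y)
  omega

theorem Faith.two_le_ncard (hf : Faith (gen ρ S) Y) (hinv : Inv (gen ρ S) Y) (hS : Indep ρ S)
    (hne : S.Nonempty) : 2 ≤ Y.ncard := by
  obtain ⟨i, hi⟩ := hne
  obtain ⟨x, hx, h⟩ := hf.exists_ne (mem_gen hi) (hS.ne_one hi)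
  exact (Set.one_lt_ncard (Set.toFinite _)).2 ⟨_, hinv _ (mem_gen hi) x hx, x, hx, h⟩

/-- A subgroup acting faithfully on four points and commuting with an element acting
nontrivially has order at most `8`. -/
theorem card_le_eight (hY : Y.ncard = 4) (hinv : Inv H Y) (hf : Faith H Y) {t : Perm X}
    (hc : ∀ g ∈ H, Commute g t) (ht : ∀ y ∈ Y, t y ∈ Y) {x : X} (hx : x ∈ Y) (hne : t x ≠ x) :
    Nat.card H ≤ 8 := by
  classical
  have hfin := Y.toFinite
  set F := hfin.toFinset with hF
  have hFc : F.card = 4 := by rw [← hY, Set.ncard_eq_toFinset_card Y hfin]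
  have hmem : ∀ y, y ∈ F ↔ y ∈ Y := fun y => hfin.mem_toFinset
  have hpair : ∀ u ∈ Y, t u ≠ u → (F \ {u, t u}).card = 2 := by
    intro u hu hne
    rw [Finset.card_sdiff_of_subset, hFc, Finset.card_pair hne.symm]
    intro v hv
    rcases Finset.mem_insert.1 hv with rfl | hv
    · exact (hmem _).2 hu
    · rw [Finset.mem_singleton.1 hv]; exact (hmem _).2 (ht u hu)
  obtain ⟨y, hy⟩ : (F \ {x, t x}).Nonempty := by
    rw [← Finset.card_pos, hpair x hx hne]; norm_num
  simp only [Finset.mem_sdiff, hmem, Finset.mem_insert, Finset.mem_singleton, not_or] at hy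
  have hcomm : ∀ g ∈ H, ∀ u, g (t u) = t (g u) := fun g hg u => by
    rw [← Perm.mul_apply, (hc g hg).eq, Perm.mul_apply]
  have hfix : ∀ g ∈ H, g x = x → g y = y → g = 1 := by
    intro g hg h1 h2
    refine hf g hg fun w hw => ?_
    by_contra hw'
    have h3 : g (t x) = t x := by rw [hcomm g hg, h1]
    have hsub : ({x, t x, y, w, g w} : Finset X) ⊆ F := by
      intro v hv
      simp only [Finset.mem_insert, Finset.mem_singleton] at hv
      rw [hmem]
      rcases hv with rfl | rfl | rfl | rfl | rfl
      exacts [hx, ht _ hx, hy.1, hw, hinv g hg w hw]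
    have h5 := Finset.card_le_card hsub
    have hinj := g.injective
    have e1 : w ≠ x := fun e => hw' (by rw [e, h1])
    have e2 : w ≠ t x := fun e => hw' (by rw [e, h3])
    have e3 : w ≠ y := fun e => hw' (by rw [e, h2])
    have e4 : g w ≠ x := fun e => e1 (hinj (e.trans h1.symm))
    have e5 : g w ≠ t x := fun e => e2 (hinj (e.trans h3.symm))
    have e6 : g w ≠ y := fun e => e3 (hinj (e.trans h2.symm))
    rw [Finset.card_insert_of_notMem, Finset.card_insert_of_notMem, Finset.card_insert_of_notMem,
      Finset.card_pair (Ne.symm hw')] at h5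
    · omega
    · simp [e3.symm, e6.symm]
    · simp [Ne.symm hy.2.2, e2.symm, e5.symm]
    · simp [Ne.symm hy.2.1, e1.symm, e4.symm, hne.symm]
  let P := (F.filter fun u => t u ≠ u).sigma fun u => F \ {u, t u}
  have hP : P.card ≤ 8 := by
    rw [Finset.card_sigma, Finset.sum_const_nat (m := 2)]
    · have := Finset.card_filter_le F (fun u => t u ≠ u)
      omega
    · intro u hu
      rw [Finset.mem_filter, hmem] at hu
      exact hpair u hu.1 hu.2
  have hmaps : ∀ g : H, (⟨g.1 x, g.1 y⟩ : Σ _ : X, X) ∈ P := by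
    intro g
    have hinj := g.1.injective
    simp only [P, Finset.mem_sigma, Finset.mem_filter, hmem, Finset.mem_sdiff, Finset.mem_insert,
      Finset.mem_singleton, ← hcomm g.1 g.2, hinj.eq_iff, not_or, hinv.apply_mem_iff g.2]
    exact ⟨⟨hx, fun e => hne (hinj e)⟩, hy⟩
  refine le_trans ?_ hP
  have hinjective : Function.Injective fun g : H => (⟨⟨g.1 x, g.1 y⟩, hmaps g⟩ : P) := by
    intro g g' e
    have e1 := congrArg Subtype.val e
    simp only [Sigma.mk.injEq, heq_eq_eq] at e1
    have := hfix (g'.1⁻¹ * g.1) (mul_mem (inv_mem g'.2) g.2) (by simp [e1.1]) (by simp [e1.2])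
    exact Subtype.ext (inv_mul_eq_one.1 this).symm
  simpa using Nat.card_le_card_of_injective _ hinjective

theorem mem_of_four (hY : Y.ncard = 4) (hHK : H ≤ K) (hinv : Inv K Y) (hf : Faith K Y)
    (htr : Tr H Y) {z : Perm X} (hz : z ∈ K) (hc : ∀ g ∈ H, Commute g z) (h1 : z ≠ 1) : z ∈ H := by
  by_contra hzH
  obtain ⟨x, hx, hne⟩ := hf.exists_ne hz h1
  set L := K ⊓ Subgroup.centralizer {z} with hL
  have hLK : L ≤ K := inf_le_left
  have hHL : H ≤ L := le_inf hHK fun g hg => Subgroup.mem_centralizer_singleton_iff.2 (hc g hg)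
  have hzL : z ∈ L := ⟨hz, Subgroup.mem_centralizer_singleton_iff.2 rfl⟩
  have h8 : Nat.card L ≤ 8 := card_le_eight hY (hinv.mono hLK) (hf.mono hLK)
    (fun g hg => Subgroup.mem_centralizer_singleton_iff.1 hg.2) (hinv z hz) hx hne
  have h2 := two_mul_card_le hHL hzL hzH
  have h4 := ncard_orb_le_card (H := H) x
  rw [htr.orb_eq (hinv.mono hHK) hx, hY] at h4
  have hcard : Nat.card H = 2 ^ 2 := by omega
  have : Fact (Nat.Prime 2) := ⟨Nat.prime_two⟩
  have hab := IsPGroup.isMulCommutative_of_card_eq_prime_sq hcard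
  refine hzH (mem_of_abelian ⟨x, hx⟩ htr (fun a ha b hb => ?_) hc (hinv z hz) fun a ha e => ?_)
  · exact congrArg Subtype.val (hab.is_comm.comm (⟨a, ha⟩ : H) ⟨b, hb⟩)
  · have := hf (a⁻¹ * z) (mul_mem (inv_mem (hHK ha)) hz) fun y hy => by simp [e y hy]
    exact (inv_mul_eq_one.1 this).symm

theorem mem_of_prime {p : ℕ} [Fact p.Prime] (hcard : Nat.card H = p) (hY : Y.Nonempty)
    (hHK : H ≤ K) (hinv : Inv K Y) (hf : Faith K Y)
    (htr : Tr H Y) {z : Perm X} (hz : z ∈ K) (hc : ∀ g ∈ H, Commute g z) : z ∈ H := by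
  have : IsCyclic H := isCyclic_of_prime_card hcard
  refine mem_of_abelian hY htr (fun a ha b hb => ?_) hc (hinv z hz) fun a ha e => ?_
  · exact congrArg Subtype.val ((IsCyclic.isMulCommutative (α := H)).is_comm.comm
      (⟨a, ha⟩ : H) ⟨b, hb⟩)
  · have := hf (a⁻¹ * z) (mul_mem (inv_mem (hHK ha)) hz) fun y hy => by simp [e y hy]
    exact (inv_mul_eq_one.1 this).symm

end

/-- A string of independent generators acting transitively and faithfully on `Y`. -/
structure Good (ρ : ℤ → Perm X) (S : Finset ℤ) (Y : Set X) : Prop where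
  nonempty : Y.Nonempty
  str : Str ρ S
  indep : Indep ρ S
  inv : Inv (gen ρ S) Y
  tr : Tr (gen ρ S) Y
  faith : Faith (gen ρ S) Y

namespace Good

theorem orbit (h : Good ρ S Y) (hc : Comm ρ A B) (htr : Tr (gen ρ (A ∪ B)) Y) (hB : B ⊆ S)
    {x : X} (hx : x ∈ Y) : Good ρ B (orb (gen ρ B) x) where
  nonempty := ⟨x, mem_orb_self x⟩
  str := h.str.mono hB
  indep := h.indep.mono hB
  inv := inv_orb x
  tr := tr_orb x
  faith := hc.faith_orb htr (h.faith.mono (gen_mono hB)) hx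

variable [Finite X]

theorem two_pow_le (h : Good ρ S Y) (hc : Comm ρ A B) (htr : Tr (gen ρ A) Y) (hB : B ⊆ S)
    {x : X} (hx : x ∈ Y) : 2 ^ B.card ≤ (orb (gen ρ B) x).ncard := by
  rw [← card_eq_ncard_orb x fun b hb e => eq_one_of_fix htr (h.faith.mono (gen_mono hB))
    (fun _ ha _ hb => hc.commute ha hb) hb hx e]
  exact two_pow_le_card (h.indep.mono hB)

theorem norb_mul (h : Good ρ S Y) (hc : Comm ρ A B) (hA : A ⊆ S) (hB : B ⊆ S)
    (htr : Tr (gen ρ (A ∪ B)) Y) {x : X} (hx : x ∈ Y) :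
    norb (gen ρ B) Y * (orb (gen ρ B) x).ncard = Y.ncard :=
  hc.norb_mul htr (h.inv.mono (gen_mono (Finset.union_subset hA hB))) hx

theorem exists_size (h : Good ρ S Y)
    (ih : ∀ S' Y', Y'.ncard < Y.ncard → Good ρ S' Y' → S'.card + 1 ≤ Y'.ncard)
    (hc : Comm ρ A B) (hA : A ⊆ S) (hB : B ⊆ S) (htr : Tr (gen ρ (A ∪ B)) Y)
    (hn : ¬ Tr (gen ρ B) Y) : ∃ b t, 2 ≤ t ∧ B.card + 1 ≤ b ∧ t * b = Y.ncard ∧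
      norb (gen ρ B) Y = t ∧ ∀ x ∈ Y, (orb (gen ρ B) x).ncard = b := by
  obtain ⟨x, hx⟩ := h.nonempty
  have h1 := h.norb_mul hc hA hB htr hx
  have h2 := two_le_norb hn
  have h3 := one_le_ncard_orb (H := gen ρ B) x
  refine ⟨_, _, h2, ih B _ ?_ (h.orbit hc htr hB hx), h1, rfl, fun y hy => hc.ncard_orb_eq htr hx hy⟩
  nlinarith

theorem card_of_both_intransitive (h : Good ρ S Y)
    (ih : ∀ S' Y', Y'.ncard < Y.ncard → Good ρ S' Y' → S'.card + 1 ≤ Y'.ncard)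
    (hc : Comm ρ A B) (hA : A ⊆ S) (hB : B ⊆ S) (htr : Tr (gen ρ (A ∪ B)) Y)
    (hs : A.card + B.card + 1 = S.card)
    (hnA : ¬ Tr (gen ρ A) Y) (hnB : ¬ Tr (gen ρ B) Y) : S.card + 1 ≤ Y.ncard := by
  obtain ⟨b, t, ht, hb, htb, -, -⟩ := h.exists_size ih hc hA hB htr hnB
  obtain ⟨a, u, hu, ha, hua, -, -⟩ := h.exists_size ih hc.symm hB hA
    (by rwa [Finset.union_comm]) hnA
  nlinarith

theorem card_of_one_essential (h : Good ρ S Y)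
    (ih : ∀ S' Y', Y'.ncard < Y.ncard → Good ρ S' Y' → S'.card + 1 ≤ Y'.ncard)
    {i : ℤ} (hi : i ∈ S) (he : S.erase i = A ∪ B)
    (hc : Comm ρ A B) (htr : Tr (gen ρ (A ∪ B)) Y)
    (hs : A.card + B.card + 1 = S.card) (hess : ∀ e ∈ A, ¬ Tr (gen ρ (S.erase e)) Y)
    (hnB : ¬ Tr (gen ρ B) Y) : S.card + 1 ≤ Y.ncard := by
  have hAB : A ∪ B ⊆ S := he ▸ Finset.erase_subset i S
  have hA := Finset.union_subset_left hAB
  have hB := Finset.union_subset_right hAB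
  obtain ⟨b, t, ht, hb, htb, hnt, -⟩ := h.exists_size ih hc hA hB htr hnB
  have h1 := card_add_one_le_norb hA h.nonempty h.inv hess h.tr
  have hiA : i ∉ A := fun hh => by
    have : i ∈ S.erase i := he ▸ Finset.mem_union_left _ hh
    simp at this
  rcases Nat.lt_or_ge 1 b with hb2 | hb1
  · have hBS : B ⊆ S \ A := by
      intro j hj
      refine Finset.mem_sdiff.2 ⟨hB hj, fun hjA => ?_⟩
      have h5 : A.card + B.card = (A ∪ B).card := by
        rw [← he, Finset.card_erase_of_mem hi]; omega
      rw [Eq.comm, Finset.card_union_eq_card_add_card] at h5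
      exact Finset.disjoint_left.1 h5 hjA hj
    have h2 := norb_anti (Y := Y) (gen_mono (ρ := ρ) hBS)
    nlinarith
  · obtain ⟨x, hx, hne⟩ := h.faith.exists_ne (mem_gen hi) (h.indep.ne_one hi)
    have h2 := norb_lt_ncard (mem_gen (ρ := ρ) (Finset.mem_sdiff.2 ⟨hi, hiA⟩))
      (h.inv.mono (gen_mono Finset.sdiff_subset)) hx hne
    omega

theorem two_mul_add_two_le {x n : ℕ} (h : 2 ^ x ≤ n) (hn : 6 ≤ n) : 2 * x + 2 ≤ n := by
  rcases Nat.lt_or_ge x 3 with hx | hx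
  · omega
  · refine le_trans ?_ h
    induction x, hx using Nat.le_induction with
    | base => norm_num
    | succ x hx ih =>
      have := ih (le_trans (Nat.pow_le_pow_right (by norm_num) (Nat.le_succ x)) h)
      rw [pow_succ]; omega

theorem add_two_le {x n : ℕ} (h : 2 ^ x ≤ n) (hn : 3 ≤ n) : x + 2 ≤ n := by
  rcases Nat.lt_or_ge x 2 with hx | hx
  · omega
  · refine le_trans ?_ h
    clear h
    induction x, hx using Nat.le_induction with
    | base => norm_num
    | succ x hx ih => rw [pow_succ]; omega

theorem card_of_both_transitive (h : Good ρ S Y)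
    {i : ℤ} (hi : i ∈ S) (he : S.erase i = A ∪ B) (hc : Comm ρ A B)
    (hs : A.card + B.card + 1 = S.card)
    (hA : Tr (gen ρ A) Y) (hB : Tr (gen ρ B) Y) : S.card + 1 ≤ Y.ncard := by
  have hAB : A ∪ B ⊆ S := he ▸ Finset.erase_subset i S
  have hAS := Finset.union_subset_left hAB
  have hBS := Finset.union_subset_right hAB
  obtain ⟨x, hx⟩ := h.nonempty
  have h1 := h.two_pow_le hc hA hBS hx
  have h2 := h.two_pow_le hc.symm hB hAS hx
  rw [hB.orb_eq (h.inv.mono (gen_mono hBS)) hx] at h1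
  rw [hA.orb_eq (h.inv.mono (gen_mono hAS)) hx] at h2
  have h2n := h.faith.two_le_ncard h.inv h.indep ⟨i, hi⟩
  rcases Nat.lt_or_ge Y.ncard 6 with h6 | h6
  · exfalso
    have hcard : Nat.card (gen ρ A) = Y.ncard := by
      rw [card_eq_ncard_orb x fun b hb e => eq_one_of_fix hB (h.faith.mono (gen_mono hAS))
        (fun _ ha _ hb => hc.symm.commute ha hb) hb hx e,
        hA.orb_eq (h.inv.mono (gen_mono hAS)) hx]
    obtain ⟨j, hj⟩ : B.Nonempty := by
      rw [Finset.nonempty_iff_ne_empty]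
      rintro rfl
      have := hB.orb_eq (h.inv.mono (gen_mono hBS)) hx
      rw [gen_empty, orb_bot] at this
      rw [← this, Set.ncard_singleton] at h2n
      omega
    have hjA : j ∉ A := fun hjA => by
      have h5 : A.card + B.card = (A ∪ B).card := by
        rw [← he, Finset.card_erase_of_mem hi]; omega
      rw [Eq.comm, Finset.card_union_eq_card_add_card] at h5
      exact Finset.disjoint_left.1 h5 hjA hj
    refine h.indep.not_mem hAS (hBS hj) hjA ?_
    have hcj : ∀ g ∈ gen ρ A, Commute g (ρ j) := fun g hg => hc.commute hg (mem_gen hj)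
    by_cases h4 : Y.ncard = 4
    · exact mem_of_four h4 (gen_mono hAS) h.inv h.faith hA (mem_gen (hBS hj)) hcj
        (h.indep.ne_one (hBS hj))
    · have : Fact (Y.ncard).Prime := ⟨by
        have : Y.ncard = 2 ∨ Y.ncard = 3 ∨ Y.ncard = 5 := by omega
        rcases this with h | h | h <;> rw [h] <;> norm_num⟩
      exact mem_of_prime hcard h.nonempty (gen_mono hAS) h.inv h.faith hA (mem_gen (hBS hj)) hcj
  · have := two_mul_add_two_le h1 h6
    have := two_mul_add_two_le h2 h6
    omega

theorem norb_add_two_le (hinv : Inv H Y) (hf : Faith H Y) {g f : Perm X} (hg : g ∈ H)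
    (hfH : f ∈ H) (hg1 : g ≠ 1) (hf1 : f ≠ 1) (hgf : f ≠ g) : norb H Y + 2 ≤ Y.ncard := by
  by_contra hlt
  obtain ⟨x, hx, hne⟩ := hf.exists_ne hg hg1
  have hgx : g x ∈ Y := hinv g hg x hx
  have inj : ∀ u ∈ Y, ∀ v ∈ Y, u ≠ v → v ∈ orb H u →
      ∀ y ∈ Y, ∀ z ∈ Y, y ≠ u → z ≠ u → z ∈ orb H y → z = y := by
    intro u hu v hv huv hvu y hy z hz hyu hzu hzy
    have e1 : orb H '' (Y \ {u}) = orb H '' Y := by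
      refine (Set.image_mono Set.sdiff_subset).antisymm ?_
      rintro _ ⟨w, hw, rfl⟩
      by_cases hwu : w = u
      · exact ⟨v, ⟨hv, fun e => huv e.symm⟩, by rw [hwu]; exact orb_eq_of_mem hvu⟩
      · exact ⟨w, ⟨hw, hwu⟩, rfl⟩
    have e2 : (orb H '' (Y \ {u})).ncard = (Y \ {u}).ncard := by
      have h1 := Set.ncard_image_le (Set.toFinite (Y \ {u})) (f := orb H)
      have h2 := Set.ncard_sdiff_singleton_add_one hu (Set.toFinite Y)
      rw [e1] at h1 ⊢
      rw [norb] at hlt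
      omega
    exact ((Set.ncard_image_iff (Set.toFinite _)).1 e2 ⟨hy, hyu⟩ ⟨hz, hzu⟩ (orb_eq_iff.2 hzy)).symm
  have inj1 := inj x hx _ hgx hne.symm (apply_mem_orb hg x)
  have inj2 := inj _ hgx x hx hne (mem_orb_symm (apply_mem_orb hg x))
  have key : ∀ e ∈ H, e ≠ 1 → e x = g x ∧ e (g x) = x ∧ ∀ y ∈ Y, y ≠ x → y ≠ g x → e y = y := by
    intro e he he1
    have hrest : ∀ y ∈ Y, y ≠ x → y ≠ g x → e y = y := by
      intro y hy h1 h2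
      by_cases h3 : e y = x
      · have : g x ∈ orb H y := mem_orb_trans (apply_mem_orb he y) (by rw [h3]; exact apply_mem_orb hg x)
        exact absurd (inj1 y hy _ hgx h1 hne this).symm h2
      · exact inj1 y hy _ (hinv e he y hy) h1 h3 (apply_mem_orb he y)
    have hex : e x ≠ x → e x = g x := fun h => inj1 _ hgx _ (hinv e he x hx) hne h
      (mem_orb_trans (mem_orb_symm (apply_mem_orb hg x)) (apply_mem_orb he x))
    have heg : e (g x) ≠ g x → e (g x) = x := fun h => inj2 _ hx _ (hinv e he _ hgx) hne.symm h
      (mem_orb_trans (apply_mem_orb hg x) (apply_mem_orb he (g x)))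
    have hinje := e.injective
    obtain ⟨y, hy, hye⟩ := hf.exists_ne he he1
    by_cases h1 : e x = x
    · by_cases h2 : e (g x) = g x
      · exfalso
        refine hye ?_
        by_cases h3 : y = x
        · rw [h3, h1]
        · by_cases h4 : y = g x
          · rw [h4, h2]
          · exact hrest y hy h3 h4
      · exact absurd (hinje (h1.trans (heg h2).symm)) hne.symm
    · have h2 := hex h1
      exact ⟨h2, heg fun h3 => hne (hinje (h3.trans h2.symm)), hrest⟩
  obtain ⟨a1, a2, a3⟩ := key f hfH hf1
  obtain ⟨b1, b2, b3⟩ := key g hg hg1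
  have := hf (g⁻¹ * f) (mul_mem (inv_mem hg) hfH) fun y hy => by
    rw [Perm.mul_apply, Perm.inv_eq_iff_eq]
    by_cases h3 : y = x
    · rw [h3, a1]
    · by_cases h4 : y = g x
      · rw [h4, a2, b2]
      · rw [a3 y hy h3 h4, b3 y hy h3 h4]
  exact hgf (inv_mul_eq_one.1 this).symm

theorem eq_of_mem_of_ncard_two {Z : Set X} (hZ : Z.ncard = 2) {x y z : X} (hx : x ∈ Z)
    (hy : y ∈ Z) (hz : z ∈ Z) (h1 : y ≠ x) (h2 : z ≠ x) : y = z := by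
  obtain ⟨u, v, -, rfl⟩ := Set.ncard_eq_two.1 hZ
  simp only [Set.mem_insert_iff, Set.mem_singleton_iff] at hx hy hz
  grind

theorem nonempty_of_ncard_orb {x : X} (h : 2 ≤ (orb (gen ρ S) x).ncard) : S.Nonempty := by
  rw [Finset.nonempty_iff_ne_empty]
  rintro rfl
  rw [gen_empty, orb_bot, Set.ncard_singleton] at h
  omega

theorem card_of_two_essential_aux (h : Good ρ S Y)
    (ih : ∀ S' Y', Y'.ncard < Y.ncard → Good ρ S' Y' → S'.card + 1 ≤ Y'.ncard)
    {i i' : ℤ} (hi : i ∈ S) (hi' : i' ∈ S) (hii : i ≠ i') {A B P Q E : Finset ℤ}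
    (hA : A ⊆ S) (hB : B ⊆ S) (hP : P ⊆ S) (hQ : Q ⊆ S) (hE : E ⊆ S)
    (hiE : i ∉ E) (hiE' : i' ∉ E) (hAE : Disjoint A E) (hBE : Disjoint B E) (hAB : Disjoint A B)
    (hPA : Comm ρ P A) (hQB : Comm ρ Q B) (hQBd : Disjoint Q B)
    (hs : A.card + B.card + E.card + 2 = S.card)
    (htP : Tr (gen ρ P) Y) (htQ : Tr (gen ρ Q) Y) (hnA : ¬ Tr (gen ρ A) Y) (hnB : ¬ Tr (gen ρ B) Y)
    (hess : ∀ e ∈ E, ¬ Tr (gen ρ (S.erase e)) Y)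
    (hle : ∀ x ∈ Y, (orb (gen ρ A) x).ncard ≤ (orb (gen ρ B) x).ncard) :
    S.card + 1 ≤ Y.ncard := by
  obtain ⟨x, hx⟩ := h.nonempty
  obtain ⟨a, u, hu, ha, hua, -, hao⟩ := h.exists_size ih hPA hP hA
    (htP.mono (gen_mono Finset.subset_union_left)) hnA
  obtain ⟨b, t, ht, hb, htb, hnt, hbo⟩ := h.exists_size ih hQB hQ hB
    (htQ.mono (gen_mono Finset.subset_union_left)) hnB
  have hab : a ≤ b := by rw [← hao x hx, ← hbo x hx]; exact hle x hx
  have h1 := card_add_one_le_norb hE h.nonempty h.inv hess h.tr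
  have pA := h.two_pow_le hPA htP hA hx
  have pB := h.two_pow_le hQB htQ hB hx
  rw [hao x hx] at pA
  rw [hbo x hx] at pB
  have hiF : i ∈ S \ E := Finset.mem_sdiff.2 ⟨hi, hiE⟩
  have hiF' : i' ∈ S \ E := Finset.mem_sdiff.2 ⟨hi', hiE'⟩
  have hFS : gen ρ (S \ E) ≤ gen ρ S := gen_mono Finset.sdiff_subset
  have hBF : B ⊆ S \ E := fun j hj =>
    Finset.mem_sdiff.2 ⟨hB hj, Finset.disjoint_left.1 hBE hj⟩
  have hst := norb_anti (Y := Y) (gen_mono (ρ := ρ) hBF)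
  rw [hnt] at hst
  have hinjS := fun {i j} => h.indep.injOn (i := i) (j := j)
  rcases Nat.lt_or_ge b 2 with hb1 | hb2
  · have := norb_add_two_le (h.inv.mono hFS) (h.faith.mono hFS) (mem_gen hiF) (mem_gen hiF')
      (h.indep.ne_one hi) (h.indep.ne_one hi') fun e => hii (hinjS hi hi' e.symm)
    omega
  rcases Nat.lt_or_ge b 3 with hb3 | hb3
  · obtain rfl : b = 2 := by omega
    obtain ⟨l, hl⟩ : B.Nonempty := nonempty_of_ncard_orb (by rw [hbo x hx])
    by_cases ht2 : t = 2
    · exfalso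
      refine h.indep.not_mem hQ (hB hl) (fun hlQ => Finset.disjoint_left.1 hQBd hlQ hl) ?_
      exact mem_of_four (by omega) (gen_mono hQ) h.inv h.faith htQ (mem_gen (hB hl))
        (fun g hg => hQB.commute hg (mem_gen hl)) (h.indep.ne_one (hB hl))
    by_cases ht3 : t = 3
    · by_cases ha2 : a = 2
      · obtain ⟨j, hj⟩ : A.Nonempty := nonempty_of_ncard_orb (by rw [hao x hx]; omega)
        have hjF : j ∈ S \ E := Finset.mem_sdiff.2 ⟨hA hj, Finset.disjoint_left.1 hAE hj⟩
        have hjl : ρ j ≠ ρ l := fun e => Finset.disjoint_left.1 hAB hj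
          (hinjS (hA hj) (hB hl) e ▸ hl)
        have : norb (gen ρ (S \ E)) Y < norb (gen ρ B) Y := by
          obtain ⟨y, hy, hney⟩ : ∃ y ∈ Y, ρ j y ≠ ρ l y := by
            by_contra hcon
            push Not at hcon
            refine hjl (inv_mul_eq_one.1 (h.faith ((ρ l)⁻¹ * ρ j) (mul_mem (inv_mem (mem_gen (hB hl)))
              (mem_gen (hA hj))) fun y hy => ?_)).symm
            rw [Perm.mul_apply, hcon y hy]; simp
          refine norb_lt (gen_mono hBF) hy (h.inv _ (mem_gen (hA hj)) y hy)
            (apply_mem_orb (mem_gen hjF) y) fun hmem => hney ?_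
          refine eq_of_mem_of_ncard_two (hbo y hy) (mem_orb_self y) hmem
            (apply_mem_orb (mem_gen hl) y) (fun e => ?_) (fun e => ?_)
          · exact h.indep.ne_one (hA hj) (eq_one_of_fix htP (h.faith.mono (gen_mono hA))
              (fun _ ha _ hb => hPA.commute ha hb) (mem_gen hj) hy e)
          · exact h.indep.ne_one (hB hl) (eq_one_of_fix htQ (h.faith.mono (gen_mono hB))
              (fun _ ha _ hb => hQB.commute ha hb) (mem_gen hl) hy e)
        omega
      · omega
    · omega
  · rcases Nat.lt_or_ge t 3 with ht3 | ht3
    · obtain rfl : t = 2 := by omega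
      have := add_two_le pB hb3
      have := add_two_le (pA.trans hab) hb3
      omega
    · nlinarith

theorem card_of_two_essential (h : Good ρ S Y)
    (ih : ∀ S' Y', Y'.ncard < Y.ncard → Good ρ S' Y' → S'.card + 1 ≤ Y'.ncard)
    {i i' : ℤ} (hi : i ∈ S) (hi' : i' ∈ S) (hii : i ≠ i') {A B P Q E : Finset ℤ}
    (hA : A ⊆ S) (hB : B ⊆ S) (hP : P ⊆ S) (hQ : Q ⊆ S) (hE : E ⊆ S)
    (hiE : i ∉ E) (hiE' : i' ∉ E) (hAE : Disjoint A E) (hBE : Disjoint B E) (hAB : Disjoint A B)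
    (hPA : Comm ρ P A) (hQB : Comm ρ Q B) (hPAd : Disjoint P A) (hQBd : Disjoint Q B)
    (hs : A.card + B.card + E.card + 2 = S.card)
    (htP : Tr (gen ρ P) Y) (htQ : Tr (gen ρ Q) Y) (hnA : ¬ Tr (gen ρ A) Y) (hnB : ¬ Tr (gen ρ B) Y)
    (hess : ∀ e ∈ E, ¬ Tr (gen ρ (S.erase e)) Y) :
    S.card + 1 ≤ Y.ncard := by
  obtain ⟨x, hx⟩ := h.nonempty
  have eA := fun y hy => hPA.ncard_orb_eq (htP.mono (gen_mono Finset.subset_union_left)) hx (y := y) hy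
  have eB := fun y hy => hQB.ncard_orb_eq (htQ.mono (gen_mono Finset.subset_union_left)) hx (y := y) hy
  rcases le_total (orb (gen ρ A) x).ncard (orb (gen ρ B) x).ncard with hle | hle
  · exact card_of_two_essential_aux h ih hi hi' hii hA hB hP hQ hE hiE hiE' hAE hBE hAB hPA hQB hQBd
      hs htP htQ hnA hnB hess fun y hy => by rw [eA y hy, eB y hy]; exact hle
  · exact card_of_two_essential_aux h ih hi' hi hii.symm hB hA hQ hP hE hiE' hiE hBE hAE hAB.symm
      hQB hPA hPAd (by omega) htQ htP hnB hnA hess fun y hy => by rw [eA y hy, eB y hy]; exact hle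

theorem disjoint_low_high {i j : ℤ} (h : i ≤ j) : Disjoint (low S i) (high S j) := by
  rw [Finset.disjoint_left]
  intro l hl hl'
  rw [mem_low] at hl
  rw [mem_high] at hl'
  omega

/-- A string of independent generators acting transitively and faithfully on `n` points has
rank at most `n - 1`. -/
theorem card_add_one_le (h : Good ρ S Y) : S.card + 1 ≤ Y.ncard := by
  classical
  generalize hn : Y.ncard = n
  induction n using Nat.strong_induction_on generalizing S Y with
  | _ n IH =>
  subst hn
  have ih : ∀ S' Y', Y'.ncard < Y.ncard → Good ρ S' Y' → S'.card + 1 ≤ Y'.ncard :=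
    fun S' Y' hlt h' => IH _ hlt h' rfl
  by_cases hT : ∃ i ∈ S, Tr (gen ρ (S.erase i)) Y; swap
  · push Not at hT
    have h1 := card_add_one_le_norb (Finset.Subset.refl S) h.nonempty h.inv hT h.tr
    exact h1.trans norb_le_ncard
  by_cases hover : ∃ i ∈ S, Tr (gen ρ (low S i)) Y ∧ Tr (gen ρ (high S i)) Y
  · obtain ⟨i, hi, h1, h2⟩ := hover
    exact h.card_of_both_transitive hi (erase_eq_low_union_high i) (h.str.comm_low_high i)
      (card_split hi) h1 h2
  by_cases hnone : ∃ i ∈ S, Tr (gen ρ (S.erase i)) Y ∧ ¬ Tr (gen ρ (low S i)) Y ∧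
      ¬ Tr (gen ρ (high S i)) Y
  · obtain ⟨i, hi, h1, h2, h3⟩ := hnone
    rw [erase_eq_low_union_high] at h1
    exact h.card_of_both_intransitive ih (h.str.comm_low_high i) (low_subset i) (high_subset i) h1
      (card_split hi) h2 h3
  push Not at hover hnone
  set L := S.filter fun i => Tr (gen ρ (S.erase i)) Y ∧ Tr (gen ρ (low S i)) Y with hL
  set R := S.filter fun i => Tr (gen ρ (S.erase i)) Y ∧ Tr (gen ρ (high S i)) Y with hR
  have hLR : ∀ j ∈ S, Tr (gen ρ (S.erase j)) Y → j ∈ L ∨ j ∈ R := by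
    intro j hj h1
    by_cases h2 : Tr (gen ρ (low S j)) Y
    · exact Or.inl (Finset.mem_filter.2 ⟨hj, h1, h2⟩)
    · exact Or.inr (Finset.mem_filter.2 ⟨hj, h1, hnone j hj h1 h2⟩)
  rcases L.eq_empty_or_nonempty with hLe | hLn
  · have hRn : R.Nonempty := by
      obtain ⟨i, hi, h1⟩ := hT
      rcases hLR i hi h1 with h2 | h2
      · rw [hLe] at h2; simp at h2
      · exact ⟨i, h2⟩
    have hmem := Finset.mem_filter.1 (R.max'_mem hRn)
    set i := R.max' hRn
    refine h.card_of_one_essential ih (A := high S i) (B := low S i) hmem.1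
      (by rw [erase_eq_low_union_high, Finset.union_comm])
      (h.str.comm_low_high i).symm ?_ (by have := card_split hmem.1; omega) ?_ ?_
    · rw [Finset.union_comm, ← erase_eq_low_union_high]; exact hmem.2.1
    · intro e he hte
      rw [mem_high] at he
      rcases hLR e he.1 hte with h2 | h2
      · rw [hLe] at h2; simp at h2
      · exact absurd (R.le_max' e h2) (not_le.2 he.2)
    · exact fun hh => hover i hmem.1 hh hmem.2.2
  rcases R.eq_empty_or_nonempty with hRe | hRn
  · have hmem := Finset.mem_filter.1 (L.min'_mem hLn)
    set i := L.min' hLn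
    refine h.card_of_one_essential ih (A := low S i) (B := high S i) hmem.1
      (erase_eq_low_union_high i) (h.str.comm_low_high i) ?_ (card_split hmem.1) ?_ ?_
    · rw [← erase_eq_low_union_high]; exact hmem.2.1
    · intro e he hte
      rw [mem_low] at he
      rcases hLR e he.1 hte with h2 | h2
      · exact absurd (L.min'_le e h2) (not_le.2 he.2)
      · rw [hRe] at h2; simp at h2
    · exact fun hh => hover i hmem.1 hmem.2.2 hh
  · have hi := Finset.mem_filter.1 (L.min'_mem hLn)
    have hi' := Finset.mem_filter.1 (R.max'_mem hRn)
    have hmin := L.min'_le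
    have hmax := R.le_max'
    set i := L.min' hLn
    set i' := R.max' hRn
    have hlt : i' < i := by
      by_contra hge
      push Not at hge
      refine hover i' hi'.1 (hi.2.2.mono (gen_mono fun j hj => ?_)) hi'.2.2
      rw [mem_low] at hj ⊢
      exact ⟨hj.1, by omega⟩
    set E := high (low S i) i' with hE
    have memE : ∀ j, j ∈ E ↔ (j ∈ S ∧ j < i) ∧ i' < j := fun j => by rw [hE, mem_high, mem_low]
    have hc1 := card_split hi.1
    have hc2 := card_split (S := low S i) (i := i') (mem_low.2 ⟨hi'.1, hlt⟩)
    have hlow : low (low S i) i' = low S i' := by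
      ext j; simp only [mem_low]; constructor
      · exact fun h => ⟨h.1.1, h.2⟩
      · exact fun h => ⟨⟨h.1, by omega⟩, h.2⟩
    rw [hlow, ← hE] at hc2
    refine h.card_of_two_essential ih (i := i) (i' := i') (A := low S i') (B := high S i)
      (P := high S i') (Q := low S i) (E := E) hi.1 hi'.1 hlt.ne' (low_subset _) (high_subset _)
      (high_subset _) (low_subset _) (fun j hj => ((memE j).1 hj).1.1) ?_ ?_ ?_ ?_
      (disjoint_low_high hlt.le) (h.str.comm_low_high i').symm (h.str.comm_low_high i)
      (disjoint_low_high le_rfl).symm (disjoint_low_high le_rfl) (by omega) hi'.2.2 hi.2.2 ?_ ?_ ?_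
    · rw [memE]; omega
    · rw [memE]; omega
    · rw [Finset.disjoint_left]; intro j hj hj'
      rw [mem_low] at hj; rw [memE] at hj'; omega
    · rw [Finset.disjoint_left]; intro j hj hj'
      rw [mem_high] at hj; rw [memE] at hj'; omega
    · exact fun hh => hover i' hi'.1 hh hi'.2.2
    · exact fun hh => hover i hi.1 hi.2.2 hh
    · intro e he hte
      rw [memE] at he
      rcases hLR e he.1.1 hte with h2 | h2
      · exact absurd (hmin e h2) (not_le.2 he.1.2)
      · exact absurd (hmax e h2) (not_le.2 he.2)

end Good

end StringPerm

namespace StringPerm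

open Equiv
open scoped Pointwise

variable {X : Type*} {ρ : ℤ → Perm X} {A B C E S T L : Finset ℤ} {H K : Subgroup (Perm X)}
  {Y Y' : Set X}

section

variable [Finite X]

/-- If a faithful group on four points has all orbits of size two, it has order at most four. -/
theorem card_le_four (hY : Y.ncard = 4) (hinv : Inv H Y) (hf : Faith H Y)
    (h2 : ∀ x ∈ Y, (orb H x).ncard = 2) : Nat.card H ≤ 4 := by
  have hn := norb_mul_eq hinv h2
  rw [hY] at hn
  have hn2 : (orb H '' Y).ncard = 2 := by rw [norb] at hn; omega
  obtain ⟨O, O', -, hOO⟩ := Set.ncard_eq_two.1 hn2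
  obtain ⟨x, hx, rfl⟩ : O ∈ orb H '' Y := hOO ▸ Set.mem_insert _ _
  obtain ⟨y, hy, rfl⟩ : O' ∈ orb H '' Y := hOO ▸ Set.mem_insert_of_mem _ rfl
  have hinj : Function.Injective fun g : H =>
      ((⟨g.1 x, apply_mem_orb g.2 x⟩, ⟨g.1 y, apply_mem_orb g.2 y⟩) : orb H x × orb H y) := by
    intro g g' e
    simp only [Prod.mk.injEq, Subtype.mk.injEq] at e
    have key : ∀ u ∈ Y, g.1 u = g'.1 u → ∀ v ∈ orb H u, g.1 v = g'.1 v := by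
      intro u hu e v hv
      by_cases hvu : v = u
      · rw [hvu, e]
      refine Good.eq_of_mem_of_ncard_two (h2 u hu) (x := g.1 u) (apply_mem_orb g.2 u)
        (mem_orb_trans hv (apply_mem_orb g.2 v)) (mem_orb_trans hv (apply_mem_orb g'.2 v))
        (fun h => hvu (g.1.injective h)) fun h => hvu (g'.1.injective (h.trans e))
    have := hf (g'.1⁻¹ * g.1) (mul_mem (inv_mem g'.2) g.2) fun v hv => by
      rw [Perm.mul_apply, Perm.inv_eq_iff_eq]
      have : orb H v ∈ orb H '' Y := ⟨v, hv, rfl⟩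
      rw [hOO] at this
      rcases this with h | h
      · exact key x hx e.1 v (h ▸ mem_orb_self v)
      · exact key y hy e.2 v ((Set.mem_singleton_iff.1 h) ▸ mem_orb_self v)
    exact Subtype.ext (inv_mul_eq_one.1 this).symm
  have := Nat.card_le_card_of_injective _ hinj
  rw [Nat.card_prod, Nat.card_coe_set_eq, Nat.card_coe_set_eq, h2 x hx, h2 y hy] at this
  exact this

theorem card_of_two_sided_aux (hY : Y.Nonempty) (hind : Indep ρ C) (hinv : Inv (gen ρ C) Y)
    (hf : Faith (gen ρ C) Y) (hntr : ¬ Tr (gen ρ C) Y) (hA : A ⊆ C \ E) (hB : B ⊆ C \ E)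
    (hc : Comm ρ A B) (hAB : Disjoint A B) {i i' : ℤ} (hi : i ∈ C \ E) (hi' : i' ∈ C \ E)
    (hii : i ≠ i') (hs : A.card + B.card + E.card + 2 = C.card)
    (hE : E.card + 1 ≤ norb (gen ρ (C \ E)) Y) {a b : ℕ}
    (hao : ∀ y ∈ Y, (orb (gen ρ A) y).ncard = a) (hbo : ∀ y ∈ Y, (orb (gen ρ B) y).ncard = b)
    (hgA : ∀ y ∈ Y, Good ρ A (orb (gen ρ A) y)) (hgB : ∀ y ∈ Y, Good ρ B (orb (gen ρ B) y))
    (hab : a ≤ b) : C.card + 1 ≤ Y.ncard := by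
  obtain ⟨x, hx⟩ := hY
  have hEC : gen ρ (C \ E) ≤ gen ρ C := gen_mono Finset.sdiff_subset
  have hAC : A ⊆ C := hA.trans Finset.sdiff_subset
  have hBC : B ⊆ C := hB.trans Finset.sdiff_subset
  have hiC := Finset.sdiff_subset hi
  have hiC' := Finset.sdiff_subset hi'
  have ha := (hgA x hx).card_add_one_le
  have hb := (hgB x hx).card_add_one_le
  rw [hao x hx] at ha
  rw [hbo x hx] at hb
  have htb := norb_mul_eq (hinv.mono (gen_mono hBC)) hbo
  have hst := norb_anti (Y := Y) (gen_mono (ρ := ρ) hB)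
  have hs2 : 2 ≤ norb (gen ρ (C \ E)) Y := two_le_norb fun h => hntr (h.mono hEC)
  generalize hsE : norb (gen ρ (C \ E)) Y = s at *
  generalize htE : norb (gen ρ B) Y = t at *
  rcases Nat.lt_or_ge b 2 with hb1 | hb2
  · have := Good.norb_add_two_le (hinv.mono hEC) (hf.mono hEC) (mem_gen hi) (mem_gen hi')
      (hind.ne_one hiC) (hind.ne_one hiC') fun e => hii (hind.injOn hiC hiC' e.symm)
    omega
  by_cases hfour : b = 2 ∧ t = 2
  · obtain ⟨rfl, rfl⟩ := hfour
    have h4 : Nat.card (gen ρ C) ≤ 4 := by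
      refine card_le_four (by omega) hinv hf fun y hy => ?_
      have hsub := orb_mono (gen_mono (ρ := ρ) hBC) y
      have hge := Set.ncard_le_ncard hsub (Set.toFinite _)
      rw [hbo y hy] at hge
      have hlt : (orb (gen ρ C) y).ncard ≤ 2 := by
        by_contra hgt
        push Not at hgt
        obtain ⟨z, hz, hzB⟩ := Set.exists_mem_notMem_of_ncard_lt_ncard
          (s := orb (gen ρ B) y) (t := orb (gen ρ C) y) (by rw [hbo y hy]; exact hgt)
          (Set.toFinite _)
        have := norb_lt (Y := Y) (gen_mono (ρ := ρ) hBC) hy (hinv.orb_subset hy hz) hz hzB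
        rw [htE] at this
        exact hntr (tr_of_norb_le_one (by omega))
      omega
    have h2 := two_pow_le_card hind
    have : 2 ^ C.card ≤ 2 ^ 2 := h2.trans h4
    have := (Nat.pow_le_pow_iff_right (by norm_num : 1 < 2)).1 this
    omega
  have ht2 : 2 ≤ t := hs2.trans hst
  rcases Nat.lt_or_ge b 3 with hb3 | hb3
  · obtain rfl : b = 2 := by omega
    by_cases ht3 : t = 3
    · subst ht3
      by_cases ha2 : a = 2
      · subst ha2
        have hone : ∀ D : Finset ℤ, D.card + 1 ≤ 2 → (∀ y ∈ Y, (orb (gen ρ D) y).ncard = 2) →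
            ∃ j ∈ D, ∀ y ∈ Y, ρ j y ≠ y := by
          intro D hD ho
          obtain ⟨j, hj⟩ : D.Nonempty := Good.nonempty_of_ncard_orb (by rw [ho x hx])
          refine ⟨j, hj, fun y hy e => ?_⟩
          have h1 := ho y hy
          have : orb (gen ρ D) y = {y} := by
            ext z
            constructor
            · rintro ⟨g, hg, rfl⟩
              refine fix_of_gens (fun l hl => ?_) hg
              rw [Finset.card_le_one.1 (by omega) l hl j hj, e]
            · rintro rfl; exact mem_orb_self _
          rw [this, Set.ncard_singleton] at h1
          omega
        obtain ⟨j, hj, hjf⟩ := hone A ha hao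
        obtain ⟨l, hl, hlf⟩ := hone B hb hbo
        have hjl : ρ j ≠ ρ l := fun e => Finset.disjoint_left.1 hAB hj
          (hind.injOn (hAC hj) (hBC hl) e ▸ hl)
        have : norb (gen ρ (C \ E)) Y < norb (gen ρ B) Y := by
          obtain ⟨y, hy, hney⟩ : ∃ y ∈ Y, ρ j y ≠ ρ l y := by
            by_contra hcon
            push Not at hcon
            refine hjl (inv_mul_eq_one.1 (hf ((ρ l)⁻¹ * ρ j) (mul_mem (inv_mem (mem_gen (hBC hl)))
              (mem_gen (hAC hj))) fun y hy => ?_)).symm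
            rw [Perm.mul_apply, hcon y hy]; simp
          refine norb_lt (gen_mono hB) hy (hinv _ (mem_gen (hAC hj)) y hy)
            (apply_mem_orb (mem_gen (hA hj)) y) fun hmem => hney ?_
          exact Good.eq_of_mem_of_ncard_two (hbo y hy) (mem_orb_self y) hmem
            (apply_mem_orb (mem_gen hl) y) (hjf y hy) (hlf y hy)
        omega
      · omega
    · omega
  rcases Nat.lt_or_ge t 3 with ht3 | ht3
  · obtain rfl : t = 2 := by omega
    have hpres : ∀ y ∈ Y, ∀ g ∈ gen ρ A, g y ∈ orb (gen ρ B) y := by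
      intro y hy g hg
      by_contra hno
      have := norb_lt (gen_mono (ρ := ρ) hB) hy (hinv _ (gen_mono hAC hg) y hy)
        (apply_mem_orb (gen_mono hA hg) y) hno
      omega
    have hinvA : Inv (gen ρ A) (orb (gen ρ B) x) := fun g hg y hy =>
      mem_orb_trans hy (hpres y (hinv.orb_subset hx (orb_mono (gen_mono hBC) x hy)) g hg)
    have hdiv := norb_mul_eq hinvA fun y hy =>
      hao y (hinv.orb_subset hx (orb_mono (gen_mono hBC) x hy))
    rw [hbo x hx] at hdiv
    rcases Nat.lt_or_ge a b with hlt | hge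
    · have : 2 ≤ norb (gen ρ A) (orb (gen ρ B) x) := by
        by_contra hcon
        have : norb (gen ρ A) (orb (gen ρ B) x) = 0 ∨ norb (gen ρ A) (orb (gen ρ B) x) = 1 := by
          omega
        rcases this with h | h <;> rw [h] at hdiv <;> omega
      have : 2 * a ≤ b := by
        calc 2 * a ≤ _ := Nat.mul_le_mul_right a this
          _ = b := hdiv
      omega
    · obtain rfl : a = b := by omega
      have hOO : orb (gen ρ A) x = orb (gen ρ B) x :=
        Set.eq_of_subset_of_ncard_le (fun _ ⟨g, hg, e⟩ => e ▸ hpres x hx g hg)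
          (by rw [hao x hx, hbo x hx]) (Set.toFinite _)
      have hgood := hgB x hx
      have hmem := mem_orb_self (H := gen ρ B) x
      have p1 : 2 ^ B.card ≤ a := by
        rw [← hbo x hx]
        exact hgood.two_pow_le hc (by rw [← hOO]; exact tr_orb x) (Finset.Subset.refl _) hmem
      have p2 : 2 ^ A.card ≤ a := by
        rw [← hao x hx]
        exact (hgA x hx).two_pow_le hc.symm (by rw [hOO]; exact tr_orb x) (Finset.Subset.refl _)
          (mem_orb_self x)
      have := Good.add_two_le p1 hb3
      have := Good.add_two_le p2 hb3
      omega
  · nlinarith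

theorem card_of_two_sided (hY : Y.Nonempty) (hind : Indep ρ C) (hinv : Inv (gen ρ C) Y)
    (hf : Faith (gen ρ C) Y) (hntr : ¬ Tr (gen ρ C) Y) (hA : A ⊆ C \ E) (hB : B ⊆ C \ E)
    (hc : Comm ρ A B) (hAB : Disjoint A B) {i i' : ℤ} (hi : i ∈ C \ E) (hi' : i' ∈ C \ E)
    (hii : i ≠ i') (hs : A.card + B.card + E.card + 2 = C.card)
    (hE : E.card + 1 ≤ norb (gen ρ (C \ E)) Y) {a b : ℕ}
    (hao : ∀ y ∈ Y, (orb (gen ρ A) y).ncard = a) (hbo : ∀ y ∈ Y, (orb (gen ρ B) y).ncard = b)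
    (hgA : ∀ y ∈ Y, Good ρ A (orb (gen ρ A) y)) (hgB : ∀ y ∈ Y, Good ρ B (orb (gen ρ B) y)) :
    C.card + 1 ≤ Y.ncard := by
  rcases le_total a b with hab | hab
  · exact card_of_two_sided_aux hY hind hinv hf hntr hA hB hc hAB hi hi' hii hs hE hao hbo hgA hgB hab
  · exact card_of_two_sided_aux hY hind hinv hf hntr hB hA hc.symm hAB.symm hi hi' hii (by omega) hE
      hbo hao hgB hgA hab

theorem card_of_one_sided (hY : Y.Nonempty) (hind : Indep ρ C) (hinv : Inv (gen ρ C) Y)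
    (hf : Faith (gen ρ C) Y) (hntr : ¬ Tr (gen ρ C) Y) (hB : B ⊆ C \ E)
    {i : ℤ} (hi : i ∈ C \ E) (hs : B.card + E.card + 1 = C.card)
    (hE : E.card + 1 ≤ norb (gen ρ (C \ E)) Y) {b : ℕ}
    (hbo : ∀ y ∈ Y, (orb (gen ρ B) y).ncard = b)
    (hgB : ∀ y ∈ Y, Good ρ B (orb (gen ρ B) y)) :
    C.card + 1 ≤ Y.ncard := by
  obtain ⟨x, hx⟩ := hY
  have hEC : gen ρ (C \ E) ≤ gen ρ C := gen_mono Finset.sdiff_subset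
  have hBC : B ⊆ C := hB.trans Finset.sdiff_subset
  have hb := (hgB x hx).card_add_one_le
  rw [hbo x hx] at hb
  have htb := norb_mul_eq (hinv.mono (gen_mono hBC)) hbo
  have hst := norb_anti (Y := Y) (gen_mono (ρ := ρ) hB)
  have hs2 : 2 ≤ norb (gen ρ (C \ E)) Y := two_le_norb fun h => hntr (h.mono hEC)
  rcases Nat.lt_or_ge b 2 with hb1 | hb2
  · obtain ⟨y, hy, hne⟩ := hf.exists_ne (mem_gen (Finset.sdiff_subset hi))
      (hind.ne_one (Finset.sdiff_subset hi))
    have := norb_lt_ncard (mem_gen hi) (hinv.mono hEC) hy hne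
    omega
  · nlinarith

/-- Generators acting trivially on blocks, commuting with a block-transitive set of generators,
and forming an initial and a final segment of the string: there are fewer than the block size. -/
theorem card_segments_add_one_le {Z : Type*} {Ω : Set X} (hG : Good ρ S Ω) (β : X → Z)
    (hLS : L ⊆ S)
    (hL : ∀ x ∈ Ω, ∀ y ∈ Ω, ∃ g ∈ gen ρ L, β (g x) = β y) {Cl Cr : Finset ℤ}
    (hClS : Cl ⊆ S) (hCrS : Cr ⊆ S) (hCβ : ∀ i ∈ Cl ∪ Cr, ∀ x ∈ Ω, β (ρ i x) = β x)
    (hLC : Comm ρ L (Cl ∪ Cr)) (hLd : Disjoint L (Cl ∪ Cr)) (hd : Disjoint Cl Cr)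
    (hCl : ∀ i ∈ Cl, ∀ j ∈ S, j < i → j ∈ Cl) (hCr : ∀ i ∈ Cr, ∀ j ∈ S, i < j → j ∈ Cr)
    {x₀ : X} (hx₀ : x₀ ∈ Ω) :
    Cl.card + Cr.card + 1 ≤ {x | x ∈ Ω ∧ β x = β x₀}.ncard := by
  classical
  rw [← Finset.card_union_of_disjoint hd]
  set C := Cl ∪ Cr with hC
  set Y : Set X := {x | x ∈ Ω ∧ β x = β x₀} with hYdef
  have hCS : C ⊆ S := Finset.union_subset hClS hCrS
  have hYΩ : ∀ x ∈ Y, x ∈ Ω := fun x hx => hx.1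
  have hYn : Y.Nonempty := ⟨x₀, hx₀, rfl⟩
  have hind := hG.indep.mono hCS
  have hinv : Inv (gen ρ C) Y := inv_gen_of fun i hi x hx =>
    ⟨hG.inv _ (mem_gen (hCS hi)) x hx.1, (hCβ i hi x hx.1).trans hx.2⟩
  have hmove : ∀ y ∈ Ω, ∃ l ∈ gen ρ L, l y ∈ Y := by
    intro y hy
    obtain ⟨l, hl, e⟩ := hL y hy x₀ hx₀
    exact ⟨l, hl, hG.inv l (gen_mono hLS hl) y hy, e⟩
  have hf : Faith (gen ρ C) Y := by
    intro c hc hfix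
    refine hG.faith c (gen_mono hCS hc) fun y hy => ?_
    obtain ⟨l, hl, hly⟩ := hmove y hy
    have h1 := hfix _ hly
    rw [← Perm.mul_apply, ← (hLC.commute hl hc).eq, Perm.mul_apply] at h1
    exact l.injective h1
  by_cases htr : Tr (gen ρ C) Y
  · exact Good.card_add_one_le ⟨hYn, hG.str.mono hCS, hind, hinv, htr, hf⟩
  have hnorb : ∀ E ⊆ C, norb (gen ρ (S \ E)) Ω ≤ norb (gen ρ (C \ E)) Y := by
    intro E hE
    refine le_trans ?_ (norb_anti (gen_mono (Finset.sdiff_subset_sdiff hCS le_rfl)))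
    refine Set.ncard_le_ncard ?_ (Set.toFinite _)
    rintro _ ⟨y, hy, rfl⟩
    obtain ⟨l, hl, hly⟩ := hmove y hy
    refine ⟨l y, hly, orb_eq_of_mem (apply_mem_orb (gen_mono (fun j hj => ?_) hl) y)⟩
    exact Finset.mem_sdiff.2 ⟨hLS hj, fun hjE => Finset.disjoint_left.1 hLd hj (hE hjE)⟩
  have hchain : ∀ E ⊆ C, (∀ e ∈ E, ¬ Tr (gen ρ (S.erase e)) Ω) →
      E.card + 1 ≤ norb (gen ρ (C \ E)) Y := fun E hE hess =>
    (card_add_one_le_norb (hE.trans hCS) hG.nonempty hG.inv hess hG.tr).trans (hnorb E hE)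
  have hlt : ∀ i' ∈ Cl, ∀ i ∈ Cr, i' < i := by
    intro i' hi' i hi
    by_contra hge
    rcases (not_lt.1 hge).lt_or_eq with h | h
    · exact Finset.disjoint_left.1 hd (hCl i' hi' i (hCrS hi) h) hi
    · exact Finset.disjoint_left.1 hd hi' (h ▸ hi)
  have hhigh : ∀ i ∈ Cr, high C i = high S i := by
    intro i hi; ext j
    simp only [mem_high]
    exact ⟨fun h => ⟨hCS h.1, h.2⟩, fun h => ⟨Finset.mem_union_right _ (hCr i hi j h.1 h.2), h.2⟩⟩
  have hlow : ∀ i ∈ Cl, low C i = low S i := by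
    intro i hi; ext j
    simp only [mem_low]
    exact ⟨fun h => ⟨hCS h.1, h.2⟩, fun h => ⟨Finset.mem_union_left _ (hCl i hi j h.1 h.2), h.2⟩⟩
  have hright : ∀ i, Tr (gen ρ (S.erase i)) Ω →
      (∀ y ∈ Y, (orb (gen ρ (high S i)) y).ncard = (orb (gen ρ (high S i)) x₀).ncard) ∧
      ∀ y ∈ Y, Good ρ (high S i) (orb (gen ρ (high S i)) y) := by
    intro i ht
    rw [erase_eq_low_union_high] at ht
    have hc := hG.str.comm_low_high i
    exact ⟨fun y hy => hc.ncard_orb_eq ht hx₀ hy.1, fun y hy => hG.orbit hc ht (high_subset i) hy.1⟩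
  have hleft : ∀ i, Tr (gen ρ (S.erase i)) Ω →
      (∀ y ∈ Y, (orb (gen ρ (low S i)) y).ncard = (orb (gen ρ (low S i)) x₀).ncard) ∧
      ∀ y ∈ Y, Good ρ (low S i) (orb (gen ρ (low S i)) y) := by
    intro i ht
    rw [erase_eq_low_union_high, Finset.union_comm] at ht
    have hc := (hG.str.comm_low_high i).symm
    exact ⟨fun y hy => hc.ncard_orb_eq ht hx₀ hy.1, fun y hy => hG.orbit hc ht (low_subset i) hy.1⟩
  set R := Cr.filter fun i => Tr (gen ρ (S.erase i)) Ω with hR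
  set F := Cl.filter fun i => Tr (gen ρ (S.erase i)) Ω with hF
  have hFR : ∀ j ∈ C, Tr (gen ρ (S.erase j)) Ω → j ∈ F ∨ j ∈ R := by
    intro j hj h1
    rcases Finset.mem_union.1 hj with h2 | h2
    · exact Or.inl (Finset.mem_filter.2 ⟨h2, h1⟩)
    · exact Or.inr (Finset.mem_filter.2 ⟨h2, h1⟩)
  rcases F.eq_empty_or_nonempty with hFe | hFn <;> rcases R.eq_empty_or_nonempty with hRe | hRn
  · refine (hchain C le_rfl fun e he hte => ?_).trans norb_le_ncard
    rcases hFR e he hte with h | h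
    · rw [hFe] at h; simp at h
    · rw [hRe] at h; simp at h
  · have hi := Finset.mem_filter.1 (R.min'_mem hRn)
    have hmin := R.min'_le
    set i := R.min' hRn
    have hiC : i ∈ C := Finset.mem_union_right _ hi.1
    have hcs := card_split hiC
    rw [hhigh i hi.1] at hcs
    refine card_of_one_sided (B := high S i) (E := low C i) (i := i) hYn hind hinv hf htr ?_ ?_
      (by omega) (hchain _ (low_subset i) fun e he hte => ?_) (hright i hi.2).1 (hright i hi.2).2
    · rw [← hhigh i hi.1]; intro j hj
      rw [Finset.mem_sdiff, mem_low]; rw [mem_high] at hj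
      exact ⟨hj.1, by omega⟩
    · rw [Finset.mem_sdiff, mem_low]; exact ⟨hiC, by omega⟩
    · rw [mem_low] at he
      rcases hFR e he.1 hte with h | h
      · rw [hFe] at h; simp at h
      · exact absurd (hmin e h) (by omega)
  · have hi := Finset.mem_filter.1 (F.max'_mem hFn)
    have hmax := F.le_max'
    set i := F.max' hFn
    have hiC : i ∈ C := Finset.mem_union_left _ hi.1
    have hcs := card_split hiC
    rw [hlow i hi.1] at hcs
    refine card_of_one_sided (B := low S i) (E := high C i) (i := i) hYn hind hinv hf htr ?_ ?_
      (by omega) (hchain _ (high_subset i) fun e he hte => ?_) (hleft i hi.2).1 (hleft i hi.2).2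
    · rw [← hlow i hi.1]; intro j hj
      rw [Finset.mem_sdiff, mem_high]; rw [mem_low] at hj
      exact ⟨hj.1, by omega⟩
    · rw [Finset.mem_sdiff, mem_high]; exact ⟨hiC, by omega⟩
    · rw [mem_high] at he
      rcases hFR e he.1 hte with h | h
      · exact absurd (hmax e h) (by omega)
      · rw [hRe] at h; simp at h
  · have hi := Finset.mem_filter.1 (R.min'_mem hRn)
    have hmin := R.min'_le
    have hi' := Finset.mem_filter.1 (F.max'_mem hFn)
    have hmax := F.le_max'
    set i := R.min' hRn
    set i' := F.max' hFn
    have hlt' := hlt i' hi'.1 i hi.1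
    have hiC : i ∈ C := Finset.mem_union_right _ hi.1
    have hiC' : i' ∈ C := Finset.mem_union_left _ hi'.1
    have hc1 := card_split hiC
    have hc2 := card_split (S := low C i) (i := i') (mem_low.2 ⟨hiC', hlt'⟩)
    have hll : low (low C i) i' = low C i' := by
      ext j; simp only [mem_low]; constructor
      · exact fun h => ⟨h.1.1, h.2⟩
      · exact fun h => ⟨⟨h.1, by omega⟩, h.2⟩
    rw [hll, hlow i' hi'.1] at hc2
    rw [hhigh i hi.1] at hc1
    have memE : ∀ j, j ∈ high (low C i) i' ↔ (j ∈ C ∧ j < i) ∧ i' < j := fun j => by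
      rw [mem_high, mem_low]
    refine card_of_two_sided (A := low S i') (B := high S i) (E := high (low C i) i') (i := i)
      (i' := i') hYn hind hinv hf htr ?_ ?_ ?_ (Good.disjoint_low_high hlt'.le) ?_ ?_ hlt'.ne'
      (by omega) (hchain _ (fun j hj => ((memE j).1 hj).1.1) fun e he hte => ?_)
      (hleft i' hi'.2).1 (hright i hi.2).1 (hleft i' hi'.2).2 (hright i hi.2).2
    · rw [← hlow i' hi'.1]; intro j hj
      rw [Finset.mem_sdiff, memE]; rw [mem_low] at hj
      exact ⟨hj.1, by omega⟩
    · rw [← hhigh i hi.1]; intro j hj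
      rw [Finset.mem_sdiff, memE]; rw [mem_high] at hj
      exact ⟨hj.1, by omega⟩
    · intro j hj l hl
      rw [mem_low] at hj; rw [mem_high] at hl
      exact hG.str j hj.1 l hl.1 (by omega)
    · rw [Finset.mem_sdiff, memE]; exact ⟨hiC, by omega⟩
    · rw [Finset.mem_sdiff, memE]; exact ⟨hiC', by omega⟩
    · rw [memE] at he
      rcases hFR e he.1.1 hte with h | h
      · exact absurd (hmax e h) (by omega)
      · exact absurd (hmin e h) (by omega)

end

end StringPerm

namespace StringPerm

open Equiv
open scoped Pointwise

variable {X Z : Type*} {ρ : ℤ → Perm X} {σ : ℤ → Perm Z} {β : X → Z}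
  {A B C E S T L J : Finset ℤ} {k m : ℕ}

/-- A transitive string of independent involutions `ρ` on `X` preserving the fibres of `β`, which
have `k` elements each, together with its action `σ` on the `m` fibres, on which every nontrivial
normal subgroup is transitive. -/
structure Blocks (ρ : ℤ → Perm X) (σ : ℤ → Perm Z) (β : X → Z) (S : Finset ℤ) (k m : ℕ) :
    Prop where
  good : Good ρ S Set.univ
  invol : ∀ i ∈ S, ρ i * ρ i = 1
  equiv : ∀ i ∈ S, ∀ x, β (ρ i x) = σ i (β x)
  surj : Function.Surjective β
  fib : ∀ c, {x | β x = c}.ncard = k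
  card : Nat.card Z = m
  prim : ∀ N ≤ gen σ S, N ≠ ⊥ → (∀ g ∈ gen σ S, ∀ n ∈ N, g * n * g⁻¹ ∈ N) → Tr N Set.univ

namespace Blocks

section

theorem exists_lift (h : Blocks ρ σ β S k m) (hJ : J ⊆ S) {g : Perm Z} (hg : g ∈ gen σ J) :
    ∃ g' ∈ gen ρ J, ∀ x, β (g' x) = g (β x) := by
  rw [gen] at hg
  induction hg using Subgroup.closure_induction with
  | mem y hy =>
    obtain ⟨i, hi, rfl⟩ := hy
    exact ⟨ρ i, mem_gen hi, h.equiv i (hJ hi)⟩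
  | one => exact ⟨1, one_mem _, fun _ => rfl⟩
  | mul a b _ _ iha ihb =>
    obtain ⟨a', ha', ea⟩ := iha
    obtain ⟨b', hb', eb⟩ := ihb
    exact ⟨a' * b', mul_mem ha' hb', fun x => by rw [Perm.mul_apply, ea, eb, Perm.mul_apply]⟩
  | inv a _ iha =>
    obtain ⟨a', ha', ea⟩ := iha
    refine ⟨a'⁻¹, inv_mem ha', fun x => ?_⟩
    rw [Perm.eq_inv_iff_eq, ← ea]; simp

theorem exists_proj (h : Blocks ρ σ β S k m) (hJ : J ⊆ S) {g : Perm X} (hg : g ∈ gen ρ J) :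
    ∃ g' ∈ gen σ J, ∀ x, β (g x) = g' (β x) := by
  rw [gen] at hg
  induction hg using Subgroup.closure_induction with
  | mem y hy =>
    obtain ⟨i, hi, rfl⟩ := hy
    exact ⟨σ i, mem_gen hi, h.equiv i (hJ hi)⟩
  | one => exact ⟨1, one_mem _, fun _ => rfl⟩
  | mul a b _ _ iha ihb =>
    obtain ⟨a', ha', ea⟩ := iha
    obtain ⟨b', hb', eb⟩ := ihb
    exact ⟨a' * b', mul_mem ha' hb', fun x => by rw [Perm.mul_apply, ea, eb, Perm.mul_apply]⟩
  | inv a _ iha =>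
    obtain ⟨a', ha', ea⟩ := iha
    refine ⟨a'⁻¹, inv_mem ha', fun x => ?_⟩
    rw [Perm.eq_inv_iff_eq, ← ea]; simp

theorem commute_block (h : Blocks ρ σ β S k m) {i j : ℤ} (hi : i ∈ S) (hj : j ∈ S)
    (hc : Commute (ρ i) (ρ j)) : Commute (σ i) (σ j) := by
  ext z
  obtain ⟨x, rfl⟩ := h.surj z
  rw [Perm.mul_apply, Perm.mul_apply, ← h.equiv j hj, ← h.equiv i hi, ← h.equiv i hi,
    ← h.equiv j hj, ← Perm.mul_apply, hc.eq, Perm.mul_apply]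

theorem str_block (h : Blocks ρ σ β S k m) : Str σ S := fun i hi j hj hij =>
  h.commute_block hi hj (h.good.str i hi j hj hij)

theorem invol_block (h : Blocks ρ σ β S k m) {i : ℤ} (hi : i ∈ S) : σ i * σ i = 1 := by
  ext z
  obtain ⟨x, rfl⟩ := h.surj z
  rw [Perm.mul_apply, ← h.equiv i hi, ← h.equiv i hi, ← Perm.mul_apply, h.invol i hi]; rfl

theorem tr_block (h : Blocks ρ σ β S k m) (hJ : J ⊆ S) (ht : Tr (gen ρ J) Set.univ) :
    Tr (gen σ J) Set.univ := by
  intro z _ w _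
  obtain ⟨x, rfl⟩ := h.surj z
  obtain ⟨y, rfl⟩ := h.surj w
  obtain ⟨g, hg, rfl⟩ := ht x trivial y trivial
  obtain ⟨g', hg', e⟩ := h.exists_proj hJ hg
  exact ⟨g', hg', (e x).symm⟩

theorem block_trans (h : Blocks ρ σ β S k m) (hJ : J ⊆ S) (ht : Tr (gen σ J) Set.univ) (x y : X) :
    ∃ g ∈ gen ρ J, β (g x) = β y := by
  obtain ⟨g, hg, e⟩ := ht (β x) trivial (β y) trivial
  obtain ⟨g', hg', e'⟩ := h.exists_lift hJ hg
  exact ⟨g', hg', (e' x).trans e⟩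

/-- A minimal set of generators for the action on the blocks. -/
theorem exists_min (σ : ℤ → Perm Z) (S : Finset ℤ) :
    ∃ L ⊆ S, gen σ L = gen σ S ∧ Indep σ L := by
  classical
  have hne : (S.powerset.filter fun L => gen σ L = gen σ S).Nonempty :=
    ⟨S, Finset.mem_filter.2 ⟨Finset.mem_powerset_self S, rfl⟩⟩
  obtain ⟨L, hL, hmin⟩ := Finset.exists_min_image _ Finset.card hne
  rw [Finset.mem_filter, Finset.mem_powerset] at hL
  refine ⟨L, hL.1, hL.2, fun i hi hm => ?_⟩
  have h1 : gen σ (L.erase i) = gen σ S := by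
    rw [← hL.2]
    refine (gen_mono (Finset.erase_subset i L)).antisymm (gen_le.2 fun j hj => ?_)
    by_cases hji : j = i
    · rwa [hji]
    · exact mem_gen (Finset.mem_erase.2 ⟨hji, hj⟩)
  have := hmin (L.erase i) (Finset.mem_filter.2 ⟨Finset.mem_powerset.2
    ((Finset.erase_subset i L).trans hL.1), h1⟩)
  have := Finset.card_erase_lt_of_mem hi
  omega

end

section

variable [Finite X] [Finite Z]

theorem good_block (h : Blocks ρ σ β S k m) [Nonempty Z] (hLS : L ⊆ S) (hL : gen σ L = gen σ S)
    (hi : Indep σ L) : Good σ L Set.univ where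
  nonempty := Set.univ_nonempty
  str := h.str_block.mono hLS
  indep := hi
  inv := inv_univ
  tr := by rw [hL]; exact h.tr_block le_rfl h.good.tr
  faith := faith_univ

theorem nonempty_block (h : Blocks ρ σ β S k m) : Nonempty Z := by
  obtain ⟨x, -⟩ := h.good.nonempty
  exact ⟨β x⟩

theorem ncard_univ (h : Blocks ρ σ β S k m) : (Set.univ : Set Z).ncard = m := by
  rw [Set.ncard_univ, h.card]

/-- A generator commuting with the whole block action acts trivially on the blocks. -/
theorem eq_one_of_central (h : Blocks ρ σ β S k m) (hm : 3 ≤ m) (hL : gen σ L = gen σ S)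
    {c : ℤ} (hc : c ∈ S) (hcomm : ∀ l ∈ L, Commute (σ l) (σ c)) : σ c = 1 := by
  by_contra hne
  have hcen : ∀ g ∈ gen σ S, Commute g (σ c) := fun g hg => commute_gen hcomm (hL ▸ hg)
  have htr := h.prim (Subgroup.zpowers (σ c)) (Subgroup.zpowers_le.2 (mem_gen hc))
    (fun e => hne (Subgroup.zpowers_eq_bot.1 e)) (by
      rintro g hg _ ⟨t, rfl⟩
      simp only
      rw [((hcen g hg).zpow_right t).eq, mul_inv_cancel_right]
      exact ⟨t, rfl⟩)
  obtain ⟨z⟩ := h.nonempty_block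
  have h1 := ncard_orb_le_card (H := Subgroup.zpowers (σ c)) z
  rw [htr.orb_eq inv_univ trivial, h.ncard_univ, Nat.card_zpowers] at h1
  have h2 : orderOf (σ c) ≤ 2 := orderOf_le_of_pow_eq_one (by norm_num)
    (by rw [pow_two]; exact h.invol_block hc)
  omega

theorem beta_eq_of_central (h : Blocks ρ σ β S k m) (hm : 3 ≤ m) (hLS : L ⊆ S)
    (hL : gen σ L = gen σ S) {c : ℤ} (hc : c ∈ S) (hcomm : ∀ l ∈ L, Commute (ρ l) (ρ c)) (x : X) :
    β (ρ c x) = β x := by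
  rw [h.equiv c hc, h.eq_one_of_central hm hL hc fun l hl => h.commute_block (hLS hl) hc (hcomm l hl)]
  rfl

/-- The generators commuting with a block of consecutive indices. -/
theorem comm_far (hs : Str ρ S) {x y : ℤ} (hLS : Finset.Icc x y ⊆ S) :
    Comm ρ (Finset.Icc x y) (low S (x - 1) ∪ high S (y + 1)) := by
  intro l hl c hc
  have hl' := Finset.mem_Icc.1 hl
  rcases Finset.mem_union.1 hc with h | h
  · rw [mem_low] at h
    exact (hs c h.1 l (hLS hl) (by omega)).symm
  · rw [mem_high] at h
    exact hs l (hLS hl) c h.1 (by omega)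

theorem subset_far (x y : ℤ) : S ⊆ Finset.Icc x y ∪ {x - 1, y + 1} ∪
    (low S (x - 1) ∪ high S (y + 1)) := by
  intro j hj
  simp only [Finset.mem_union, Finset.mem_Icc, Finset.mem_insert, Finset.mem_singleton, mem_low,
    mem_high, hj, true_and]
  omega

theorem card_far (x y : ℤ) : S.card ≤ (Finset.Icc x y).card + 2 +
    ((low S (x - 1)).card + (high S (y + 1)).card) := by
  refine (Finset.card_le_card (subset_far x y)).trans ?_
  refine (Finset.card_union_le _ _).trans (Nat.add_le_add ?_ (Finset.card_union_le _ _))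
  exact (Finset.card_union_le _ _).trans (Nat.add_le_add_left Finset.card_le_two _)

/-- The far generators are few when a run of consecutive generators is block-transitive. -/
theorem card_far_le {Ω : Set X} (hG : Good ρ S Ω) {x y : ℤ} (hxy : x ≤ y)
    (hLS : Finset.Icc x y ⊆ S)
    (hL : ∀ u ∈ Ω, ∀ v ∈ Ω, ∃ g ∈ gen ρ (Finset.Icc x y), β (g u) = β v)
    (hβ : ∀ c ∈ low S (x - 1) ∪ high S (y + 1), ∀ u, β (ρ c u) = β u)
    (hk : ∀ c, {u | β u = c}.ncard = k) :
    (low S (x - 1)).card + (high S (y + 1)).card + 1 ≤ k := by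
  obtain ⟨u, hu⟩ := hG.nonempty
  refine (card_segments_add_one_le hG β hLS hL (low_subset _) (high_subset _)
    (fun i hi x _ => hβ i hi x) (comm_far hG.str hLS) ?_ (Good.disjoint_low_high (by omega)) ?_ ?_
    hu).trans ?_
  · rw [Finset.disjoint_left]
    intro j hj hj'
    simp only [Finset.mem_Icc, Finset.mem_union, mem_low, mem_high] at hj hj'
    omega
  · intro i hi j hj hji
    rw [mem_low] at hi ⊢
    exact ⟨hj, by omega⟩
  · intro i hi j hj hji
    rw [mem_high] at hi ⊢
    exact ⟨hj, by omega⟩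
  · rw [← hk (β u)]
    exact Set.ncard_le_ncard (fun v hv => hv.2) (Set.toFinite _)

theorem card_far_le_of_run (h : Blocks ρ σ β S k m) (hm : 3 ≤ m) {x y : ℤ} (hxy : x ≤ y)
    (hLS : Finset.Icc x y ⊆ S) (hL : gen σ (Finset.Icc x y) = gen σ S) :
    (low S (x - 1)).card + (high S (y + 1)).card + 1 ≤ k := by
  refine card_far_le h.good hxy hLS (fun u _ v _ => h.block_trans hLS ?_ u v) ?_ h.fib
  · rw [hL]; exact h.tr_block le_rfl h.good.tr
  · intro c hc u
    have hcS : c ∈ S := Finset.union_subset (low_subset _) (high_subset _) hc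
    exact h.beta_eq_of_central hm hLS hL hcS (fun l hl => comm_far h.good.str hLS l hl c hc) u

end

end Blocks

end StringPerm

namespace StringPerm

open Equiv
open scoped Pointwise

variable {X Z : Type*} {ρ : ℤ → Perm X} {σ : ℤ → Perm Z} {β : X → Z}
  {A B C E S T L J : Finset ℤ} {k m : ℕ}

/-- A generating set for the block action made of two commuting independent parts. -/
structure Split (σ : ℤ → Perm Z) (S A B : Finset ℤ) : Prop where
  sub : A ∪ B ⊆ S
  gen_eq : gen σ (A ∪ B) = gen σ S
  indep : Indep σ (A ∪ B)
  disj : Disjoint A B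
  comm : Comm σ A B
  left : A.Nonempty
  right : B.Nonempty

namespace Split

theorem symm (h : Split σ S A B) : Split σ S B A where
  sub := by rw [Finset.union_comm]; exact h.sub
  gen_eq := by rw [Finset.union_comm]; exact h.gen_eq
  indep := by rw [Finset.union_comm]; exact h.indep
  disj := h.disj.symm
  comm := h.comm.symm
  left := h.right
  right := h.left

theorem subset_left (h : Split σ S A B) : A ⊆ S := Finset.subset_union_left.trans h.sub

theorem indep_left (h : Split σ S A B) : Indep σ A := h.indep.mono Finset.subset_union_left

theorem tr_of_normal (h : Split σ S A B) (hB : Blocks ρ σ β S k m) {N : Subgroup (Perm Z)}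
    (hN : N ≤ gen σ A) (h1 : N ≠ ⊥) (hn : ∀ g ∈ gen σ A, ∀ n ∈ N, g * n * g⁻¹ ∈ N) :
    Tr N Set.univ := by
  refine hB.prim N (hN.trans (gen_mono h.subset_left)) h1 fun g hg n hnN => ?_
  rw [← h.gen_eq] at hg
  obtain ⟨a, ha, b, hb, rfl⟩ := h.comm.exists_mul hg
  have hc := h.comm.commute (hN hnN) hb
  have : a * b * n * (a * b)⁻¹ = a * n * a⁻¹ := by
    rw [mul_inv_rev, mul_assoc a b n, ← hc.eq]; group
  rw [this]
  exact hn a ha n hnN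

theorem false_of_abelian (h : Split σ S A B) (hB : Blocks ρ σ β S k m) {N : Subgroup (Perm Z)}
    (hN : N ≤ gen σ A) (h1 : N ≠ ⊥) (hab : ∀ a ∈ N, ∀ b ∈ N, Commute a b)
    (hn : ∀ g ∈ gen σ A, ∀ n ∈ N, g * n * g⁻¹ ∈ N) : False := by
  have htr := h.tr_of_normal hB hN h1 hn
  obtain ⟨l, hl⟩ := h.right
  obtain ⟨x, -⟩ := hB.good.nonempty
  have := mem_of_abelian (z := σ l) ⟨β x, Set.mem_univ _⟩ htr hab
    (fun a ha => h.comm.commute (hN ha) (mem_gen hl)) (fun _ _ => trivial)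
    (fun a _ e => Equiv.ext fun y => e y trivial)
  exact h.indep.not_mem Finset.subset_union_left (Finset.mem_union_right _ hl)
    (fun hl' => Finset.disjoint_left.1 h.disj hl' hl) (hN this)

theorem gen_ne_bot (h : Split σ S A B) : gen σ A ≠ ⊥ := by
  intro e
  obtain ⟨l, hl⟩ := h.left
  exact h.indep_left.ne_one hl (Subgroup.mem_bot.1 (e ▸ mem_gen hl))

theorem tr_left (h : Split σ S A B) (hB : Blocks ρ σ β S k m) : Tr (gen σ A) Set.univ :=
  h.tr_of_normal hB le_rfl h.gen_ne_bot fun _ hg _ hn => mul_mem (mul_mem hg hn) (inv_mem hg)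

theorem card_left [Finite Z] [Finite X] (h : Split σ S A B) (hB : Blocks ρ σ β S k m) :
    Nat.card (gen σ A) = m := by
  obtain ⟨z⟩ := hB.nonempty_block
  rw [card_eq_ncard_orb z, (h.tr_left hB).orb_eq inv_univ trivial, hB.ncard_univ]
  intro b hb e
  exact eq_one_of_fix (h.symm.tr_left hB) faith_univ
    (fun a ha b hb => h.symm.comm.commute ha hb) hb trivial e

theorem three_le_card (h : Split σ S A B) (hB : Blocks ρ σ β S k m) : 3 ≤ A.card := by
  have h0 := h.left.card_pos
  by_contra hlt
  have h12 : A.card = 1 ∨ A.card = 2 := by omega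
  rcases h12 with h1 | h2
  · obtain ⟨a, rfl⟩ := Finset.card_eq_one.1 h1
    have hc : Comm σ {a} {a} := by
      intro i hi j hj
      rw [Finset.mem_singleton.1 hi, Finset.mem_singleton.1 hj]
    exact h.false_of_abelian hB le_rfl h.gen_ne_bot (fun x hx y hy => hc.commute hx hy)
      fun _ hg _ hn => mul_mem (mul_mem hg hn) (inv_mem hg)
  · obtain ⟨a, b, hab, rfl⟩ := Finset.card_eq_two.1 h2
    have haS : a ∈ S := h.subset_left (by simp)
    have hbS : b ∈ S := h.subset_left (by simp)
    have ia := hB.invol_block haS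
    have ib := hB.invol_block hbS
    have ia' : (σ a)⁻¹ = σ a := inv_eq_of_mul_eq_one_left ia
    have ib' : (σ b)⁻¹ = σ b := inv_eq_of_mul_eq_one_left ib
    have ma : σ a ∈ gen σ {a, b} := mem_gen (by simp)
    have mb : σ b ∈ gen σ {a, b} := mem_gen (by simp)
    refine h.false_of_abelian hB (N := Subgroup.zpowers (σ a * σ b))
      (Subgroup.zpowers_le.2 (mul_mem ma mb)) ?_ ?_ ?_
    · intro e
      have e' := Subgroup.zpowers_eq_bot.1 e
      have : σ a = σ b := by rw [← ib']; exact eq_inv_of_mul_eq_one_left e'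
      exact hab (h.indep_left.injOn (by simp) (by simp) this)
    · rintro _ ⟨s, rfl⟩ _ ⟨t, rfl⟩
      exact (Commute.refl _).zpow_zpow s t
    · have key : gen σ {a, b} ≤ Subgroup.normalizer (Subgroup.zpowers (σ a * σ b) : Set (Perm Z)) := by
        have inv1 : (σ a * σ b)⁻¹ = σ b * σ a := by rw [mul_inv_rev, ia', ib']
        have gen1 : ∀ g : Perm Z, g * g = 1 → g * (σ a * σ b) * g⁻¹ = (σ a * σ b)⁻¹ →
            g ∈ Subgroup.normalizer (Subgroup.zpowers (σ a * σ b) : Set (Perm Z)) := by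
          intro g hg hgc
          have hsub : ∀ n ∈ Subgroup.zpowers (σ a * σ b),
              g * n * g⁻¹ ∈ Subgroup.zpowers (σ a * σ b) := by
            rintro _ ⟨t, rfl⟩
            simp only
            rw [← conj_zpow, hgc]
            exact zpow_mem (inv_mem (Subgroup.mem_zpowers _)) t
          rw [Subgroup.mem_normalizer_iff]
          intro n
          refine ⟨hsub n, fun hn => ?_⟩
          have := hsub _ hn
          have hg' : g⁻¹ = g := inv_eq_of_mul_eq_one_left hg
          rwa [hg', show g * (g * n * g) * g = (g * g) * n * (g * g) by group, hg, one_mul,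
            mul_one] at this
        refine gen_le.2 fun i hi => ?_
        rcases Finset.mem_insert.1 hi with rfl | hi
        · exact gen1 _ ia (by rw [inv1, ia', ← mul_assoc, ia, one_mul])
        · rw [Finset.mem_singleton.1 hi]
          exact gen1 _ ib (by rw [inv1, ib', mul_assoc, mul_assoc, ib, mul_one])
      intro g hg n hn
      exact (Subgroup.mem_normalizer_iff.1 (key hg) n).1 hn

theorem false_of_three [Finite Z] [Finite X] (h : Split σ S A B) (hB : Blocks ρ σ β S k m)
    {A₁ A₂ : Finset ℤ} (hA : A = A₁ ∪ A₂) (hd : Disjoint A₁ A₂) (hc : Comm σ A₁ A₂)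
    (h₁ : A₁.Nonempty) (h₂ : A₂.Nonempty) : False := by
  subst hA
  have hs : Split σ S A₁ (A₂ ∪ B) :=
    { sub := by rw [← Finset.union_assoc]; exact h.sub
      gen_eq := by rw [← Finset.union_assoc]; exact h.gen_eq
      indep := by rw [← Finset.union_assoc]; exact h.indep
      disj := Finset.disjoint_union_right.2 ⟨hd, h.disj.mono_left Finset.subset_union_left⟩
      comm := fun i hi j hj => (Finset.mem_union.1 hj).elim (hc i hi j)
        (h.comm i (Finset.mem_union_left _ hi) j)
      left := h₁
      right := h₂.mono Finset.subset_union_left }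
  have c1 := hs.symm.card_left hB
  have c2 := h.symm.card_left hB
  have e : gen σ B = gen σ (A₂ ∪ B) := by
    refine Subgroup.eq_of_le_of_card_ge (gen_mono Finset.subset_union_right) ?_
    rw [c1, c2]
  obtain ⟨l, hl⟩ := h₂
  have hl' : l ∈ A₁ ∪ A₂ := Finset.mem_union_right _ hl
  refine h.indep.not_mem Finset.subset_union_right (Finset.mem_union_left _ hl')
    (fun hlB => Finset.disjoint_left.1 h.disj hl' hlB) ?_
  rw [e]; exact mem_gen (Finset.mem_union_left _ hl)

end Split

/-- A nonempty set of integers is an interval or has an internal gap. -/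
theorem eq_Icc_or_gap (hA : A.Nonempty) : (∃ x y, x ≤ y ∧ A = Finset.Icc x y) ∨
    ∃ j, j ∉ A ∧ (low A j).Nonempty ∧ (high A j).Nonempty := by
  by_cases h : ∃ j, j ∉ A ∧ A.min' hA < j ∧ j < A.max' hA
  · obtain ⟨j, hj, h1, h2⟩ := h
    exact Or.inr ⟨j, hj, ⟨_, mem_low.2 ⟨A.min'_mem hA, h1⟩⟩, ⟨_, mem_high.2 ⟨A.max'_mem hA, h2⟩⟩⟩
  · left
    refine ⟨A.min' hA, A.max' hA, A.min'_le _ (A.max'_mem hA), ?_⟩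
    ext j
    rw [Finset.mem_Icc]
    refine ⟨fun hj => ⟨A.min'_le _ hj, A.le_max' _ hj⟩, fun hj => ?_⟩
    by_contra hjA
    refine h ⟨j, hjA, lt_of_le_of_ne hj.1 ?_, lt_of_le_of_ne hj.2 ?_⟩
    · rintro rfl; exact hjA (A.min'_mem hA)
    · rintro rfl; exact hjA (A.max'_mem hA)

theorem eq_low_union_high {j : ℤ} (hj : j ∉ A) : A = low A j ∪ high A j := by
  rw [← erase_eq_low_union_high, Finset.erase_eq_of_notMem hj]

namespace Split

theorem eq_Icc [Finite Z] [Finite X] (h : Split σ S A B) (hB : Blocks ρ σ β S k m) :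
    ∃ x y, x ≤ y ∧ A = Finset.Icc x y := by
  rcases eq_Icc_or_gap h.left with h' | ⟨j, hj, h1, h2⟩
  · exact h'
  · exact (h.false_of_three hB (eq_low_union_high hj) (Good.disjoint_low_high le_rfl)
      ((hB.str_block.mono h.subset_left).comm_low_high j) h1 h2).elim

theorem twelve_le [Finite Z] [Finite X] (h : Split σ S A B) (hB : Blocks ρ σ β S k m) :
    12 ≤ m := by
  have h3 := h.three_le_card hB
  have hm := h.card_left hB
  have hind := h.indep_left
  obtain ⟨T, hT, hT2⟩ := Finset.exists_subset_card_eq (show 2 ≤ A.card by omega)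
  have hd4 := two_pow_le_card (hind.mono hT)
  rw [hT2] at hd4
  obtain ⟨a, ha, haT⟩ : ∃ a ∈ A, a ∉ T := by
    by_contra hcon
    push Not at hcon
    have := Finset.card_le_card hcon
    omega
  have hd2 := two_mul_card_le (gen_mono hT) (mem_gen ha) (hind.not_mem hT ha haT)
  have hdvd := Subgroup.card_dvd_of_le (gen_mono (ρ := σ) hT)
  obtain ⟨t, ht⟩ : T.Nonempty := Finset.card_pos.1 (by omega)
  have heven : 2 ∣ Nat.card (gen σ T) := by
    have ho : orderOf (σ t) = 2 := orderOf_eq_prime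
      (by rw [pow_two]; exact hB.invol_block (h.subset_left (hT ht))) (hind.ne_one (hT ht))
    rw [← ho, ← Subgroup.orderOf_mk (σ t) (mem_gen ht)]
    exact orderOf_dvd_natCard _
  rw [hm] at hd2 hdvd
  by_contra hlt
  have hm8 : m = 8 := by
    obtain ⟨q, hq⟩ := hdvd
    obtain ⟨p, hp⟩ := heven
    rw [hp] at hd4 hd2 hq
    have hp2 : p = 2 := by omega
    subst hp2
    have : 2 ^ 3 ≤ m := by
      rw [← hm]
      exact (Nat.pow_le_pow_right (by norm_num) h3).trans (two_pow_le_card hind)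
    omega
  have hp : IsPGroup 2 (gen σ A) := IsPGroup.of_card (n := 3) (by rw [hm, hm8]; norm_num)
  have : Nontrivial (gen σ A) := (Subgroup.nontrivial_iff_ne_bot _).2 h.gen_ne_bot
  have : Fact (Nat.Prime 2) := ⟨Nat.prime_two⟩
  have hc := hp.center_nontrivial
  refine h.false_of_abelian hB (N := (Subgroup.center (gen σ A)).map (gen σ A).subtype) ?_ ?_ ?_ ?_
  · exact Subgroup.map_subtype_le _
  · intro e
    rw [Subgroup.map_eq_bot_iff_of_injective _ (Subgroup.subtype_injective _)] at e
    exact (Subgroup.nontrivial_iff_ne_bot _).1 hc e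
  · rintro _ ⟨a, ha, rfl⟩ _ ⟨b, hb, rfl⟩
    have := Subgroup.mem_center_iff.1 hb a
    exact congrArg Subtype.val this
  · rintro g hg _ ⟨a, ha, rfl⟩
    have := Subgroup.mem_center_iff.1 ha ⟨g, hg⟩
    have e : g * a.1 = a.1 * g := congrArg Subtype.val this
    simp only [Subgroup.coe_subtype]
    rw [e, mul_inv_cancel_right]
    exact ⟨a, ha, rfl⟩

theorem two_mul_card_add_six_le [Finite Z] [Finite X] (h : Split σ S A B)
    (hB : Blocks ρ σ β S k m) : 2 * A.card + 6 ≤ m := by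
  have h12 := h.twelve_le hB
  have h2 := two_pow_le_card h.indep_left
  rw [h.card_left hB] at h2
  have key : ∀ a, 4 ≤ a → 2 * a + 6 ≤ 2 ^ a := by
    intro a ha
    induction a, ha using Nat.le_induction with
    | base => norm_num
    | succ a ha ih => rw [pow_succ]; omega
  rcases le_or_gt 4 A.card with h4 | h4
  · exact (key _ h4).trans h2
  · omega

end Split

namespace Blocks

variable [Finite X] [Finite Z]

theorem norb_le (h : Blocks ρ σ β S k m) (hJ : J ⊆ S) (ht : Tr (gen σ J) Set.univ) :
    norb (gen ρ J) Set.univ ≤ k := by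
  obtain ⟨x, -⟩ := h.good.nonempty
  rw [← h.fib (β x)]
  refine le_trans ?_ (norb_le_ncard (H := gen ρ J))
  refine Set.ncard_le_ncard ?_ (Set.toFinite _)
  rintro _ ⟨y, -, rfl⟩
  obtain ⟨g, hg, e⟩ := h.block_trans hJ ht y x
  exact ⟨g y, e, orb_eq_of_mem (apply_mem_orb hg y)⟩

theorem card_part_le (h : Blocks ρ σ β S k m) (hm : 3 ≤ m) {P Q : Finset ℤ} (hP : P ⊆ S)
    (hc : Comm ρ P Q) (ht : Tr (gen ρ (P ∪ Q)) Set.univ) {x y : ℤ} (hxy : x ≤ y)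
    (hLP : Finset.Icc x y ⊆ P) (hLt : Tr (gen σ (Finset.Icc x y)) Set.univ)
    (hgen : gen σ (Finset.Icc x y ∪ B) = gen σ S) (hBS : B ⊆ S)
    (hBc : Comm ρ B (low P (x - 1) ∪ high P (y + 1))) :
    P.card ≤ (Finset.Icc x y).card + k + 1 := by
  obtain ⟨u, hu⟩ := h.good.nonempty
  have hG : Good ρ P (orb (gen ρ P) u) := h.good.orbit hc.symm
    (by rw [Finset.union_comm]; exact ht) hP hu
  have := card_far_le (k := k) (β := β) hG hxy hLP (fun u _ v _ => by
      obtain ⟨g, hg, e⟩ := h.block_trans (hLP.trans hP) hLt u v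
      exact ⟨g, hg, e⟩)
    (fun c hc' u => h.beta_eq_of_central hm (Finset.union_subset (hLP.trans hP) hBS) hgen
      (hP (Finset.union_subset (low_subset _) (high_subset _) hc')) (fun l hl => ?_) u) h.fib
  · have := card_far (S := P) x y
    omega
  · rcases Finset.mem_union.1 hl with hl | hl
    · exact comm_far hG.str hLP l hl c hc'
    · exact hBc l hl c hc'

theorem card_le_of_split (h : Blocks ρ σ β S k m) (hm : 3 ≤ m) {x y u v : ℤ} (hxy : x ≤ y)
    (huv : u ≤ v) (hyu : y + 1 < u) (sp : Split σ S (Finset.Icc x y) (Finset.Icc u v)) :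
    S.card ≤ (Finset.Icc x y).card + (Finset.Icc u v).card + 2 * k + 3 := by
  have hs := h.good.str
  have hAS := sp.subset_left
  have hBS := sp.symm.subset_left
  by_cases hj : ∃ j ∈ S, y < j ∧ j < u ∧ Tr (gen ρ (S.erase j)) Set.univ
  · obtain ⟨j, hjS, hyj, hju, htr⟩ := hj
    rw [erase_eq_low_union_high] at htr
    have hc := hs.comm_low_high j
    have h1 := h.card_part_le hm (low_subset j) hc htr hxy
      (fun l hl => mem_low.2 ⟨hAS hl, by rw [Finset.mem_Icc] at hl; omega⟩) (sp.tr_left h)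
      sp.gen_eq hBS (by
        intro l hl c hc
        rw [Finset.mem_Icc] at hl
        simp only [Finset.mem_union, mem_low, mem_high] at hc
        refine (hs c ?_ l (hBS (Finset.mem_Icc.2 hl)) (by omega)).symm
        tauto)
    have h2 := h.card_part_le hm (high_subset j) hc.symm (by rwa [Finset.union_comm]) huv
      (fun l hl => mem_high.2 ⟨hBS hl, by rw [Finset.mem_Icc] at hl; omega⟩) (sp.symm.tr_left h)
      sp.symm.gen_eq hAS (by
        intro l hl c hc
        rw [Finset.mem_Icc] at hl
        simp only [Finset.mem_union, mem_low, mem_high] at hc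
        refine hs l (hAS (Finset.mem_Icc.2 hl)) c ?_ (by omega)
        tauto)
    have := card_split hjS
    omega
  · push Not at hj
    set E := S.filter fun j => y < j ∧ j < u with hE
    have hES : E ⊆ S := Finset.filter_subset _ _
    have h1 := card_add_one_le_norb hES h.good.nonempty inv_univ
      (fun e he => by
        rw [hE, Finset.mem_filter] at he
        exact hj e he.1 he.2.1 he.2.2) h.good.tr
    have hLE : Finset.Icc x y ⊆ S \ E := by
      intro l hl
      rw [Finset.mem_sdiff, hE, Finset.mem_filter]
      refine ⟨hAS hl, ?_⟩
      rw [Finset.mem_Icc] at hl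
      omega
    have h2 := (norb_anti (gen_mono (ρ := ρ) hLE)).trans (h.norb_le hAS (sp.tr_left h))
    obtain ⟨w, hw⟩ := h.good.nonempty
    have hcomm : Comm ρ (Finset.Icc x y ∪ Finset.Icc u v) (low S (x - 1) ∪ high S (v + 1)) := by
      intro l hl c hc
      have hlS := sp.sub hl
      simp only [Finset.mem_union, Finset.mem_Icc, mem_low, mem_high] at hl hc
      rcases hc with hc | hc
      · exact (hs c hc.1 l hlS (by omega)).symm
      · exact hs l hlS c hc.1 (by omega)
    have h3 := card_segments_add_one_le h.good β sp.sub
      (fun a _ b _ => h.block_trans sp.sub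
        ((sp.tr_left h).mono (gen_mono Finset.subset_union_left)) a b)
      (low_subset (x - 1)) (high_subset (v + 1))
      (fun c hc a _ => h.beta_eq_of_central hm sp.sub sp.gen_eq
        (Finset.union_subset (low_subset _) (high_subset _) hc) (fun l hl => hcomm l hl c hc) a)
      hcomm (by
        rw [Finset.disjoint_left]
        intro l hl hc
        simp only [Finset.mem_union, Finset.mem_Icc, mem_low, mem_high] at hl hc
        omega) (Good.disjoint_low_high (by omega))
      (fun i hi j hj hji => by
        rw [mem_low] at hi ⊢
        exact ⟨hj, by omega⟩)
      (fun i hi j hj hji => by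
        rw [mem_high] at hi ⊢
        exact ⟨hj, by omega⟩) hw
    have h4 : {a | a ∈ Set.univ ∧ β a = β w}.ncard = k := by
      rw [← h.fib (β w)]; simp
    rw [h4] at h3
    have h5 : S ⊆ (Finset.Icc x y ∪ Finset.Icc u v) ∪ (E ∪ ({x - 1, v + 1} ∪
        (low S (x - 1) ∪ high S (v + 1)))) := by
      intro j hj
      simp only [hE, Finset.mem_union, Finset.mem_Icc, Finset.mem_insert, Finset.mem_singleton,
        Finset.mem_filter, mem_low, mem_high, hj, true_and]
      omega
    have h6 := Finset.card_le_card h5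
    have h7 := Finset.card_union_le (Finset.Icc x y ∪ Finset.Icc u v) (E ∪ ({x - 1, v + 1} ∪
        (low S (x - 1) ∪ high S (v + 1))))
    have h8 := Finset.card_union_le (Finset.Icc x y) (Finset.Icc u v)
    have h9 := Finset.card_union_le E ({x - 1, v + 1} ∪ (low S (x - 1) ∪ high S (v + 1)))
    have h10 := Finset.card_union_le {x - 1, v + 1} (low S (x - 1) ∪ high S (v + 1))
    have h11 := Finset.card_union_le (low S (x - 1)) (high S (v + 1))
    have h12 : ({x - 1, v + 1} : Finset ℤ).card ≤ 2 := Finset.card_le_two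
    omega

/-- Either a run of consecutive generators generates the block action, or the rank is small. -/
theorem exists_run (h : Blocks ρ σ β S k m) (hm : 3 ≤ m) :
    (∃ x y, x ≤ y ∧ Finset.Icc x y ⊆ S ∧ gen σ (Finset.Icc x y) = gen σ S ∧
      Good σ (Finset.Icc x y) Set.univ) ∨ (12 ≤ m ∧ S.card + 3 ≤ m + 2 * k) := by
  have := h.nonempty_block
  obtain ⟨L, hLS, hgen, hind⟩ := exists_min σ S
  have hG := h.good_block hLS hgen hind
  have hne : L.Nonempty := by
    rw [Finset.nonempty_iff_ne_empty]
    rintro rfl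
    obtain ⟨z⟩ := this
    have := hG.tr.orb_eq hG.inv (Set.mem_univ z)
    rw [gen_empty, orb_bot] at this
    have h2 := h.ncard_univ
    rw [← this, Set.ncard_singleton] at h2
    omega
  rcases eq_Icc_or_gap hne with ⟨x, y, hxy, rfl⟩ | ⟨j, hj, h1, h2⟩
  · exact Or.inl ⟨x, y, hxy, hLS, hgen, hG⟩
  · right
    have hL := eq_low_union_high hj
    have sp : Split σ S (low L j) (high L j) :=
      { sub := hL ▸ hLS
        gen_eq := hL ▸ hgen
        indep := hL ▸ hind
        disj := Good.disjoint_low_high le_rfl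
        comm := hG.str.comm_low_high j
        left := h1
        right := h2 }
    have h6 := sp.two_mul_card_add_six_le h
    have h7 := sp.symm.two_mul_card_add_six_le h
    obtain ⟨x, y, hxy, e1⟩ := sp.eq_Icc h
    obtain ⟨u, v, huv, e2⟩ := sp.symm.eq_Icc h
    have hyj := (mem_low.1 (show y ∈ low L j by rw [e1]; exact Finset.mem_Icc.2 ⟨hxy, le_rfl⟩)).2
    have hju := (mem_high.1 (show u ∈ high L j by rw [e2]; exact Finset.mem_Icc.2 ⟨le_rfl, huv⟩)).2
    refine ⟨sp.twelve_le h, ?_⟩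
    rw [e1, e2] at sp
    have := h.card_le_of_split hm hxy huv (by omega) sp
    rw [← e1, ← e2] at this
    omega

theorem card_le_add (h : Blocks ρ σ β S k m) (hm : 3 ≤ m) :
    S.card ≤ k + m ∨ (12 ≤ m ∧ S.card + 3 ≤ m + 2 * k) := by
  rcases h.exists_run hm with ⟨x, y, hxy, hLS, hL, hG⟩ | h'
  · left
    have h1 := h.card_far_le_of_run hm hxy hLS hL
    have h2 := card_far (S := S) x y
    have h3 := hG.card_add_one_le
    rw [h.ncard_univ] at h3
    omega
  · exact Or.inr h'

end Blocks

end StringPerm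

namespace StringPerm

open Equiv
open scoped Pointwise

variable {X Z : Type*} {ρ : ℤ → Perm X} {σ : ℤ → Perm Z} {β : X → Z}
  {A B C E S T L J : Finset ℤ} {k m : ℕ}

namespace Blocks

variable [Finite X] [Finite Z]

/-- The rank is not extremal when full-rank configurations on a block are centralized only by
the identity and are not products of two large commuting parts. -/
theorem card_lt_of_run (h : Blocks ρ σ β S k m) (hm : 3 ≤ m) {x y : ℤ} (hxy : x ≤ y)
    (hLS : Finset.Icc x y ⊆ S) (hL : gen σ (Finset.Icc x y) = gen σ S)
    (hG : Good σ (Finset.Icc x y) Set.univ)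
    (hV : ∀ (Y : Set X) (C : Finset ℤ) (t : Perm X), C ⊆ S → C.card + 1 = k → Y.ncard = k →
      Inv (gen ρ C) Y → Faith (gen ρ C) Y → (∀ c ∈ C, Commute (ρ c) t) → (∀ y ∈ Y, t y ∈ Y) →
      (∃ y ∈ Y, t y ≠ y) → False)
    (hW : ∀ (Y : Set X) (A B : Finset ℤ), A ∪ B ⊆ S → Comm ρ A B → Disjoint A B → 2 ≤ A.card →
      2 ≤ B.card → A.card + B.card + 1 = k → Y.ncard = k → Inv (gen ρ (A ∪ B)) Y →
      Faith (gen ρ (A ∪ B)) Y → False) : S.card < k + m := by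
  by_contra hlt
  set Cl := low S (x - 1) with hCl
  set Cr := high S (y + 1) with hCr
  have h1 := h.card_far_le_of_run hm hxy hLS hL
  rw [← hCl, ← hCr] at h1
  have h2 := card_far (S := S) x y
  have h3 := hG.card_add_one_le
  rw [h.ncard_univ] at h3
  rw [← hCl, ← hCr] at h2
  have hs := h.good.str
  have hFS : Cl ∪ Cr ⊆ S := Finset.union_subset (low_subset _) (high_subset _)
  have hcomm := comm_far hs hLS
  rw [← hCl, ← hCr] at hcomm
  have hd : Disjoint Cl Cr := Good.disjoint_low_high (by omega)
  have hcl : Comm ρ Cl Cr := fun i hi j hj => by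
    rw [hCl, mem_low] at hi
    rw [hCr, mem_high] at hj
    exact hs i hi.1 j hj.1 (by omega)
  have hfix : ∀ c ∈ Cl ∪ Cr, ∀ u, β (ρ c u) = β u := fun c hc u =>
    h.beta_eq_of_central hm hLS hL (hFS hc) (fun l hl => hcomm l hl c hc) u
  have htrL : Tr (gen σ (Finset.Icc x y)) Set.univ := by
    rw [hL]; exact h.tr_block le_rfl h.good.tr
  have hinv : ∀ c, Inv (gen ρ (Cl ∪ Cr)) {u | β u = c} := fun c =>
    inv_gen_of fun i hi u hu => by
      rw [Set.mem_ofPred_eq] at hu ⊢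
      rw [hfix i hi, hu]
  have hfaith : ∀ c, Faith (gen ρ (Cl ∪ Cr)) {u | β u = c} := by
    intro c g hg hgc
    obtain ⟨w, rfl⟩ := h.surj c
    refine Equiv.ext fun u => ?_
    obtain ⟨l, hl, e⟩ := h.block_trans hLS htrL u w
    have hc := hcomm.commute hl hg
    have := hgc (l u) e
    rw [← Perm.mul_apply, ← hc.eq, Perm.mul_apply] at this
    exact l.injective this
  have hcard : (Cl ∪ Cr).card = Cl.card + Cr.card := Finset.card_union_of_disjoint hd
  have noT : ∀ t : Perm X, t ≠ 1 → (∀ u, β (t u) = β u) → (∀ c ∈ Cl ∪ Cr, Commute (ρ c) t) →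
      False := by
    intro t ht htβ htc
    obtain ⟨u, hu⟩ : ∃ u, t u ≠ u := by
      by_contra hcon
      push Not at hcon
      exact ht (Equiv.ext hcon)
    refine hV {v | β v = β u} (Cl ∪ Cr) t hFS (by omega) (h.fib _) (hinv _) (hfaith _) htc
      (fun v hv => ?_) ⟨u, rfl, hu⟩
    rw [Set.mem_ofPred_eq] at hv ⊢
    rw [htβ, hv]
  have noR : ∀ c ∈ S, c ∉ Finset.Icc x y → (∀ d ∈ Cl ∪ Cr, Commute (ρ d) (ρ c)) → False := by
    intro c hcS hcL hcc
    obtain ⟨l, hl, e⟩ := h.exists_lift hLS (hL ▸ mem_gen hcS : σ c ∈ gen σ (Finset.Icc x y))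
    refine noT (ρ c * l⁻¹) ?_ ?_ ?_
    · intro e1
      exact h.good.indep.not_mem hLS hcS hcL (mul_inv_eq_one.1 e1 ▸ hl)
    · intro u
      rw [Perm.mul_apply, h.equiv c hcS, ← e]
      simp
    · intro d hd'
      exact (hcc d hd').mul_right (hcomm.symm.commute (mem_gen hd') (inv_mem hl))
  have single : ∀ c ∈ Cl ∪ Cr, (∀ d ∈ Cl ∪ Cr, Commute (ρ d) (ρ c)) → False := fun c hc hcc =>
    noT (ρ c) (h.good.indep.ne_one (hFS hc)) (hfix c hc) hcc
  have memR : x - 1 ∈ S ∧ y + 1 ∈ S := by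
    have key : ∀ c, S ⊆ Finset.Icc x y ∪ {c} ∪ (Cl ∪ Cr) → False := by
      intro c hc
      have h4 := Finset.card_le_card hc
      have h5 := Finset.card_union_le (Finset.Icc x y ∪ {c}) (Cl ∪ Cr)
      have h6 := Finset.card_union_le (Finset.Icc x y) {c}
      have h7 := Finset.card_singleton c
      omega
    have hsub := subset_far (S := S) x y
    constructor
    · by_contra hn
      refine key (y + 1) fun j hj => ?_
      have := hsub hj
      have hne : j ≠ x - 1 := by rintro rfl; exact hn hj
      simp only [Finset.mem_union, Finset.mem_insert, Finset.mem_singleton] at this ⊢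
      tauto
    · by_contra hn
      refine key (x - 1) fun j hj => ?_
      have := hsub hj
      have hne : j ≠ y + 1 := by rintro rfl; exact hn hj
      simp only [Finset.mem_union, Finset.mem_insert, Finset.mem_singleton] at this ⊢
      tauto
  by_cases hl0 : Cl = ∅
  · refine noR (x - 1) memR.1 (by simp) fun d hd' => ?_
    rw [hl0, Finset.empty_union, hCr, mem_high] at hd'
    exact (hs _ memR.1 _ hd'.1 (by omega)).symm
  by_cases hr0 : Cr = ∅
  · refine noR (y + 1) memR.2 (by simp) fun d hd' => ?_
    rw [hr0, Finset.union_empty, hCl, mem_low] at hd'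
    exact hs _ hd'.1 _ memR.2 (by omega)
  by_cases hl1 : Cl.card = 1
  · obtain ⟨c, hc⟩ := Finset.card_eq_one.1 hl1
    have hcl' : c ∈ Cl := by rw [hc]; simp
    refine single c (Finset.mem_union_left _ hcl') fun d hd' => ?_
    rcases Finset.mem_union.1 hd' with hd' | hd'
    · rw [hc, Finset.mem_singleton] at hd'
      rw [hd']
    · exact (hcl c hcl' d hd').symm
  by_cases hr1 : Cr.card = 1
  · obtain ⟨c, hc⟩ := Finset.card_eq_one.1 hr1
    have hcl' : c ∈ Cr := by rw [hc]; simp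
    refine single c (Finset.mem_union_right _ hcl') fun d hd' => ?_
    rcases Finset.mem_union.1 hd' with hd' | hd'
    · exact hcl d hd' c hcl'
    · rw [hc, Finset.mem_singleton] at hd'
      rw [hd']
  have hl2 := Finset.card_pos.2 (Finset.nonempty_iff_ne_empty.2 hl0)
  have hr2 := Finset.card_pos.2 (Finset.nonempty_iff_ne_empty.2 hr0)
  obtain ⟨w, -⟩ := h.good.nonempty
  exact hW {u | β u = β w} Cl Cr hFS hcl hd (by omega) (by omega) (by omega) (h.fib _) (hinv _)
    (hfaith _)

end Blocks

end StringPerm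

namespace StringPerm

open Equiv
open scoped Pointwise

variable {X : Type*} {ρ : ℤ → Perm X} {A B C E S T L J : Finset ℤ} {H K : Subgroup (Perm X)}
  {Y Y' : Set X}

section Restrict

open Classical in
/-- The restriction of the permutations `ρ i` to an invariant set. -/
noncomputable def res (ρ : ℤ → Perm X) (Y : Set X) (i : ℤ) : Perm Y :=
  if h : ∀ x, ρ i x ∈ Y ↔ x ∈ Y then (ρ i).subtypePerm h else 1

theorem res_apply (hinv : Inv (gen ρ C) Y) {i : ℤ} (hi : i ∈ C) (y : Y) :
    ((res ρ Y i y : Y) : X) = ρ i y := by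
  rw [res, dif_pos fun x => hinv.apply_mem_iff (mem_gen hi)]
  rfl

theorem res_lift (hinv : Inv (gen ρ C) Y) (hJ : J ⊆ C) {p : Perm Y} (hp : p ∈ gen (res ρ Y) J) :
    ∃ g ∈ gen ρ J, ∀ y : Y, ((p y : Y) : X) = g y := by
  rw [gen] at hp
  induction hp using Subgroup.closure_induction with
  | mem y hy =>
    obtain ⟨i, hi, rfl⟩ := hy
    exact ⟨ρ i, mem_gen hi, res_apply hinv (hJ hi)⟩
  | one => exact ⟨1, one_mem _, fun _ => rfl⟩
  | mul a b _ _ iha ihb =>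
    obtain ⟨a', ha', ea⟩ := iha
    obtain ⟨b', hb', eb⟩ := ihb
    exact ⟨a' * b', mul_mem ha' hb', fun y => by rw [Perm.mul_apply, ea, eb, Perm.mul_apply]⟩
  | inv a _ iha =>
    obtain ⟨a', ha', ea⟩ := iha
    refine ⟨a'⁻¹, inv_mem ha', fun y => ?_⟩
    rw [Perm.eq_inv_iff_eq, ← ea]; simp

theorem res_proj (hinv : Inv (gen ρ C) Y) (hJ : J ⊆ C) {g : Perm X} (hg : g ∈ gen ρ J) :
    ∃ p ∈ gen (res ρ Y) J, ∀ y : Y, ((p y : Y) : X) = g y := by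
  rw [gen] at hg
  induction hg using Subgroup.closure_induction with
  | mem y hy =>
    obtain ⟨i, hi, rfl⟩ := hy
    exact ⟨res ρ Y i, mem_gen hi, res_apply hinv (hJ hi)⟩
  | one => exact ⟨1, one_mem _, fun _ => rfl⟩
  | mul a b _ _ iha ihb =>
    obtain ⟨a', ha', ea⟩ := iha
    obtain ⟨b', hb', eb⟩ := ihb
    exact ⟨a' * b', mul_mem ha' hb', fun y => by rw [Perm.mul_apply, ea, eb, Perm.mul_apply]⟩
  | inv a _ iha =>
    obtain ⟨a', ha', ea⟩ := iha
    refine ⟨a'⁻¹, inv_mem ha', fun y => ?_⟩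
    rw [Perm.eq_inv_iff_eq, ← ea]; simp

theorem res_commute (hinv : Inv (gen ρ C) Y) {i j : ℤ} (hi : i ∈ C) (hj : j ∈ C)
    (hc : Commute (ρ i) (ρ j)) : Commute (res ρ Y i) (res ρ Y j) := by
  refine Equiv.ext fun y => Subtype.ext ?_
  rw [Perm.mul_apply, Perm.mul_apply, res_apply hinv hi, res_apply hinv hj, res_apply hinv hj,
    res_apply hinv hi, ← Perm.mul_apply, hc.eq, Perm.mul_apply]

theorem res_str (hinv : Inv (gen ρ C) Y) (h : Str ρ C) : Str (res ρ Y) C := fun i hi j hj hij =>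
  res_commute hinv hi hj (h i hi j hj hij)

theorem res_tr (hinv : Inv (gen ρ C) Y) (hJ : J ⊆ C) (h : Tr (gen ρ J) Y) :
    Tr (gen (res ρ Y) J) Set.univ := by
  intro x _ y _
  obtain ⟨g, hg, e⟩ := h x x.2 y y.2
  obtain ⟨p, hp, e'⟩ := res_proj hinv hJ hg
  exact ⟨p, hp, Subtype.ext ((e' x).trans e)⟩

end Restrict

section

variable [Finite X]

theorem card_le_factorial (hinv : Inv H Y) (hf : Faith H Y) : Nat.card H ≤ Y.ncard.factorial := by
  rw [← Nat.card_coe_set_eq, ← Nat.card_perm]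
  refine Nat.card_le_card_of_injective
    (fun g : H => (g.1.subtypePerm fun x => hinv.apply_mem_iff g.2 : Perm Y)) fun g g' e => ?_
  have := hf (g'.1⁻¹ * g.1) (mul_mem (inv_mem g'.2) g.2) fun y hy => by
    have := congrArg Subtype.val (DFunLike.congr_fun e (⟨y, hy⟩ : Y))
    rw [Perm.mul_apply, Perm.inv_eq_iff_eq]
    exact this
  exact Subtype.ext (inv_mul_eq_one.1 this).symm

/-- The elements of `H` fixing a point. -/
def stab (H : Subgroup (Perm X)) (x : X) : Subgroup (Perm X) :=
  H ⊓ MulAction.stabilizer (Perm X) x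

theorem mem_stab {x : X} {g : Perm X} : g ∈ stab H x ↔ g ∈ H ∧ g x = x := by
  rw [stab, Subgroup.mem_inf, MulAction.mem_stabilizer_iff]; rfl

theorem stab_le (x : X) : stab H x ≤ H := inf_le_left

theorem card_le_orb_mul (x : X) : Nat.card H ≤ (orb H x).ncard * Nat.card (stab H x) := by
  choose s hs hsx using fun y : orb H x => y.2
  rw [← Nat.card_coe_set_eq, ← Nat.card_prod]
  refine Nat.card_le_card_of_injective (fun g : H => ((⟨g.1 x, apply_mem_orb g.2 x⟩ : orb H x),
    (⟨(s ⟨g.1 x, apply_mem_orb g.2 x⟩)⁻¹ * g.1, mem_stab.2 ⟨mul_mem (inv_mem (hs _)) g.2, by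
      rw [Perm.mul_apply, Perm.inv_eq_iff_eq, hsx]⟩⟩ : stab H x))) fun g g' e => ?_
  simp only [Prod.mk.injEq, Subtype.mk.injEq] at e
  have h2 := e.2
  simp only [e.1, mul_right_inj] at h2
  exact Subtype.ext h2

/-- A group all of whose orbits have at most two points is small. -/
theorem card_le_two_pow (hinv : Inv H Y) (hf : Faith H Y) (h2 : ∀ x ∈ Y, (orb H x).ncard ≤ 2) :
    Nat.card H ≤ 2 ^ (Y.ncard / 2) := by
  induction hn : Y.ncard using Nat.strong_induction_on generalizing H Y with
  | _ n ih =>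
    by_cases htriv : ∀ g ∈ H, ∀ y ∈ Y, g y = y
    · have : H = ⊥ := (Subgroup.eq_bot_iff_forall _).2 fun g hg => hf g hg (htriv g hg)
      rw [this, Subgroup.card_bot]
      exact Nat.one_le_two_pow
    push Not at htriv
    obtain ⟨g, hg, x, hx, hgx⟩ := htriv
    have ho : (orb H x).ncard = 2 := by
      refine le_antisymm (h2 x hx) ?_
      have : ({x, g x} : Set X) ⊆ orb H x := by
        rintro _ (rfl | rfl)
        exacts [mem_orb_self _, apply_mem_orb hg _]
      rw [← Set.ncard_pair hgx.symm]
      exact Set.ncard_le_ncard this (Set.toFinite _)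
    have hsub := hinv.orb_subset hx
    have hc : (Y \ orb H x).ncard + 2 = n := by
      rw [← hn, ← ho]; exact Set.ncard_sdiff_add_ncard_of_subset hsub
    have hfix : ∀ h ∈ stab H x, ∀ y ∈ orb H x, h y = y := by
      intro h hh y hy
      rw [mem_stab] at hh
      by_cases hyx : y = x
      · rw [hyx, hh.2]
      · refine (Good.eq_of_mem_of_ncard_two ho (mem_orb_self x)
          (mem_orb_trans hy (apply_mem_orb hh.1 y)) hy ?_ hyx)
        intro e
        exact hyx (h.injective (e.trans hh.2.symm))
    have ih' := ih (Y \ orb H x).ncard (by omega) (H := stab H x) (Y := Y \ orb H x)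
      (fun h hh y hy => ⟨hinv h (stab_le x hh) y hy.1, fun hm =>
        hy.2 ((inv_orb x).apply_mem_iff (stab_le x hh) |>.1 hm)⟩)
      (fun h hh hfx => hf h (stab_le x hh) fun y hy => by
        by_cases hyo : y ∈ orb H x
        · exact hfix h hh y hyo
        · exact hfx y ⟨hy, hyo⟩)
      (fun y hy => (Set.ncard_le_ncard (orb_mono (stab_le x) y) (Set.toFinite _)).trans (h2 y hy.1))
      rfl
    have h1 := card_le_orb_mul (H := H) x
    rw [ho] at h1
    have hdiv : n / 2 = (Y \ orb H x).ncard / 2 + 1 := by omega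
    rw [hdiv, pow_succ]
    omega

theorem two_pow_mul_card_le (h : Indep ρ C) (hJ : J ⊆ C) :
    2 ^ (C \ J).card * Nat.card (gen ρ J) ≤ Nat.card (gen ρ C) := by
  have key : ∀ D : Finset ℤ, D ⊆ C \ J →
      2 ^ D.card * Nat.card (gen ρ J) ≤ Nat.card (gen ρ (J ∪ D)) := by
    intro D
    induction D using Finset.induction_on with
    | empty => intro _; simp
    | insert d D hd ih =>
      intro hD
      have h1 := ih ((Finset.subset_insert d D).trans hD)
      have hdC := Finset.mem_sdiff.1 (hD (Finset.mem_insert_self d D))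
      have hJD : J ∪ D ⊆ C := Finset.union_subset hJ
        (((Finset.subset_insert d D).trans hD).trans Finset.sdiff_subset)
      have h2 := h.not_mem hJD hdC.1 (by
        rw [Finset.mem_union]; exact fun h => h.elim hdC.2 hd)
      have h3 := two_mul_card_le (gen_mono (ρ := ρ) (Finset.union_subset_union_right
        (Finset.subset_insert d D) : J ∪ D ⊆ J ∪ insert d D))
        (mem_gen (Finset.mem_union_right _ (Finset.mem_insert_self d D))) h2
      rw [Finset.card_insert_of_notMem hd, pow_succ]
      calc 2 ^ D.card * 2 * Nat.card (gen ρ J) = 2 * (2 ^ D.card * Nat.card (gen ρ J)) := by ring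
        _ ≤ _ := by omega
  have := key (C \ J) le_rfl
  rwa [Finset.union_sdiff_of_subset hJ] at this

/-- The number of generators not needed on an invariant set `Y` is controlled by the action
outside `Y`. -/
theorem two_pow_sdiff_le (h : Indep ρ C) (hJ : J ⊆ C) (hinv : Inv (gen ρ C) Y)
    (hgen : gen (res ρ Y) J = gen (res ρ Y) C) (hinv' : Inv (gen ρ C) Y')
    (hf : Faith (gen ρ C) (Y ∪ Y')) : 2 ^ (C \ J).card ≤ Y'.ncard.factorial := by
  let K : Subgroup (Perm X) := gen ρ C ⊓ fixingSubgroup (Perm X) Y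
  have hK : ∀ g, g ∈ K ↔ g ∈ gen ρ C ∧ ∀ y ∈ Y, g y = y := fun g => by
    rw [Subgroup.mem_inf, mem_fixingSubgroup_iff]; rfl
  have hKC : K ≤ gen ρ C := inf_le_left
  have hcK := card_le_factorial (hinv'.mono hKC) (fun g hg hfx => hf g (hKC hg) fun y hy =>
    hy.elim (((hK g).1 hg).2 y) (hfx y))
  have hlift : ∀ g : gen ρ C, ∃ j : gen ρ J, ∀ y ∈ Y, j.1 y = g.1 y := by
    intro g
    obtain ⟨p, hp, e⟩ := res_proj hinv le_rfl g.2
    rw [← hgen] at hp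
    obtain ⟨j, hj, e'⟩ := res_lift hinv hJ hp
    exact ⟨⟨j, hj⟩, fun y hy => (e' ⟨y, hy⟩).symm.trans (e ⟨y, hy⟩)⟩
  choose f hf' using hlift
  have hcard : Nat.card (gen ρ C) ≤ Nat.card (gen ρ J) * Nat.card K := by
    rw [← Nat.card_prod]
    refine Nat.card_le_card_of_injective (fun g => (f g, (⟨(f g).1⁻¹ * g.1, (hK _).2
      ⟨mul_mem (inv_mem (gen_mono hJ (f g).2)) g.2, fun y hy => by
        rw [Perm.mul_apply, Perm.inv_eq_iff_eq, hf' g y hy]⟩⟩ : K))) fun g g' e => ?_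
    simp only [Prod.mk.injEq, Subtype.mk.injEq] at e
    have h2 := e.2
    rw [e.1, mul_right_inj] at h2
    exact Subtype.ext h2
  have h1 := (two_pow_mul_card_le h hJ).trans hcard
  rw [mul_comm] at h1
  exact (Nat.le_of_mul_le_mul_left h1 Nat.card_pos).trans hcK

/-- An intransitive string of independent involutions on at most six points. -/
theorem card_add_two_le_of_not_tr (hs : Str ρ C) (h : Indep ρ C) (hinv : Inv (gen ρ C) Y)
    (hf : Faith (gen ρ C) Y) (hntr : ¬ Tr (gen ρ C) Y) (h3 : 3 ≤ Y.ncard) (h6 : Y.ncard ≤ 6) :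
    C.card + 2 ≤ Y.ncard := by
  by_cases hall : ∀ x ∈ Y, (orb (gen ρ C) x).ncard ≤ 2
  · have h1 := (two_pow_le_card h).trans (card_le_two_pow hinv hf hall)
    have := (Nat.pow_le_pow_iff_right (by norm_num)).1 h1
    rcases Nat.lt_or_ge Y.ncard 4 with hlt | hge
    · have h4 : Y.ncard = 3 := by omega
      omega
    · omega
  · push Not at hall
    obtain ⟨x, hx, ho⟩ := hall
    set O := orb (gen ρ C) x with hO
    have hsub : O ⊆ Y := hinv.orb_subset hx
    have hinvO : Inv (gen ρ C) O := inv_orb x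
    have hc : (Y \ O).ncard + O.ncard = Y.ncard := Set.ncard_sdiff_add_ncard_of_subset hsub
    have hpos : 1 ≤ (Y \ O).ncard := by
      rw [Nat.one_le_iff_ne_zero, ne_eq, Set.ncard_eq_zero (Set.toFinite _), Set.sdiff_eq_empty]
      intro hYO
      exact hntr (tr_of_orb hYO)
    obtain ⟨J, hJ, hgen, hind⟩ := Blocks.exists_min (res ρ O) C
    have hG : Good (res ρ O) J Set.univ :=
      { nonempty := ⟨⟨x, mem_orb_self x⟩, trivial⟩
        str := (res_str hinvO hs).mono hJ
        indep := hind
        inv := inv_univ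
        tr := by rw [hgen]; exact res_tr hinvO le_rfl (tr_orb x)
        faith := faith_univ }
    have h1 := hG.card_add_one_le
    rw [Set.ncard_univ, Nat.card_coe_set_eq] at h1
    have h2 := two_pow_sdiff_le h hJ hinvO hgen (Y' := Y \ O)
      (fun g hg y hy => ⟨hinv g hg y hy.1, fun hm => hy.2 ((hinvO.apply_mem_iff hg).1 hm)⟩)
      (by rwa [Set.union_sdiff_cancel hsub])
    have h4 := Finset.card_sdiff_add_card_eq_card hJ
    have h5 : (Y \ O).ncard ≤ 3 := by omega
    have h7 : (C \ J).card + 1 ≤ (Y \ O).ncard := by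
      by_contra hlt
      have hle : (Y \ O).ncard ≤ (C \ J).card := by omega
      have := (Nat.pow_le_pow_right (show 0 < 2 by norm_num) hle).trans h2
      interval_cases (Y \ O).ncard <;> simp [Nat.factorial] at this
    omega

end

end StringPerm

namespace StringPerm

open Equiv
open scoped Pointwise

variable {X : Type*} {ρ : ℤ → Perm X} {A B C E S T L J : Finset ℤ} {H K : Subgroup (Perm X)}
  {Y Y' : Set X} [Finite X]

theorem conj_mem_of_card_le (h : H ≤ K) (hc : Nat.card K ≤ 2 * Nat.card H) {d a : Perm X}
    (hd : d ∈ K) (ha : a ∈ H) : d * a * d⁻¹ ∈ H := by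
  by_cases hdH : d ∈ H
  · exact mul_mem (mul_mem hdH ha) (inv_mem hdH)
  have h3 := Subgroup.card_mul_index (H.subgroupOf K)
  rw [Nat.card_congr (Subgroup.subgroupOfEquivOfLe h).toEquiv] at h3
  have h4 := two_mul_card_le h hd hdH
  have hpos : 0 < Nat.card H := Nat.card_pos
  have h5 : (H.subgroupOf K).index = 2 := by
    have : Nat.card H * (H.subgroupOf K).index = Nat.card H * 2 := by omega
    exact Nat.eq_of_mul_eq_mul_left hpos this
  have hn := Subgroup.normal_of_index_eq_two h5
  exact hn.conj_mem ⟨a, h ha⟩ (Subgroup.mem_subgroupOf.2 ha) ⟨d, hd⟩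

theorem commute_of_isMulCommutative (h : IsMulCommutative H) {a b : Perm X} (ha : a ∈ H)
    (hb : b ∈ H) : Commute a b :=
  congrArg Subtype.val (h.is_comm.comm (⟨a, ha⟩ : H) ⟨b, hb⟩)

theorem six_le_card {u v : Perm X} (hu : u ∈ H) (hv : v ∈ H) (hu2 : u * u = 1)
    (hne : ¬ Commute u v) : 6 ≤ Nat.card H := by
  have hu1 : u ≠ 1 := by rintro rfl; exact hne (Commute.one_left v)
  have h2 : 2 ∣ Nat.card H := by
    have : orderOf (⟨u, hu⟩ : H) = 2 := orderOf_eq_prime (by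
      rw [pow_two]; exact Subtype.ext hu2) (fun e => hu1 (congrArg Subtype.val e))
    rw [← this]
    exact orderOf_dvd_natCard _
  have hpos : 0 < Nat.card H := Nat.card_pos
  by_contra hlt
  have h4 : Nat.card H = 2 ∨ Nat.card H = 2 ^ 2 := by omega
  rcases h4 with h4 | h4
  · have : IsCyclic H := isCyclic_of_prime_card (p := 2) h4
    exact hne (commute_of_isMulCommutative IsCyclic.isMulCommutative hu hv)
  · exact hne (commute_of_isMulCommutative (IsPGroup.isMulCommutative_of_card_eq_prime_sq h4) hu hv)

theorem pow_three_of_card_le {u v : Perm X} (hu : u ∈ H) (hv : v ∈ H) (hu2 : u * u = 1)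
    (hv2 : v * v = 1) (hne : ¬ Commute u v) (hc : Nat.card H ≤ 6) : (u * v) ^ 3 = 1 := by
  have h6 : Nat.card H = 6 := le_antisymm hc (six_le_card hu hv hu2 hne)
  have hdvd : orderOf (⟨u * v, mul_mem hu hv⟩ : H) ∣ 6 := h6 ▸ orderOf_dvd_natCard _
  rw [Subgroup.orderOf_mk] at hdvd
  have h2 : orderOf (u * v) ≠ 2 := by
    intro e
    have := pow_orderOf_eq_one (u * v)
    rw [e] at this
    refine hne ?_
    have hu' : u⁻¹ = u := inv_eq_of_mul_eq_one_left hu2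
    have hv' : v⁻¹ = v := inv_eq_of_mul_eq_one_left hv2
    have h3 : u * v = (u * v)⁻¹ := eq_inv_of_mul_eq_one_left (by rw [← pow_two, this])
    rw [mul_inv_rev, hu', hv'] at h3
    exact h3
  have h1 : orderOf (u * v) ≠ 1 := by
    intro e
    rw [orderOf_eq_one_iff] at e
    refine hne ?_
    rw [(mul_eq_one_iff_eq_inv.1 e)]
    exact (Commute.refl v).inv_left
  have h6' : orderOf (u * v) ≠ 6 := by
    intro e
    have : IsCyclic H := isCyclic_of_orderOf_eq_card (⟨u * v, mul_mem hu hv⟩ : H)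
      (by rw [Subgroup.orderOf_mk, e, h6])
    exact hne (commute_of_isMulCommutative IsCyclic.isMulCommutative hu hv)
  have h3 : orderOf (u * v) = 3 := by
    have := Nat.le_of_dvd (by norm_num) hdvd
    interval_cases orderOf (u * v) <;> omega
  rw [← h3, pow_orderOf_eq_one]

/-- The elements fixing all but two points of a set. -/
theorem card_le_two_of_fix (hf : Faith H Y) (hinv : Inv H Y) {F : Set X} (hF : F ⊆ Y)
    (hfix : ∀ g ∈ H, ∀ x ∈ F, g x = x) (hc : Y.ncard ≤ F.ncard + 2) : Nat.card H ≤ 2 := by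
  have h1 : Faith H (Y \ F) := fun g hg hgx => hf g hg fun x hx => by
    by_cases hxF : x ∈ F
    · exact hfix g hg x hxF
    · exact hgx x ⟨hx, hxF⟩
  have h2 : Inv H (Y \ F) := fun g hg x hx => ⟨hinv g hg x hx.1, fun hm => hx.2 (by
    have := hfix g hg _ hm
    rw [← g.injective this]
    exact hm)⟩
  have h3 := card_le_factorial h2 h1
  have h4 := Set.ncard_sdiff_add_ncard_of_subset hF
  have h5 : (Y \ F).ncard ≤ 2 := by omega
  exact h3.trans ((Nat.factorial_le h5).trans (by norm_num [Nat.factorial]))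

theorem Good.ne_of_commute (h : Good ρ C Y) {t : Perm X}
    (ht : ∀ c ∈ C, Commute (ρ c) t) {y : X} (hy : y ∈ Y) (hne : t y ≠ y) {x : X} (hx : x ∈ Y) :
    t x ≠ x := by
  intro e
  obtain ⟨g, hg, rfl⟩ := h.tr x hx y hy
  refine hne ?_
  rw [← Perm.mul_apply, ← (commute_gen ht hg).eq, Perm.mul_apply, e]

theorem fix_of_commute {t g : Perm X} (h : Commute g t) {x : X} (e : g x = x) :
    g (t x) = t x := by
  rw [← Perm.mul_apply, h.eq, Perm.mul_apply, e]

theorem orb_stab_subset {F : Set X} (hinv : Inv H Y) (hfix : ∀ g ∈ H, ∀ x ∈ F, g x = x)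
    {y : X} (hy : y ∈ Y) (hyF : y ∉ F) : orb H y ⊆ Y \ F := by
  rintro _ ⟨g, hg, rfl⟩
  refine ⟨hinv g hg y hy, fun hm => hyF ?_⟩
  rw [← g.injective (hfix g hg _ hm)]
  exact hm

/-- A transitive group on six points with nontrivial centralizer. -/
theorem Good.card_le_of_six (h : Good ρ C Y) (hY : Y.ncard = 6) {t : Perm X}
    (ht : ∀ c ∈ C, Commute (ρ c) t) (htY : ∀ y ∈ Y, t y ∈ Y) (hne : ∀ y ∈ Y, t y ≠ y) :
    Nat.card (gen ρ C) ≤ 48 := by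
  obtain ⟨x, hx⟩ := h.nonempty
  have hcm : ∀ g ∈ gen ρ C, Commute g t := fun g hg => commute_gen ht hg
  set G := gen ρ C with hG
  have h1 := card_le_orb_mul (H := G) x
  rw [h.tr.orb_eq h.inv hx, hY] at h1
  obtain ⟨F, hFY, hxF, hFc, hFfix, hFt⟩ : ∃ F ⊆ Y, x ∈ F ∧ (F.ncard = 2 ∨ F.ncard = 3) ∧
      (∀ g ∈ stab G x, ∀ y ∈ F, g y = y) ∧ ∀ y, y ∉ F → t y ∈ F → F.ncard = 3 ∧ t y = x := by
    have hfx : ∀ g ∈ stab G x, g (t x) = t x := fun g hg =>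
      fix_of_commute (hcm g (stab_le x hg)) (mem_stab.1 hg).2
    have hfx2 : ∀ g ∈ stab G x, g (t (t x)) = t (t x) := fun g hg =>
      fix_of_commute (hcm g (stab_le x hg)) (hfx g hg)
    by_cases htt : t (t x) = x
    · refine ⟨{x, t x}, ?_, by simp, Or.inl (Set.ncard_pair (hne x hx).symm), ?_, ?_⟩
      · rintro _ (rfl | rfl)
        exacts [hx, htY _ hx]
      · rintro g hg _ (rfl | rfl)
        exacts [(mem_stab.1 hg).2, hfx g hg]
      · rintro y hy (e | e)
        · exact absurd (t.injective (e.trans htt.symm)) (fun e => hy (by simp [e]))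
        · exact absurd (t.injective e) (fun e => hy (by simp [e]))
    · have hc : ({x, t x, t (t x)} : Set X).ncard = 3 :=
        Set.ncard_eq_three.2 ⟨x, t x, t (t x), (hne x hx).symm, fun e => htt e.symm,
          (hne _ (htY x hx)).symm, rfl⟩
      refine ⟨{x, t x, t (t x)}, ?_, by simp, Or.inr hc, ?_, ?_⟩
      · rintro _ (rfl | rfl | rfl)
        exacts [hx, htY _ hx, htY _ (htY _ hx)]
      · rintro g hg _ (rfl | rfl | rfl)
        exacts [(mem_stab.1 hg).2, hfx g hg, hfx2 g hg]
      · rintro y hy (e | e | e)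
        · exact ⟨hc, e⟩
        · exact absurd (t.injective e) (fun e => hy (by simp [e]))
        · exact absurd (t.injective e) (fun e => hy (by simp [e]))
  have hYF := Set.ncard_sdiff_add_ncard_of_subset hFY
  obtain ⟨y, hyY, hyF⟩ : ∃ y ∈ Y, y ∉ F := by
    by_contra hcon
    push Not at hcon
    have : Y.ncard ≤ F.ncard := Set.ncard_le_ncard hcon (Set.toFinite _)
    omega
  have hinvx : Inv (stab G x) Y := h.inv.mono (stab_le x)
  have h2 := card_le_orb_mul (H := stab G x) y
  have h3 : (orb (stab G x) y).ncard ≤ 4 := by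
    have := Set.ncard_le_ncard (orb_stab_subset hinvx hFfix hyY hyF) (Set.toFinite _)
    omega
  have h4 : Nat.card (stab (stab G x) y) ≤ 2 := by
    have hfy : ∀ g ∈ stab (stab G x) y, g y = y := fun g hg => (mem_stab.1 hg).2
    have hfty : ∀ g ∈ stab (stab G x) y, g (t y) = t y := fun g hg =>
      fix_of_commute (hcm g (stab_le x (stab_le y hg))) (hfy g hg)
    have hfF : ∀ g ∈ stab (stab G x) y, ∀ z ∈ F, g z = z := fun g hg => hFfix g (stab_le y hg)
    have hle : stab (stab G x) y ≤ G := (stab_le y).trans (stab_le x)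
    by_cases htyF : t y ∈ F
    · have h5 := (hFt y hyF htyF).1
      refine card_le_two_of_fix (F := insert y F) (h.faith.mono hle) (h.inv.mono hle)
        (Set.insert_subset hyY hFY) ?_ ?_
      · rintro g hg _ (rfl | hz)
        exacts [hfy g hg, hfF g hg _ hz]
      · rw [Set.ncard_insert_of_notMem hyF]
        omega
    · refine card_le_two_of_fix (F := insert (t y) (insert y F)) (h.faith.mono hle)
        (h.inv.mono hle) (Set.insert_subset (htY y hyY) (Set.insert_subset hyY hFY)) ?_ ?_
      · rintro g hg _ (rfl | rfl | hz)
        exacts [hfty g hg, hfy g hg, hfF g hg _ hz]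
      · rw [Set.ncard_insert_of_notMem, Set.ncard_insert_of_notMem hyF]
        · omega
        · rintro (e | e)
          exacts [hne y hyY e, htyF e]
  nlinarith [Nat.mul_le_mul h3 h4]

theorem Good.two_pow_le_ncard (h : Good ρ C Y) (hBC : B ⊆ C) (hc : Comm ρ C B) :
    2 ^ B.card ≤ Y.ncard := by
  obtain ⟨x, hx⟩ := h.nonempty
  exact (h.two_pow_le hc h.tr hBC hx).trans (Set.ncard_le_ncard
    ((h.inv.mono (gen_mono hBC)).orb_subset hx) (Set.toFinite _))

/-- Independent involutions of full rank on three, four or six points are centralized only by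
elements acting trivially. -/
theorem false_of_centralized (hk : Y.ncard = 3 ∨ Y.ncard = 4 ∨ Y.ncard = 6) {t : Perm X}
    (hs : Str ρ C) (hi : Indep ρ C) (hinvol : ∀ c ∈ C, ρ c * ρ c = 1) (hcard : C.card + 1 = Y.ncard)
    (hinv : Inv (gen ρ C) Y) (hf : Faith (gen ρ C) Y) (ht : ∀ c ∈ C, Commute (ρ c) t)
    (htY : ∀ y ∈ Y, t y ∈ Y) (hne : ∃ y ∈ Y, t y ≠ y) : False := by
  obtain ⟨y₀, hy₀, hne₀⟩ := hne
  have hG : Good ρ C Y :=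
    { nonempty := ⟨y₀, hy₀⟩
      str := hs
      indep := hi
      inv := hinv
      tr := by
        by_contra hn
        have := card_add_two_le_of_not_tr hs hi hinv hf hn (by omega) (by omega)
        omega
      faith := hf }
  have hne : ∀ y ∈ Y, t y ≠ y := fun y hy => hG.ne_of_commute ht hy₀ hne₀ hy
  have hpow := two_pow_le_card hi
  have comm_all : (∀ u ∈ C, ∀ v ∈ C, Commute (ρ u) (ρ v)) → False := by
    intro hc
    have := hG.two_pow_le_ncard (B := C) le_rfl hc
    rcases hk with hk | hk | hk <;> rw [hk] at this hcard
    · rw [show C.card = 2 by omega] at this; omega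
    · rw [show C.card = 3 by omega] at this; omega
    · rw [show C.card = 5 by omega] at this; omega
  have hpair : ∀ u ∈ C, ∀ v ∈ C, ¬ Commute (ρ u) (ρ v) → ({u, v} : Finset ℤ) ⊆ C ∧
      ({u, v} : Finset ℤ).card = 2 ∧ 6 ≤ Nat.card (gen ρ {u, v}) := by
    intro u hu v hv huv
    have huv' : u ≠ v := by rintro rfl; exact huv (Commute.refl _)
    exact ⟨by simp [Finset.insert_subset_iff, hu, hv], Finset.card_pair huv',
      six_le_card (mem_gen (by simp)) (mem_gen (by simp)) (hinvol u hu) huv⟩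
  rcases hk with hk | hk | hk
  · rw [show C.card = 2 by omega] at hpow
    have h1 : ∀ g ∈ gen ρ C, g y₀ = y₀ → g = 1 := by
      intro g hg e
      have h2 := fix_of_commute (commute_gen ht hg) e
      refine hf g hg fun z hz => ?_
      by_cases hz1 : z = y₀
      · rw [hz1, e]
      by_cases hz2 : z = t y₀
      · rw [hz2, h2]
      have hc3 : (Y \ {y₀, t y₀}).ncard = 1 := by
        have := Set.ncard_sdiff_add_ncard_of_subset (s := ({y₀, t y₀} : Set X)) (t := Y) (by
          rintro _ (rfl | rfl)
          exacts [hy₀, htY _ hy₀])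
        rw [Set.ncard_pair hne₀.symm] at this
        omega
      obtain ⟨w, hw⟩ := Set.ncard_eq_one.1 hc3
      have hzw : z ∈ Y \ {y₀, t y₀} := ⟨hz, by simp [hz1, hz2]⟩
      have hgw : g z ∈ Y \ {y₀, t y₀} := by
        refine ⟨hinv g hg z hz, ?_⟩
        rintro (e' | e')
        · exact hz1 (g.injective (e'.trans e.symm))
        · exact hz2 (g.injective (e'.trans h2.symm))
      rw [hw, Set.mem_singleton_iff] at hzw hgw
      rw [hgw, hzw]
    rw [card_eq_ncard_orb y₀ h1] at hpow
    have := Set.ncard_le_ncard (hinv.orb_subset hy₀) (Set.toFinite _)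
    omega
  · have h8 := card_le_eight hk hinv hf (fun g hg => commute_gen ht hg) htY hy₀ hne₀
    refine comm_all fun u hu v hv => ?_
    by_contra huv
    obtain ⟨hsub, hc2, h6⟩ := hpair u hu v hv huv
    have h1 := two_pow_mul_card_le hi hsub
    have h2 := Finset.card_sdiff_add_card_eq_card hsub
    rw [show (C \ {u, v}).card = 1 by omega] at h1
    omega
  · have h48 := hG.card_le_of_six hk ht htY hne
    refine comm_all fun u hu v hv => ?_
    by_contra huv
    obtain ⟨hsub, hc2, h6⟩ := hpair u hu v hv huv
    have h2 := Finset.card_sdiff_add_card_eq_card hsub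
    have hcen : Comm ρ C (C \ {u, v}) := by
      intro c hc d hd
      rw [Finset.mem_sdiff] at hd
      by_contra hcd
      obtain ⟨hsub', hc2', h6'⟩ := hpair c hc d hd.1 hcd
      have h3 := two_pow_mul_card_le hi hsub'
      have h4 := Finset.card_sdiff_add_card_eq_card hsub'
      rw [show (C \ {c, d}).card = 3 by omega] at h3
      have h5 := pow_three_of_card_le (H := gen ρ {c, d}) (mem_gen (by simp)) (mem_gen (by simp))
        (hinvol c hc) (hinvol d hd.1) hcd (by omega)
      have hJ : ({u, v} : Finset ℤ) ⊆ C.erase d := fun j hj =>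
        Finset.mem_erase.2 ⟨by rintro rfl; exact hd.2 hj, hsub hj⟩
      have h7 := two_pow_mul_card_le (hi.mono (Finset.erase_subset d C)) hJ
      have h8 := Finset.card_sdiff_add_card_eq_card hJ
      have h9 := Finset.card_erase_add_one hd.1
      rw [show (C.erase d \ {u, v}).card = 2 by omega] at h7
      have hcd' : c ≠ d := by rintro rfl; exact hcd (Commute.refl _)
      have hcm : ρ c ∈ gen ρ (C.erase d) := mem_gen (Finset.mem_erase.2 ⟨hcd', hc⟩)
      have h10 := conj_mem_of_card_le (gen_mono (ρ := ρ) (Finset.erase_subset d C)) (by omega)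
        (mem_gen hd.1) hcm
      refine hi d hd.1 ?_
      have hd' : (ρ d)⁻¹ = ρ d := inv_eq_of_mul_eq_one_left (hinvol d hd.1)
      have e : ρ d = ρ c * (ρ d * ρ c * (ρ d)⁻¹) * ρ c := by
        have h11 : ρ c * ρ d * (ρ c * ρ d) * (ρ c * ρ d) = 1 := by rw [← h5, pow_succ, pow_two]
        have h12 : ρ c * ρ d * ρ c * ρ d * ρ c = (ρ d)⁻¹ := by
          rw [eq_inv_iff_mul_eq_one]; simpa only [mul_assoc] using h11
        rw [hd'] at h12 ⊢
        rw [← mul_assoc, ← mul_assoc, h12]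
      rw [e]
      exact mul_mem (mul_mem hcm h10) hcm
    have := hG.two_pow_le_ncard Finset.sdiff_subset hcen
    rw [show (C \ {u, v}).card = 3 by omega] at this
    omega

/-- Full-rank configurations on six points do not decompose. -/
theorem false_of_decomposed (hY : Y.ncard = 6) (hs : Str ρ (A ∪ B)) (hi : Indep ρ (A ∪ B))
    (hc : Comm ρ A B) (hd : Disjoint A B) (hA : 2 ≤ A.card) (hB : 2 ≤ B.card)
    (hcard : A.card + B.card + 1 = 6)
    (hinv : Inv (gen ρ (A ∪ B)) Y) (hf : Faith (gen ρ (A ∪ B)) Y) : False := by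
  wlog hAB : A.card = 2 ∧ B.card = 3 generalizing A B
  · rw [Finset.union_comm] at hs hi hinv hf
    exact this hs hi hc.symm hd.symm hB hA (by omega) hinv hf (by omega)
  obtain ⟨hA2, hB3⟩ := hAB
  have hu := Finset.card_union_of_disjoint hd
  have hYne : Y.Nonempty := by
    rw [Set.nonempty_iff_ne_empty]
    rintro rfl
    simp at hY
  have hG : Good ρ (A ∪ B) Y :=
    { nonempty := hYne
      str := hs
      indep := hi
      inv := hinv
      tr := by
        by_contra hn
        have := card_add_two_le_of_not_tr hs hi hinv hf hn (by omega) (by omega)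
        omega
      faith := hf }
  obtain ⟨x, hx⟩ := hYne
  have six : ∀ D, (orb (gen ρ D) x).ncard ∣ 6 → 4 ≤ (orb (gen ρ D) x).ncard → D ⊆ A ∪ B →
      Tr (gen ρ D) Y := by
    intro D h1 h2 hD
    have h3 : (orb (gen ρ D) x).ncard = 6 := by
      have := Nat.le_of_dvd (by norm_num) h1
      interval_cases (orb (gen ρ D) x).ncard <;> omega
    refine tr_of_orb (x := x) ?_
    exact (Set.eq_of_subset_of_ncard_le ((hinv.mono (gen_mono hD)).orb_subset hx)
      (by omega) (Set.toFinite _)).ge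
  have htrB : Tr (gen ρ B) Y := by
    refine six B ?_ ?_ Finset.subset_union_right
    · have := hG.norb_mul hc Finset.subset_union_left Finset.subset_union_right hG.tr hx
      rw [hY] at this
      exact ⟨_, by rw [mul_comm]; exact this.symm⟩
    · have := (hG.orbit hc hG.tr Finset.subset_union_right hx).card_add_one_le
      omega
  have htrA : Tr (gen ρ A) Y := by
    refine six A ?_ ?_ Finset.subset_union_left
    · have := hG.norb_mul hc.symm Finset.subset_union_right Finset.subset_union_left
        (by rw [Finset.union_comm]; exact hG.tr) hx
      rw [hY] at this
      exact ⟨_, by rw [mul_comm]; exact this.symm⟩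
    · have := hG.two_pow_le hc.symm htrB Finset.subset_union_left hx
      rw [hA2] at this
      exact this
  have h1 := hG.two_pow_le hc htrA Finset.subset_union_right hx
  have h2 := Set.ncard_le_ncard ((hinv.mono (gen_mono (Finset.subset_union_right
    (s₁ := A)))).orb_subset hx) (Set.toFinite _)
  rw [hB3] at h1
  omega

variable {Z : Type*} [Finite Z] {σ : ℤ → Perm Z} {β : X → Z} {k m : ℕ}

theorem Blocks.card_lt (h : Blocks ρ σ β S k m) (hm : 3 ≤ m) (hm' : m < 12)
    (hk : k = 3 ∨ k = 4 ∨ k = 6) : S.card < k + m := by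
  rcases h.exists_run hm with ⟨x, y, hxy, hLS, hL, hG⟩ | h12
  · refine h.card_lt_of_run hm hxy hLS hL hG ?_ ?_
    · intro Y C t hCS hCk hY hinv hf hc htY hne
      exact false_of_centralized (by omega) (h.good.str.mono hCS) (h.good.indep.mono hCS)
        (fun c hc => h.invol c (hCS hc)) (by omega) hinv hf hc htY hne
    · intro Y A B hAB hc hd hA hB hk' hY hinv hf
      exact false_of_decomposed (by omega) (h.good.str.mono hAB) (h.good.indep.mono hAB) hc hd hA hB
        (by omega) hinv hf
  · omega

end StringPerm

namespace StringPerm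

open Equiv
open scoped Pointwise

variable {X : Type*} {ρ : ℤ → Perm X} {A B C E S T L J : Finset ℤ} {H K : Subgroup (Perm X)}
  {Y Y' W : Set X} [Finite X]

/-- An involution preserving a set of odd size fixes a point of it. -/
theorem exists_fix_of_odd {z : Perm X} (hz : z * z = 1) (hW : ∀ x ∈ W, z x ∈ W)
    (hodd : Odd W.ncard) : ∃ x ∈ W, z x = x := by
  classical
  have hf : Fintype W := Fintype.ofFinite W
  have hiff : ∀ x, z x ∈ W ↔ x ∈ W := fun x => ⟨fun h => by
    have := hW _ h
    rwa [← Perm.mul_apply, hz] at this, hW x⟩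
  have h2 : Fact (Nat.Prime 2) := ⟨Nat.prime_two⟩
  obtain ⟨a, ha⟩ := Perm.exists_fixed_point_of_prime (p := 2) (n := 1)
    (σ := z.subtypePerm (p := (· ∈ W)) hiff) (by
      rw [← Nat.card_eq_fintype_card]
      change ¬ 2 ∣ W.ncard
      exact hodd.not_two_dvd_nat) (by
      ext x
      rw [pow_one, pow_two]
      exact congrArg (fun f : Perm X => f x) hz)
  exact ⟨a, a.2, congrArg Subtype.val ha⟩

/-- An involution centralized by a group which is transitive on an invariant set of odd size
fixes that set pointwise. -/
theorem fix_of_odd {z : Perm X} (hz : z * z = 1) (hW : ∀ x ∈ W, z x ∈ W) (hodd : Odd W.ncard)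
    (ht : Tr K W) (hc : ∀ g ∈ K, Commute g z) {x : X} (hx : x ∈ W) : z x = x := by
  obtain ⟨y, hy, e⟩ := exists_fix_of_odd hz hW hodd
  obtain ⟨g, hg, rfl⟩ := ht y hy x hx
  rw [← Perm.mul_apply, ← (hc g hg).eq, Perm.mul_apply, e]

theorem ncard_image_mul {γ : Type*} (f : X → γ) {c : ℕ}
    (h : ∀ x ∈ Y, {y | y ∈ Y ∧ f y = f x}.ncard = c) : (f '' Y).ncard * c = Y.ncard := by
  classical
  have hf := Y.toFinite
  have h1 := Finset.card_eq_sum_card_image f hf.toFinset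
  rw [Set.ncard_eq_toFinset_card Y hf, h1, Finset.sum_const_nat (m := c)]
  · rw [Set.ncard_eq_toFinset_card _ (Set.toFinite _)]
    congr 2
    ext O; simp
  · intro O hO
    obtain ⟨x, hx, rfl⟩ := Finset.mem_image.1 hO
    rw [Set.Finite.mem_toFinset] at hx
    rw [← h x hx, ← Set.ncard_coe_finset]
    congr 1
    ext y
    simp

theorem Comm.norb_eq (h : Comm ρ A B) (htr : Tr (gen ρ (A ∪ B)) Y)
    (hinv : Inv (gen ρ A) Y) {x : X} (hx : x ∈ Y) :
    norb (gen ρ B) (orb (gen ρ A) x) = norb (gen ρ B) Y :=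
  (norb_mono_set (hinv.orb_subset hx)).antisymm (h.norb_le htr hx)

/-- The number of orbits of a factor divides the orbit size of the other one. -/
theorem Comm.norb_dvd (h : Comm ρ A B) (htr : Tr (gen ρ (A ∪ B)) Y)
    (hinv : Inv (gen ρ A) Y) {x : X} (hx : x ∈ Y) :
    norb (gen ρ B) Y ∣ (orb (gen ρ A) x).ncard := by
  rw [← h.norb_eq htr hinv hx]
  refine ⟨{y | y ∈ orb (gen ρ A) x ∧ orb (gen ρ B) y = orb (gen ρ B) x}.ncard, ?_⟩
  rw [norb]
  refine (ncard_image_mul _ fun y hy => ?_).symm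
  obtain ⟨a, ha, rfl⟩ := hy
  have e : {y | y ∈ orb (gen ρ A) x ∧ orb (gen ρ B) y = orb (gen ρ B) (a x)} =
      a '' {y | y ∈ orb (gen ρ A) x ∧ orb (gen ρ B) y = orb (gen ρ B) x} := by
    have hcm : ∀ b ∈ gen ρ B, Commute a b := fun b hb => h.commute ha hb
    ext y
    constructor
    · rintro ⟨h1, h2⟩
      refine ⟨a⁻¹ y, ⟨mem_orb_trans h1 (apply_mem_orb (inv_mem ha) y), ?_⟩, by simp⟩
      rw [orb_image_of_commute hcm] at h2
      rw [orb_image_of_commute fun b hb => (hcm b hb).inv_left, h2, ← Set.image_comp]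
      ext z; simp
    · rintro ⟨z, ⟨h1, h2⟩, rfl⟩
      exact ⟨mem_orb_trans h1 (apply_mem_orb ha z), by
        rw [orb_image_of_commute hcm, h2, orb_image_of_commute hcm]⟩
  rw [e, Set.ncard_image_of_injective _ a.injective]

theorem eq_of_dvd_primes {a p q : ℕ} (hp : p.Prime) (hq : q.Prime) (h : a ∣ p * q) (h1 : a ≠ 1)
    (h2 : a ≠ p * q) : a = p ∨ a = q := by
  obtain ⟨x, y, hx, hy, rfl⟩ := (Nat.dvd_mul).1 h
  rcases (Nat.dvd_prime hp).1 hx with rfl | rfl <;> rcases (Nat.dvd_prime hq).1 hy with rfl | rfl <;>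
    simp_all

theorem Good.not_tr_of_odd (h : Good ρ S Y) (hinv : ∀ i ∈ S, ρ i * ρ i = 1) (hodd : Odd Y.ncard)
    (hc : Comm ρ A B) (hB : B ⊆ S) (hBn : B.Nonempty) : ¬ Tr (gen ρ A) Y := by
  intro ht
  obtain ⟨j, hj⟩ := hBn
  refine h.indep.ne_one (hB hj) (h.faith _ (mem_gen (hB hj)) fun x hx => ?_)
  exact fix_of_odd (hinv j (hB hj)) (fun x hx => h.inv _ (mem_gen (hB hj)) x hx) hodd ht
    (fun g hg => hc.commute hg (mem_gen hj)) hx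

theorem Good.ncard_orb_ne_one (h : Good ρ S Y) (hc : Comm ρ A B)
    (htr : Tr (gen ρ (A ∪ B)) Y) (hB : B ⊆ S) (hBn : B.Nonempty) {x : X} (hx : x ∈ Y) :
    (orb (gen ρ B) x).ncard ≠ 1 := by
  intro e
  obtain ⟨j, hj⟩ := hBn
  obtain ⟨y, hy, hne⟩ := h.faith.exists_ne (mem_gen (hB hj)) (h.indep.ne_one (hB hj))
  have e' : (orb (gen ρ B) y).ncard = 1 := by rw [← e]; exact hc.ncard_orb_eq htr hx hy
  obtain ⟨z, hz⟩ := Set.ncard_eq_one.1 e'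
  have h1 : y ∈ orb (gen ρ B) y := mem_orb_self y
  have h2 : ρ j y ∈ orb (gen ρ B) y := apply_mem_orb (mem_gen hj) y
  rw [hz] at h1 h2
  exact hne (h2.trans h1.symm)

/-- On a set whose size is a product of two distinct odd primes, a transitive product of two
commuting parts has orbits of the two prime sizes. -/
theorem Good.prime_orbits {p q : ℕ} (h : Good ρ S Y) (hinv : ∀ i ∈ S, ρ i * ρ i = 1)
    (hp : p.Prime) (hq : q.Prime) (hpq : p ≠ q) (hodd : Odd (p * q)) (hY : Y.ncard = p * q)
    (hc : Comm ρ A B) (hA : A ⊆ S) (hB : B ⊆ S) (hAn : A.Nonempty) (hBn : B.Nonempty)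
    (htr : Tr (gen ρ (A ∪ B)) Y) :
    (∀ x ∈ Y, (orb (gen ρ A) x).ncard = p ∧ (orb (gen ρ B) x).ncard = q) ∨
      ∀ x ∈ Y, (orb (gen ρ A) x).ncard = q ∧ (orb (gen ρ B) x).ncard = p := by
  obtain ⟨x, hx⟩ := h.nonempty
  have htr' : Tr (gen ρ (B ∪ A)) Y := by rwa [Finset.union_comm]
  have key : ∀ {P Q : Finset ℤ}, Comm ρ P Q → P ⊆ S → Q ⊆ S → P.Nonempty → Q.Nonempty →
      Tr (gen ρ (P ∪ Q)) Y → ((orb (gen ρ Q) x).ncard = p ∨ (orb (gen ρ Q) x).ncard = q) := by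
    intro P Q hc hP hQ hPn hQn ht
    have h1 := h.norb_mul hc hP hQ ht hx
    refine eq_of_dvd_primes hp hq (hY ▸ ⟨_, by rw [mul_comm, h1]⟩)
      (h.ncard_orb_ne_one hc ht hQ hQn hx) fun e => ?_
    refine h.not_tr_of_odd hinv (hY ▸ hodd) hc.symm hP hPn (tr_of_orb (x := x) ?_)
    rw [Set.eq_of_subset_of_ncard_le ((h.inv.mono (gen_mono hQ)).orb_subset hx) (by rw [hY, e])]
  have hAs := key hc.symm hB hA hBn hAn htr'
  have hBs := key hc hA hB hAn hBn htr
  have h1 := h.norb_mul hc hA hB htr hx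
  have h2 := hc.norb_dvd htr (h.inv.mono (gen_mono hA)) hx
  rw [hY] at h1
  have hne : (orb (gen ρ A) x).ncard ≠ (orb (gen ρ B) x).ncard := by
    intro e
    rcases hBs with e' | e' <;> rw [e, e'] at h2 <;> rw [e'] at h1
    · have : norb (gen ρ B) Y = q := by
        rw [mul_comm] at h1; exact Nat.eq_of_mul_eq_mul_left hp.pos h1
      rw [this] at h2
      exact hpq ((Nat.prime_dvd_prime_iff_eq hq hp).1 h2).symm
    · have : norb (gen ρ B) Y = p := Nat.eq_of_mul_eq_mul_right hq.pos h1
      rw [this] at h2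
      exact hpq ((Nat.prime_dvd_prime_iff_eq hp hq).1 h2)
  have hA' : ∀ y ∈ Y, (orb (gen ρ A) y).ncard = (orb (gen ρ A) x).ncard := fun y hy =>
    hc.symm.ncard_orb_eq htr' hx hy
  have hB' : ∀ y ∈ Y, (orb (gen ρ B) y).ncard = (orb (gen ρ B) x).ncard := fun y hy =>
    hc.ncard_orb_eq htr hx hy
  rcases hAs with ha | ha <;> rcases hBs with hb | hb
  · exact absurd (ha.trans hb.symm) hne
  · exact Or.inl fun y hy => ⟨(hA' y hy).trans ha, (hB' y hy).trans hb⟩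
  · exact Or.inr fun y hy => ⟨(hA' y hy).trans ha, (hB' y hy).trans hb⟩
  · exact absurd (ha.trans hb.symm) hne

/-- Orbits filling up the number of orbits allow only one nontrivial orbit. -/
theorem fix_of_norb (hinv : Inv H Y) {w : X} (hWY : W ⊆ Y) (hw : w ∈ W) (hW : W ⊆ orb H w)
    (hn : Y.ncard + 1 ≤ norb H Y + W.ncard) {z : X} (hz : z ∈ Y) (hzW : z ∉ W) {g : Perm X}
    (hg : g ∈ H) : g z = z := by
  classical
  set U : Set X := insert w (Y \ W) with hU
  have himg : orb H '' Y = orb H '' U := by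
    refine Set.Subset.antisymm ?_ (Set.image_mono (Set.insert_subset (hWY hw) Set.sdiff_subset))
    rintro _ ⟨y, hy, rfl⟩
    by_cases hyW : y ∈ W
    · exact ⟨w, Set.mem_insert _ _, (orb_eq_of_mem (hW hyW)).symm⟩
    · exact ⟨y, Set.mem_insert_of_mem _ ⟨hy, hyW⟩, rfl⟩
  have hcard : U.ncard + W.ncard = Y.ncard + 1 := by
    rw [hU, Set.ncard_insert_of_notMem (fun h => h.2 hw)]
    have := Set.ncard_sdiff_add_ncard_of_subset hWY
    omega
  have hinj : Set.InjOn (orb H) U := by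
    refine Set.injOn_of_ncard_image_eq (le_antisymm (Set.ncard_image_le) ?_)
    rw [← himg]
    change _ ≤ norb H Y
    omega
  have hzU : z ∈ U := Set.mem_insert_of_mem _ ⟨hz, hzW⟩
  by_cases hgW : g z ∈ W
  · have e : orb H z = orb H w := by
      rw [← orb_eq_of_mem (hW hgW)]
      exact (orb_eq_of_mem (apply_mem_orb hg z)).symm
    have := hinj hzU (Set.mem_insert _ _) e
    exact absurd (this ▸ hw) hzW
  · exact hinj (Set.mem_insert_of_mem _ ⟨hinv g hg z hz, hgW⟩) hzU
      (orb_eq_of_mem (apply_mem_orb hg z))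

/-- In a string of essential generators which is as long as the set allows, final segments have
a single nontrivial orbit. -/
theorem exists_tail_orbit {x y : ℤ} (hstr : Str ρ (Finset.Icc x y))
    (hinv : Inv (gen ρ (Finset.Icc x y)) Y) (htr : Tr (gen ρ (Finset.Icc x y)) Y)
    (hY : (Y.ncard : ℤ) = y - x + 2)
    (hess : ∀ e ∈ Finset.Icc x (y - 1), ¬ Tr (gen ρ ((Finset.Icc x y).erase e)) Y)
    (hy : ∃ p ∈ Y, ρ y p ≠ p) {j : ℤ} (hj : x ≤ j) (hjy : j ≤ y) :
    ∃ W ⊆ Y, (W.ncard : ℤ) = y - j + 2 ∧ Tr (gen ρ (Finset.Icc j y)) W ∧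
      Inv (gen ρ (Finset.Icc j y)) W ∧
      ∀ z ∈ Y, z ∉ W → ∀ g ∈ gen ρ (Finset.Icc j y), g z = z := by
  have hxy : x ≤ y := hj.trans hjy
  have fin : ∀ (j : ℤ) (w : X) (W : Set X), x ≤ j → j ≤ y → W ⊆ Y → w ∈ W →
      W ⊆ orb (gen ρ (Finset.Icc j y)) w → (W.ncard : ℤ) = y - j + 2 →
      Tr (gen ρ (Finset.Icc j y)) W ∧ Inv (gen ρ (Finset.Icc j y)) W ∧
      ∀ z ∈ Y, z ∉ W → ∀ g ∈ gen ρ (Finset.Icc j y), g z = z := by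
    intro j w W hj hjy hWY hw hWo hcard
    have hsub : Finset.Icc j y ⊆ Finset.Icc x y := Finset.Icc_subset_Icc hj le_rfl
    have h1 := card_add_one_le_norb (E := Finset.Icc x (j - 1)) (S := Finset.Icc x y)
      (Finset.Icc_subset_Icc le_rfl (by omega)) ⟨w, hWY hw⟩ hinv
      (fun e he => hess e (Finset.Icc_subset_Icc le_rfl (by omega) he)) htr
    have h2 : Finset.Icc x y \ Finset.Icc x (j - 1) = Finset.Icc j y := by
      ext i; simp only [Finset.mem_sdiff, Finset.mem_Icc]; omega
    rw [h2, Int.card_Icc] at h1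
    have hYi := hinv.mono (gen_mono hsub)
    have hfix : ∀ z ∈ Y, z ∉ W → ∀ g ∈ gen ρ (Finset.Icc j y), g z = z := fun z hz hzW g hg =>
      fix_of_norb hYi hWY hw hWo (by omega) hz hzW hg
    refine ⟨tr_of_orb hWo, fun g hg z hz => ?_, hfix⟩
    by_contra hgz
    have := hfix _ (hYi g hg z (hWY hz)) hgz _ (inv_mem hg)
    have e : z = g z := by simpa using this
    exact hgz (by rw [← e]; exact hz)
  induction j, hjy using Int.leInductionDown with
  | base =>
    obtain ⟨p, hp, hne⟩ := hy
    have hyy : y ∈ Finset.Icc y y := by simp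
    have hyx : y ∈ Finset.Icc x y := by simp [hxy]
    refine ⟨{p, ρ y p}, ?_, ?_, fin y p _ hxy le_rfl ?_ (by simp) ?_ ?_⟩
    · rintro _ (rfl | rfl)
      exacts [hp, hinv _ (mem_gen hyx) _ hp]
    · rw [Set.ncard_pair hne.symm]; simp
    · rintro _ (rfl | rfl)
      exacts [hp, hinv _ (mem_gen hyx) _ hp]
    · rintro _ (rfl | rfl)
      exacts [mem_orb_self _, apply_mem_orb (mem_gen hyy) _]
    · rw [Set.ncard_pair hne.symm]; simp
  | pred j hjy ih =>
    obtain ⟨W, hWY, hcard, hWt, hWi, hfix⟩ := ih (by omega)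
    have hW2 : 1 < W.ncard := by omega
    have hmoved : ∀ z ∈ W, ¬ ∀ g ∈ gen ρ (Finset.Icc j y), g z = z := by
      intro z hz hall
      obtain ⟨z', hz', hne⟩ := Set.exists_ne_of_one_lt_ncard hW2 z
      obtain ⟨g, hg, e⟩ := hWt z hz z' hz'
      exact hne (e ▸ hall g hg)
    have hlow : ∀ i ∈ Finset.Icc x y, i < j - 1 → ∀ z ∈ W, ρ i z ∈ W := by
      intro i hi hij z hz
      by_contra hne
      refine hmoved z hz fun g hg => ?_
      have hcm : Commute g (ρ i) := commute_gen (fun l hl => by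
        rw [Finset.mem_Icc] at hl
        exact (hstr i hi l (Finset.mem_Icc.2 ⟨by omega, hl.2⟩) (by omega)).symm) hg
      have := hfix _ (hinv _ (mem_gen hi) z (hWY hz)) hne g hg
      rw [← Perm.mul_apply, hcm.eq, Perm.mul_apply] at this
      exact (ρ i).injective this
    have hex : ∃ z ∈ W, ρ (j - 1) z ∉ W := by
      by_contra hno
      push Not at hno
      have hWinv : Inv (gen ρ (Finset.Icc x y)) W := inv_gen_of fun i hi z hz => by
        rcases lt_trichotomy i (j - 1) with hlt | rfl | hgt
        · exact hlow i hi hlt z hz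
        · exact hno z hz
        · exact hWi _ (mem_gen (by rw [Finset.mem_Icc] at hi ⊢; omega)) z hz
      obtain ⟨w, hw⟩ := Set.nonempty_of_ncard_ne_zero (s := W) (by omega)
      have : Y ⊆ W := fun v hv => by
        obtain ⟨g, hg, rfl⟩ := htr w (hWY hw) v hv
        exact hWinv g hg w hw
      have := Set.ncard_le_ncard this
      omega
    obtain ⟨z, hz, hzn⟩ := hex
    have hjm : j - 1 ∈ Finset.Icc (j - 1) y := by rw [Finset.mem_Icc]; omega
    have hjm' : j - 1 ∈ Finset.Icc x y := by rw [Finset.mem_Icc]; omega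
    have hcard' : ((insert (ρ (j - 1) z) W).ncard : ℤ) = y - (j - 1) + 2 := by
      rw [Set.ncard_insert_of_notMem hzn]; push_cast; omega
    have hsub' : insert (ρ (j - 1) z) W ⊆ Y :=
      Set.insert_subset (hinv _ (mem_gen hjm') z (hWY hz)) hWY
    refine ⟨_, hsub', hcard', fin (j - 1) z _ hj (by omega) hsub' (Set.mem_insert_of_mem _ hz)
      (Set.insert_subset (apply_mem_orb (mem_gen hjm) z) fun v hv => ?_) hcard'⟩
    obtain ⟨g, hg, rfl⟩ := hWt z hz v hv
    exact apply_mem_orb (gen_mono (Finset.Icc_subset_Icc (by omega) le_rfl) hg) z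

end StringPerm

namespace StringPerm

open Equiv
open scoped Pointwise

section

variable {X : Type*} {ρ : ℤ → Perm X} {A B C E S T L J : Finset ℤ} {H K : Subgroup (Perm X)}
  {Y Y' W : Set X}

/-- An element acting on one class as `w ^ c` and on all others as `w ^ d`, multiplied over its
conjugates by a group centralizing `w` and permuting the classes transitively, is a power of
`w`. -/
theorem zpow_mem_of_classes {Z : Type*} {γ : X → Z} (hfin : (Set.range γ).Finite) {w v : Perm X}
    (hHK : H ≤ K) (hv : v ∈ K) (hw : ∀ g ∈ H, Commute g w) (hγw : ∀ x, γ (w x) = γ x)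
    (hγ : ∀ g ∈ H, ∀ x y, γ x = γ y → γ (g x) = γ (g y)) (ht : ∀ x y, ∃ g ∈ H, γ (g x) = γ y)
    (a : X) (c d : ℤ) (hc : ∀ x, γ x = γ a → v x = (w ^ c) x)
    (hd : ∀ x, γ x ≠ γ a → v x = (w ^ d) x) :
    w ^ ((Set.range γ).ncard * d + (c - d)) ∈ K := by
  classical
  have hγz : ∀ (e : ℤ) (x : X), γ ((w ^ e) x) = γ x := by
    have hinv : ∀ x, γ (w⁻¹ x) = γ x := fun x => by
      have := hγw (w⁻¹ x); simpa using this.symm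
    intro e
    induction e using Int.induction_on with
    | zero => simp
    | succ n ih => intro x; rw [zpow_add, zpow_one, Perm.mul_apply, ih, hγw]
    | pred n ih => intro x; rw [zpow_sub_one, Perm.mul_apply, ih, hinv]
  have key : ∀ T : Finset Z, ↑T ⊆ Set.range γ → ∃ g ∈ K, ∀ x,
      g x = (w ^ (T.card * d + if γ x ∈ T then c - d else 0)) x := by
    intro T
    induction T using Finset.induction_on with
    | empty => exact fun _ => ⟨1, one_mem _, fun x => by simp⟩
    | insert z T hz ih =>
      intro hsub
      obtain ⟨g, hg, e⟩ := ih fun y hy => hsub (by simp [Finset.mem_coe.1 hy])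
      obtain ⟨y, rfl⟩ := hsub (by simp : z ∈ (↑(insert z T) : Set Z))
      obtain ⟨h, hh, eh⟩ := ht a y
      refine ⟨g * (h * v * h⁻¹), mul_mem hg (mul_mem (mul_mem (hHK hh) hv) (inv_mem (hHK hh))),
        fun x => ?_⟩
      have hiff : γ (h⁻¹ x) = γ a ↔ γ x = γ y := by
        constructor
        · intro e1
          have := hγ h hh _ _ e1
          rw [← Perm.mul_apply, mul_inv_cancel] at this
          exact this.trans eh
        · intro e1
          have := hγ _ (inv_mem hh) _ _ (e1.trans eh.symm)
          rwa [← Perm.mul_apply, inv_mul_cancel] at this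
      have hcm : ∀ f : ℤ, h ((w ^ f) (h⁻¹ x)) = (w ^ f) x := fun f => by
        rw [← Perm.mul_apply h, ((hw h hh).zpow_right f).eq, Perm.mul_apply, ← Perm.mul_apply h,
          mul_inv_cancel, Perm.one_apply]
      rw [Perm.mul_apply, Perm.mul_apply, Perm.mul_apply, Finset.card_insert_of_notMem hz]
      by_cases hxy : γ x = γ y
      · rw [hc _ (hiff.2 hxy), hcm, e, hγz, ← Perm.mul_apply, ← zpow_add]
        rw [if_neg (by rwa [hxy]), if_pos (by simp [hxy])]
        congr 2; push_cast; ring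
      · rw [hd _ (mt hiff.1 hxy), hcm, e, hγz, ← Perm.mul_apply, ← zpow_add]
        have : (γ x ∈ insert (γ y) T) ↔ γ x ∈ T := by simp [hxy]
        simp only [this]
        congr 2; push_cast; ring
  obtain ⟨g, hg, e⟩ := key hfin.toFinset (by simp)
  have : g = w ^ ((Set.range γ).ncard * d + (c - d)) := by
    ext x
    rw [e, if_pos (by simp), Set.ncard_eq_toFinset_card _ hfin]
  exact this ▸ hg

theorem gen_mirror (t : ℤ) : gen (fun j => ρ (t - j)) T = gen ρ (T.image fun j => t - j) := by
  rw [gen, gen, Finset.coe_image, ← Set.image_comp]; rfl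

theorem image_mirror_Icc (t x y : ℤ) :
    (Finset.Icc x y).image (fun j => t - j) = Finset.Icc (t - y) (t - x) := by
  ext j
  simp only [Finset.mem_image, Finset.mem_Icc]
  exact ⟨by rintro ⟨i, hi, rfl⟩; omega, fun hj => ⟨t - j, by omega, by omega⟩⟩

theorem image_mirror_erase (t i : ℤ) :
    (T.erase i).image (fun j => t - j) = (T.image fun j => t - j).erase (t - i) :=
  Finset.image_erase (fun a b h => by simpa using h) _ _

theorem gen_mirror_Icc (t x y : ℤ) :
    gen (fun j => ρ (t - j)) (Finset.Icc x y) = gen ρ (Finset.Icc (t - y) (t - x)) := by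
  rw [gen_mirror, image_mirror_Icc]

theorem gen_mirror_erase (t x y i : ℤ) : gen (fun j => ρ (t - j)) ((Finset.Icc x y).erase i) =
    gen ρ ((Finset.Icc (t - y) (t - x)).erase (t - i)) := by
  rw [gen_mirror, image_mirror_erase, image_mirror_Icc]

theorem Good.mirror {t : ℤ} (h : Good ρ (Finset.Icc 0 t) Y) :
    Good (fun j => ρ (t - j)) (Finset.Icc 0 t) Y := by
  have e : gen (fun j => ρ (t - j)) (Finset.Icc 0 t) = gen ρ (Finset.Icc 0 t) := by
    rw [gen_mirror_Icc]; simp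
  have hm : ∀ i ∈ Finset.Icc 0 t, t - i ∈ Finset.Icc 0 t := fun i hi => by
    rw [Finset.mem_Icc] at hi ⊢; omega
  refine ⟨h.nonempty, fun i hi j hj hij => ?_, fun i hi hmem => ?_, by rw [e]; exact h.inv,
    by rw [e]; exact h.tr, by rw [e]; exact h.faith⟩
  · exact (h.str _ (hm j hj) _ (hm i hi) (by omega)).symm
  · rw [gen_mirror_erase] at hmem
    exact h.indep _ (hm i hi) (by simpa using hmem)

/-- On a set of odd prime size, two commuting parts cannot be jointly transitive. -/
theorem Good.not_tr_of_prime [Finite X] {p : ℕ} (h : Good ρ S Y)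
    (hinv : ∀ i ∈ S, ρ i * ρ i = 1) (hp : p.Prime) (hodd : Odd p) (hY : Y.ncard = p)
    (hc : Comm ρ A B) (hA : A ⊆ S) (hB : B ⊆ S) (hAn : A.Nonempty) (hBn : B.Nonempty) :
    ¬ Tr (gen ρ (A ∪ B)) Y := by
  intro htr
  obtain ⟨x, hx⟩ := h.nonempty
  have h1 := h.norb_mul hc hA hB htr hx
  rcases (Nat.dvd_prime hp).1 (hY ▸ ⟨_, by rw [mul_comm, h1]⟩ : (orb (gen ρ B) x).ncard ∣ p)
    with e | e
  · exact h.ncard_orb_ne_one hc htr hB hBn hx e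
  · refine h.not_tr_of_odd hinv (hY ▸ hodd) hc.symm hA hAn (tr_of_orb (x := x) ?_)
    rw [Set.eq_of_subset_of_ncard_le ((h.inv.mono (gen_mono hB)).orb_subset hx) (by rw [hY, e])]

/-- A set of essential generators is independent. -/
theorem indep_of_essential (htr : Tr (gen ρ S) Y) (hess : ∀ i ∈ S, ¬ Tr (gen ρ (S.erase i)) Y) :
    Indep ρ S := fun i hi hm => hess i hi <| htr.mono <| gen_le.2 fun j hj => by
  by_cases hji : j = i
  · rwa [hji]
  · exact mem_gen (Finset.mem_erase.2 ⟨hji, hj⟩)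

end

namespace Blocks

variable {X Z : Type*} {ρ : ℤ → Perm X} {σ : ℤ → Perm Z} {β : X → Z}
  {A B C E S T L J : Finset ℤ} {k m : ℕ}

theorem mirror {t : ℤ} (h : Blocks ρ σ β (Finset.Icc 0 t) k m) :
    Blocks (fun j => ρ (t - j)) (fun j => σ (t - j)) β (Finset.Icc 0 t) k m := by
  have hm : ∀ i ∈ Finset.Icc 0 t, t - i ∈ Finset.Icc 0 t := fun i hi => by
    rw [Finset.mem_Icc] at hi ⊢; omega
  refine ⟨h.good.mirror, fun i hi => h.invol _ (hm i hi), fun i hi => h.equiv _ (hm i hi), h.surj,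
    h.fib, h.card, ?_⟩
  have e : gen (fun j => σ (t - j)) (Finset.Icc 0 t) = gen σ (Finset.Icc 0 t) := by
    rw [gen_mirror_Icc]; simp
  rw [e]
  exact h.prim

variable [Finite X] [Finite Z]

theorem norb_le_fibre (h : Blocks ρ σ β S k m) (hJ : J ⊆ S) (ht : Tr (gen σ J) Set.univ) (x : X) :
    norb (gen ρ J) Set.univ ≤ norb (gen ρ J) {y | β y = β x} := by
  refine Set.ncard_le_ncard ?_ (Set.toFinite _)
  rintro _ ⟨y, -, rfl⟩
  obtain ⟨g, hg, e⟩ := h.block_trans hJ ht y x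
  exact ⟨g y, e, orb_eq_of_mem (apply_mem_orb hg y)⟩

/-- Essential generators outside `E` split into those needed to connect the blocks and the rest. -/
theorem exists_essential (h : Blocks ρ σ β S k m) (hE : E ⊆ S)
    (hess : ∀ i ∈ S \ E, ¬ Tr (gen ρ (S.erase i)) Set.univ) :
    ∃ L ⊆ S \ E, Tr (gen σ (E ∪ L)) Set.univ ∧
      (∀ l ∈ L, ¬ Tr (gen σ ((E ∪ L).erase l)) Set.univ) ∧
      L.card + 1 ≤ norb (gen σ E) Set.univ ∧
      ((S \ E) \ L).card + 1 ≤ norb (gen ρ (E ∪ L)) Set.univ := by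
  classical
  have hZ := h.nonempty_block
  have hne : ((S \ E).powerset.filter fun L => Tr (gen σ (E ∪ L)) Set.univ).Nonempty :=
    ⟨S \ E, Finset.mem_filter.2 ⟨Finset.mem_powerset_self _, by
      rw [Finset.union_sdiff_of_subset hE]; exact h.tr_block le_rfl h.good.tr⟩⟩
  obtain ⟨L, hL, hmin⟩ := Finset.exists_min_image _ Finset.card hne
  rw [Finset.mem_filter, Finset.mem_powerset] at hL
  obtain ⟨hLS, hLt⟩ := hL
  have hdisj : ∀ l ∈ L, l ∉ E := fun l hl => (Finset.mem_sdiff.1 (hLS hl)).2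
  have hLe : ∀ l ∈ L, ¬ Tr (gen σ ((E ∪ L).erase l)) Set.univ := by
    intro l hl ht
    have e : (E ∪ L).erase l = E ∪ L.erase l := by
      rw [Finset.erase_union_distrib, Finset.erase_eq_of_notMem (hdisj l hl)]
    rw [e] at ht
    have := hmin (L.erase l) (Finset.mem_filter.2
      ⟨Finset.mem_powerset.2 ((Finset.erase_subset l L).trans hLS), ht⟩)
    have := Finset.card_erase_lt_of_mem hl
    omega
  refine ⟨L, hLS, hLt, hLe, ?_, ?_⟩
  · have := card_add_one_le_norb (E := L) (S := E ∪ L) Finset.subset_union_right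
      Set.univ_nonempty inv_univ hLe hLt
    rwa [Finset.union_sdiff_cancel_right (Finset.disjoint_left.2 fun a ha hl => hdisj a hl ha)]
      at this
  · have := card_add_one_le_norb (E := (S \ E) \ L) (S := S)
      (Finset.sdiff_subset.trans Finset.sdiff_subset)
      h.good.nonempty h.good.inv (fun e he => hess e (Finset.sdiff_subset he)) h.good.tr
    have e : S \ ((S \ E) \ L) = E ∪ L := by
      ext i
      have h1 := @hE i
      have h2 := @hLS i
      simp only [Finset.mem_sdiff, Finset.mem_union] at h2 ⊢
      tauto
    rwa [e] at this

/-- An element preserving all blocks but moving a point makes two points of a block collide. -/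
theorem norb_lt_of_move (h : Blocks ρ σ β S k m) (hJ : J ⊆ S) (ht : Tr (gen σ J) Set.univ)
    {g : Perm X} (hg : g ∈ gen ρ J) {x : X} (hβ : β (g x) = β x) (hx : g x ≠ x) :
    norb (gen ρ J) Set.univ + 1 ≤ k := by
  have h1 := norb_lt (Y := {y | β y = β x}) (bot_le : ⊥ ≤ gen ρ J) (x := x) rfl hβ
    (apply_mem_orb hg x) (by rw [orb_bot]; exact hx)
  have h2 := norb_le_ncard (H := (⊥ : Subgroup (Perm X))) (Y := {y | β y = β x})
  have h3 := h.norb_le_fibre hJ ht x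
  rw [h.fib] at h2
  omega

theorem card_lt_of_essential (h : Blocks ρ σ β S k m) {a b : ℤ} (ha : a ∈ S) (hb : b ∈ S)
    (hab : a ≠ b)
    (hess : ∀ i ∈ S, i ≠ a → i ≠ b → ¬ Tr (gen ρ (S.erase i)) Set.univ) :
    S.card < k + m := by
  classical
  have hE : {a, b} ⊆ S := by
    intro i hi; rw [Finset.mem_insert, Finset.mem_singleton] at hi
    rcases hi with rfl | rfl <;> assumption
  obtain ⟨L, hL, hLt, -, h1, h2⟩ := h.exists_essential hE fun i hi => by
    simp only [Finset.mem_sdiff, Finset.mem_insert, Finset.mem_singleton, not_or] at hi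
    exact hess i hi.1 hi.2.1 hi.2.2
  have h3 := Finset.card_sdiff_add_card_eq_card hL
  have h4 := Finset.card_sdiff_add_card_eq_card hE
  rw [Finset.card_pair hab] at h4
  have hJ : {a, b} ∪ L ⊆ S := Finset.union_subset hE (hL.trans Finset.sdiff_subset)
  have h5 := h.norb_le hJ hLt
  have h6 := norb_le_ncard (H := gen σ {a, b}) (Y := Set.univ)
  rw [h.ncard_univ] at h6
  by_cases ha1 : σ a = 1
  · obtain ⟨x, hx⟩ : ∃ x, ρ a x ≠ x := by
      by_contra hno
      push Not at hno
      exact h.good.indep.ne_one ha (Equiv.ext hno)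
    have := h.norb_lt_of_move hJ hLt (g := ρ a) (mem_gen (by simp)) (x := x)
      (by rw [h.equiv a ha, ha1]; rfl) hx
    omega
  · obtain ⟨z, hz⟩ : ∃ z, σ a z ≠ z := by
      by_contra hno
      push Not at hno
      exact ha1 (Equiv.ext hno)
    have := norb_lt_ncard (H := gen σ {a, b}) (Y := Set.univ) (g := σ a) (mem_gen (by simp))
      inv_univ trivial hz
    rw [h.ncard_univ] at this
    omega

/-- The bound for two distinct odd primes. -/
theorem card_lt_of_primes {t : ℤ} (h : Blocks ρ σ β (Finset.Icc 0 t) k m) (ht : 0 < t)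
    (hk : k.Prime) (hm : m.Prime) (hkm : k ≠ m) (hodd : Odd (k * m))
    (hX : (Set.univ : Set X).ncard = k * m) : (Finset.Icc 0 t).card < k + m := by
  by_cases hess : ∀ i ∈ Finset.Icc 0 t, i ≠ 0 → i ≠ t →
      ¬ Tr (gen ρ ((Finset.Icc 0 t).erase i)) Set.univ
  · exact h.card_lt_of_essential (by simp [ht.le]) (by simp [ht.le]) ht.ne hess
  push Not at hess
  obtain ⟨i, hi, hi0, hit, htr⟩ := hess
  rw [erase_eq_low_union_high] at htr
  have hc := h.good.str.comm_low_high i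
  rw [Finset.mem_Icc] at hi
  have hp := h.good.prime_orbits h.invol hk hm hkm hodd hX hc (low_subset i) (high_subset i)
    ⟨0, mem_low.2 ⟨by simp [ht.le], by omega⟩⟩ ⟨t, mem_high.2 ⟨by simp [ht.le], by omega⟩⟩ htr
  obtain ⟨x, hx⟩ := h.good.nonempty
  have h1 := (h.good.orbit hc htr (high_subset i) hx).card_add_one_le
  have h2 := (h.good.orbit hc.symm (by rwa [Finset.union_comm]) (low_subset i) hx).card_add_one_le
  have h3 := card_split (S := Finset.Icc 0 t) (i := i) (by rwa [Finset.mem_Icc])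
  rcases hp with hp | hp <;> have := hp x hx <;> omega

end Blocks

end StringPerm

namespace StringPerm

open Equiv
open scoped Pointwise

variable {X Z : Type*} {ρ : ℤ → Perm X} {σ : ℤ → Perm Z} {β : X → Z}
  {A B C E S T L J : Finset ℤ} {k m : ℕ}

theorem apply_apply_of_mul_self {v : Perm X} (hv : v * v = 1) (x : X) : v (v x) = x := by
  rw [← Perm.mul_apply, hv, Perm.one_apply]

/-- Two involutions preserving the classes of `β` and moving at most one common pair of points in
each of them agree on every class in which both move a point. -/
theorem apply_eq_of_pair {v w : Perm X} (hv : v * v = 1) (hw : w * w = 1)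
    (hβv : ∀ x, β (v x) = β x)
    (hpair : ∀ g g' : Perm X, (g = v ∨ g = w) → (g' = v ∨ g' = w) → ∀ x x', β x = β x' →
      g x ≠ x → g' x' ≠ x' → x' = x ∨ x' = g x) {u x₀ x₁ : X} (h₀ : β x₀ = β u) (hx₀ : w x₀ ≠ x₀)
    (h₁ : β x₁ = β u) (hx₁ : v x₁ ≠ x₁) : v u = w u := by
  have vv := apply_apply_of_mul_self hv
  have ww := apply_apply_of_mul_self hw
  have key : ∀ x, β x = β u → v x ≠ x → v x = w x := by
    intro x hx hvx
    have hwx : w x ≠ x := by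
      rcases hpair w v (Or.inr rfl) (Or.inl rfl) x₀ x (h₀.trans hx.symm) hx₀ hvx with rfl | rfl
      · exact hx₀
      · rw [ww]; exact hx₀.symm
    exact (hpair w v (Or.inr rfl) (Or.inl rfl) x (v x) (hβv x).symm hwx
      (by rw [vv]; exact hvx.symm)).resolve_left hvx
  by_cases hu : v u = u
  · by_contra hne
    have hwu : w u ≠ u := fun e => hne (hu.trans e.symm)
    rcases hpair v w (Or.inl rfl) (Or.inr rfl) x₁ u h₁ hx₁ hwu with e | e
    · exact hx₁ (e ▸ hu)
    · rw [e, vv] at hu; exact hx₁ hu.symm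
  · exact key u rfl hu

namespace Blocks

variable [Finite X] [Finite Z]

/-- A generator centralized by generators that are transitive on the blocks moves a point in every
block. -/
theorem exists_move (h : Blocks ρ σ β S k m) (hJ : J ⊆ S) (ht : Tr (gen σ J) Set.univ) {w : Perm X}
    (hw : w ≠ 1) (hc : ∀ j ∈ J, Commute (ρ j) w) (u : X) : ∃ x, β x = β u ∧ w x ≠ x := by
  obtain ⟨x, hx⟩ : ∃ x, w x ≠ x := by
    by_contra hno
    push Not at hno
    exact hw (Equiv.ext hno)
  obtain ⟨g, hg, e⟩ := h.block_trans hJ ht x u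
  refine ⟨g x, e, fun e' => hx ?_⟩
  rw [← Perm.mul_apply, ← (commute_gen hc hg).eq, Perm.mul_apply] at e'
  exact g.injective e'

theorem false_of_run (h : Blocks ρ σ β (Finset.Icc 0 6) k m) (hk : Odd k) {y : ℤ} (hy2 : 2 ≤ y)
    (hy4 : y ≤ 4) (hm : (m : ℤ) = y + 1) (h0 : σ 0 = 1) (h6 : σ 6 = 1)
    (ht : Tr (gen σ (Finset.Icc 1 y)) Set.univ)
    (hess : ∀ e ∈ Finset.Icc 1 y, ¬ Tr (gen σ ((Finset.Icc 1 y).erase e)) Set.univ)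
    (hpair : ∀ g g' : Perm X, (g = ρ 0 ∨ g = ρ 6) → (g' = ρ 0 ∨ g' = ρ 6) → ∀ x x', β x = β x' →
      g x ≠ x → g' x' ≠ x' → x' = x ∨ x' = g x) : False := by
  have hmem : ∀ i : ℤ, 0 ≤ i → i ≤ 6 → i ∈ Finset.Icc (0 : ℤ) 6 := fun i h1 h2 => by
    rw [Finset.mem_Icc]; exact ⟨h1, h2⟩
  have m0 := hmem 0 (by norm_num) (by norm_num)
  have m1 := hmem 1 (by norm_num) (by norm_num)
  have m6 := hmem 6 (by norm_num) (by norm_num)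
  have hJ : Finset.Icc 1 y ⊆ Finset.Icc 0 6 := Finset.Icc_subset_Icc (by norm_num) (by omega)
  have hβ0 : ∀ x, β (ρ 0 x) = β x := fun x => by rw [h.equiv 0 m0, h0]; rfl
  have hβ6 : ∀ x, β (ρ 6 x) = β x := fun x => by rw [h.equiv 6 m6, h6]; rfl
  have hcomm : ∀ i j : ℤ, 0 ≤ i → j ≤ 6 → i + 1 < j → Commute (ρ i) (ρ j) := fun i j hi hj hij =>
    h.good.str i (hmem i hi (by omega)) j (hmem j (by omega) hj) hij
  have hw : ∀ u, ∃ x, β x = β u ∧ ρ 6 x ≠ x := fun u =>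
    h.exists_move hJ ht (h.good.indep.ne_one m6) (fun j hj => by
      rw [Finset.mem_Icc] at hj; exact hcomm j 6 (by omega) le_rfl (by omega)) u
  have hagree : ∀ {x u}, ρ 0 x ≠ x → β x = β u → ρ 0 u = ρ 6 u := fun {x u} hx e => by
    obtain ⟨x₀, h1, h2⟩ := hw u
    exact apply_eq_of_pair (h.invol 0 m0) (h.invol 6 m6) hβ0 hpair h1 h2 e hx
  -- the block fixed by the generators after the first
  have h1σ : ∃ p ∈ Set.univ, σ y p ≠ p := by
    by_contra hno
    push Not at hno
    refine hess y (by rw [Finset.mem_Icc]; omega) (ht.mono (gen_le.2 fun j hj => ?_))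
    by_cases hjy : j = y
    · rw [hjy, show σ y = 1 from Equiv.ext fun p => hno p trivial]; exact one_mem _
    · exact mem_gen (Finset.mem_erase.2 ⟨hjy, hj⟩)
  obtain ⟨W, -, hWc, hWt, -, hWf⟩ := exists_tail_orbit (x := 1) (y := y) (j := 2)
    (h.str_block.mono hJ) inv_univ ht (by rw [h.ncard_univ]; omega)
    (fun e he => hess e (by rw [Finset.mem_Icc] at he ⊢; omega)) h1σ (by norm_num) hy2
  have hcompl : (Wᶜ).ncard = 1 := by
    have := Set.ncard_add_ncard_compl W
    rw [h.card] at this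
    omega
  obtain ⟨z, hz⟩ := Set.ncard_eq_one.1 hcompl
  have hzW : ∀ c, c ∉ W ↔ c = z := fun c => by
    rw [← Set.mem_compl_iff, hz, Set.mem_singleton_iff]
  have hzf := hWf z trivial ((hzW z).2 rfl)
  obtain ⟨a, rfl⟩ := h.surj z
  have hσ1 : σ 1 (β a) ≠ β a := by
    intro e
    obtain ⟨c, hc⟩ := Set.nonempty_of_ncard_ne_zero (s := W) (by omega)
    obtain ⟨g, hg, rfl⟩ := ht (β a) trivial c trivial
    refine (hzW _).2 (fix_of_gens (fun i hi => ?_) hg) hc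
    rw [Finset.mem_Icc] at hi
    by_cases hi1 : i = 1
    · rw [hi1, e]
    · exact hzf _ (mem_gen (by rw [Finset.mem_Icc]; omega))
  have hconst : ∀ {x u}, ρ 0 x ≠ x → β x ≠ β a → β u ≠ β a → ρ 0 u = ρ 6 u := by
    intro x u hx hxa hua
    have hxW : β x ∈ W := by by_contra hn; exact hxa ((hzW _).1 hn)
    have huW : β u ∈ W := by by_contra hn; exact hua ((hzW _).1 hn)
    obtain ⟨g, hg, e⟩ := hWt _ hxW _ huW
    obtain ⟨g', hg', e'⟩ := h.exists_lift (Finset.Icc_subset_Icc (by norm_num) (by omega)) hg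
    refine hagree (x := g' x) (fun e1 => hx ?_) ((e' x).trans e)
    have hc0 : Commute g' (ρ 0) := commute_gen (fun j hj => by
      rw [Finset.mem_Icc] at hj; exact (hcomm 0 j le_rfl (by omega) (by omega)).symm) hg'
    rw [← Perm.mul_apply, ← hc0.eq, Perm.mul_apply] at e1
    exact g'.injective e1
  by_cases hA : ∃ x, β x = β a ∧ ρ 0 x ≠ x <;> by_cases hB : ∃ x, β x ≠ β a ∧ ρ 0 x ≠ x
  · obtain ⟨x, hxa, hx⟩ := hA
    obtain ⟨x', hxa', hx'⟩ := hB
    have : ρ 0 = ρ 6 := Equiv.ext fun u => by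
      by_cases hu : β u = β a
      · exact hagree hx (hxa.trans hu.symm)
      · exact hconst hx' hxa' hu
    exact absurd (h.good.indep.injOn m0 m6 this) (by norm_num)
  · obtain ⟨x, hxa, hx⟩ := hA
    push Not at hB
    have hsub : Finset.Icc 1 y ⊆ (Finset.Icc (0 : ℤ) 6).erase 6 := fun j hj => by
      rw [Finset.mem_erase]
      exact ⟨by rw [Finset.mem_Icc] at hj; omega, hJ hj⟩
    have := zpow_mem_of_classes (γ := β) (Set.toFinite _) (w := ρ 6) (v := ρ 0)
      (gen_mono (ρ := ρ) hsub) (mem_gen (by simp))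
      (fun g hg => commute_gen (fun j hj => by
        rw [Finset.mem_Icc] at hj; exact hcomm j 6 (by omega) le_rfl (by omega)) hg) hβ6
      (fun g hg x y e => by
        obtain ⟨g', -, e'⟩ := h.exists_proj hJ hg
        rw [e', e', e]) (h.block_trans hJ ht) a 1 0
      (fun u hu => by rw [zpow_one]; exact hagree hx (hxa.trans hu.symm))
      (fun u hu => by rw [zpow_zero]; exact hB u hu)
    simp only [mul_zero, sub_zero, zero_add, zpow_one] at this
    exact h.good.indep 6 m6 this
  · push Not at hA
    obtain ⟨x, hxa, hx⟩ := hB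
    have hQ : Inv (gen ρ (Finset.Icc 0 6)) {u | ρ 6 u ≠ u} := by
      have hcase : ∀ g : Perm X, Commute g (ρ 6) → ∀ u, ρ 6 u ≠ u → ρ 6 (g u) ≠ g u := by
        intro g hg u hu e
        rw [← Perm.mul_apply, ← hg.eq, Perm.mul_apply] at e
        exact hu (g.injective e)
      refine inv_gen_of fun i hi u hu => ?_
      rw [Finset.mem_Icc] at hi
      by_cases hi4 : i ≤ 4
      · exact hcase _ (hcomm i 6 hi.1 le_rfl (by omega)) u hu
      by_cases hi6 : i = 6
      · rw [hi6]; exact hcase _ (Commute.refl _) u hu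
      obtain rfl : i = 5 := by omega
      have c5 : Commute (ρ 0) (ρ 5) := hcomm 0 5 (by norm_num) (by norm_num) (by norm_num)
      have c15 : Commute (ρ 1) (ρ 5) := hcomm 1 5 (by norm_num) (by norm_num) (by norm_num)
      have c16 : Commute (ρ 1) (ρ 6) := hcomm 1 6 (by norm_num) (by norm_num) (by norm_num)
      -- moving by `ρ 0` is preserved by `ρ 5` and implies moving by `ρ 6`
      have h5 : ∀ u, ρ 0 u ≠ u → ρ 6 (ρ 5 u) ≠ ρ 5 u := by
        intro u hu e
        have h1 : ρ 0 (ρ 5 u) ≠ ρ 5 u := by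
          intro e1
          rw [← Perm.mul_apply, c5.eq, Perm.mul_apply] at e1
          exact hu ((ρ 5).injective e1)
        rw [← hagree h1 rfl] at e
        exact h1 e
      have hout : ∀ u, ρ 6 u ≠ u → β u ≠ β a → ρ 0 u ≠ u := fun u hu hua => by
        rw [hconst hx hxa hua]; exact hu
      change ρ 6 (ρ 5 u) ≠ ρ 5 u
      by_cases hua : β u = β a
      · have h1 : ρ 0 (ρ 1 u) ≠ ρ 1 u := hout _ (hcase _ c16 u hu) (by
          rw [h.equiv 1 m1, hua]; exact hσ1)
        have h2 := hcase _ c16 _ (h5 _ h1)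
        rw [← Perm.mul_apply (ρ 5), ← c15.eq, Perm.mul_apply,
          apply_apply_of_mul_self (h.invol 1 m1)] at h2
        exact h2
      · exact h5 u (hout u hu hua)
    obtain ⟨u, -, hu⟩ := hw a
    obtain ⟨f, hf, ef⟩ := exists_fix_of_odd (W := {y | β y = β a}) (h.invol 6 m6)
      (fun x hx => (hβ6 x).trans hx) (by rw [h.fib]; exact hk)
    obtain ⟨g, hg, e⟩ := h.good.tr u trivial f trivial
    exact hQ g hg u hu (by rw [e]; exact ef)
  · push Not at hA hB
    refine h.good.indep.ne_one m0 (Equiv.ext fun x => ?_)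
    by_cases hx : β x = β a
    · exact hA x hx
    · exact hB x hx

/-- A minimal transitive string on an odd prime number of points has no gaps. -/
theorem exists_eq_Icc (hσ : Str σ L) (hinv : ∀ i ∈ L, σ i * σ i = 1) (hL : L.Nonempty)
    (hp : (Nat.card Z).Prime) (hodd : Odd (Nat.card Z)) (ht : Tr (gen σ L) Set.univ)
    (hess : ∀ l ∈ L, ¬ Tr (gen σ (L.erase l)) Set.univ) : ∃ x y, x ≤ y ∧ L = Finset.Icc x y := by
  have hne : Nonempty Z := (Nat.card_pos_iff.1 hp.pos).1
  have hg : Good σ L Set.univ := ⟨Set.univ_nonempty, hσ, indep_of_essential ht hess, inv_univ, ht,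
    faith_univ⟩
  refine ⟨L.min' hL, L.max' hL, L.min'_le_max' hL, ?_⟩
  ext c
  rw [Finset.mem_Icc]
  refine ⟨fun hc => ⟨L.min'_le c hc, L.le_max' c hc⟩, fun ⟨h1, h2⟩ => ?_⟩
  by_contra hc
  have hmin := L.min'_mem hL
  have hmax := L.max'_mem hL
  have h1' : L.min' hL < c := lt_of_le_of_ne h1 fun e => hc (e ▸ hmin)
  have h2' : c < L.max' hL := lt_of_le_of_ne h2 fun e => hc (e ▸ hmax)
  refine hg.not_tr_of_prime hinv hp hodd (Set.ncard_univ Z) (hσ.comm_low_high c) (low_subset c)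
    (high_subset c) ⟨_, mem_low.2 ⟨hmin, h1'⟩⟩ ⟨_, mem_high.2 ⟨hmax, h2'⟩⟩ ?_
  rw [← erase_eq_low_union_high, Finset.erase_eq_of_notMem hc]
  exact ht

theorem exists_ne_of_ne_one {Z : Type*} {g : Perm Z} (hg : g ≠ 1) : ∃ x, g x ≠ x := by
  by_contra hno
  push Not at hno
  exact hg (Equiv.ext hno)

theorem false_of_essential (h : Blocks ρ σ β (Finset.Icc 0 6) k m) (hk : Odd k) (hm : m.Prime)
    (hmo : Odd m) (hkm : k + m = 8) (hm5 : m ≤ 5)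
    (hess : ∀ i ∈ Finset.Icc 0 6, i ≠ 0 → i ≠ 6 →
      ¬ Tr (gen ρ ((Finset.Icc 0 6).erase i)) Set.univ) : False := by
  classical
  have hmem : ∀ i : ℤ, 0 ≤ i → i ≤ 6 → i ∈ Finset.Icc (0 : ℤ) 6 := fun i h1 h2 => by
    rw [Finset.mem_Icc]; exact ⟨h1, h2⟩
  have m0 := hmem 0 (by norm_num) (by norm_num)
  have m6 := hmem 6 (by norm_num) (by norm_num)
  have hm3 : 3 ≤ m := by
    rcases hm.two_le.eq_or_lt with e | e
    · rw [← e] at hmo; exact absurd hmo (by decide)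
    · exact e
  have hE : ({0, 6} : Finset ℤ) ⊆ Finset.Icc 0 6 := by
    intro i hi; rw [Finset.mem_insert, Finset.mem_singleton] at hi
    rcases hi with rfl | rfl <;> assumption
  obtain ⟨L, hL, hLt, hLe, h1, h2⟩ := h.exists_essential hE fun i hi => by
    simp only [Finset.mem_sdiff, Finset.mem_insert, Finset.mem_singleton, not_or] at hi
    exact hess i hi.1 hi.2.1 hi.2.2
  have h3 := Finset.card_sdiff_add_card_eq_card hL
  have h4 : (Finset.Icc (0 : ℤ) 6 \ {0, 6}).card = 5 := by decide
  have hJ : {0, 6} ∪ L ⊆ Finset.Icc (0 : ℤ) 6 := Finset.union_subset hE (hL.trans Finset.sdiff_subset)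
  have h5 := h.norb_le hJ hLt
  have h6 := norb_le_ncard (H := gen σ {0, 6}) (Y := Set.univ)
  rw [h.ncard_univ] at h6
  set K := gen ρ ({0, 6} ∪ L) with hK
  have k0 : ρ 0 ∈ K := mem_gen (by simp)
  have k6 : ρ 6 ∈ K := mem_gen (by simp)
  by_cases hne : σ 0 = 1 ∧ σ 6 = 1
  · obtain ⟨s0, s6⟩ := hne
    have hβ0 : ∀ x, β (ρ 0 x) = β x := fun x => by rw [h.equiv 0 m0, s0]; rfl
    have hβ6 : ∀ x, β (ρ 6 x) = β x := fun x => by rw [h.equiv 6 m6, s6]; rfl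
    obtain ⟨x, hx⟩ := exists_ne_of_ne_one (h.good.indep.ne_one m0)
    have h7 := h.norb_lt_of_move hJ hLt k0 (hβ0 x) hx
    rw [← hK] at h7
    have hLc : L.card + 1 = m := by omega
    have hn : norb K Set.univ + 1 = k := by omega
    have hpair : ∀ g g' : Perm X, (g = ρ 0 ∨ g = ρ 6) → (g' = ρ 0 ∨ g' = ρ 6) → ∀ x x',
        β x = β x' → g x ≠ x → g' x' ≠ x' → x' = x ∨ x' = g x := by
      have aux : ∀ g, (g = ρ 0 ∨ g = ρ 6) → g ∈ K ∧ ∀ x, β (g x) = β x := by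
        rintro g (rfl | rfl)
        exacts [⟨k0, hβ0⟩, ⟨k6, hβ6⟩]
      intro g g' hg hg' x x' hxx' hx hx'
      obtain ⟨hgK, hgβ⟩ := aux g hg
      obtain ⟨hgK', hgβ'⟩ := aux g' hg'
      by_contra hno
      rw [not_or] at hno
      have hU := Set.ncard_sdiff_singleton_add_one (a := x) (s := {y | β y = β x}) rfl
      rw [h.fib] at hU
      have himg : orb K '' {y | β y = β x} = orb K '' ({y | β y = β x} \ {x}) := by
        refine Set.Subset.antisymm ?_ (Set.image_mono Set.sdiff_subset)
        rintro _ ⟨u, hu, rfl⟩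
        by_cases hux : u = x
        · exact ⟨g x, ⟨hgβ x, hx⟩, by rw [hux]; exact orb_eq_of_mem (apply_mem_orb hgK x)⟩
        · exact ⟨u, ⟨hu, hux⟩, rfl⟩
      have hfib := h.norb_le_fibre hJ hLt x
      rw [← hK] at hfib
      have hinj : Set.InjOn (orb K) ({y | β y = β x} \ {x}) := by
        refine Set.injOn_of_ncard_image_eq (le_antisymm Set.ncard_image_le ?_)
        rw [← himg]
        change _ ≤ norb K _
        omega
      by_cases hgx : g' x' = x
      · refine hno.2 (hinj ⟨hxx'.symm, hno.1⟩ ⟨hgβ x, hx⟩ ?_)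
        rw [orb_eq_of_mem (apply_mem_orb hgK x), ← hgx]
        exact (orb_eq_of_mem (apply_mem_orb hgK' x')).symm
      · exact hx' (hinj ⟨(hgβ' x').trans hxx'.symm, hgx⟩ ⟨hxx'.symm, hno.1⟩
          (orb_eq_of_mem (apply_mem_orb hgK' x')))
    have hdisj : ∀ l ∈ L, l ∉ ({0, 6} : Finset ℤ) := fun l hl => (Finset.mem_sdiff.1 (hL hl)).2
    have hLS : L ⊆ Finset.Icc (0 : ℤ) 6 := hL.trans Finset.sdiff_subset
    have hgen : ∀ T : Finset ℤ, T ⊆ {0, 6} ∪ L → gen σ T ≤ gen σ (T \ {0, 6}) := by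
      intro T _
      refine gen_le.2 fun j hj => ?_
      by_cases hj' : j ∈ ({0, 6} : Finset ℤ)
      · rw [Finset.mem_insert, Finset.mem_singleton] at hj'
        rcases hj' with rfl | rfl
        · rw [s0]; exact one_mem _
        · rw [s6]; exact one_mem _
      · exact mem_gen (Finset.mem_sdiff.2 ⟨hj, hj'⟩)
    have hLt' : Tr (gen σ L) Set.univ := hLt.mono <| (hgen _ le_rfl).trans <| gen_mono fun j hj => by
      simp only [Finset.mem_sdiff, Finset.mem_union] at hj; tauto
    have hLe' : ∀ l ∈ L, ¬ Tr (gen σ (L.erase l)) Set.univ := fun l hl ht =>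
      hLe l hl (ht.mono (gen_mono (Finset.erase_subset_erase _ Finset.subset_union_right)))
    obtain ⟨a, b, hab, rfl⟩ := exists_eq_Icc (h.str_block.mono hLS)
      (fun i hi => h.invol_block (hLS hi)) (Finset.card_pos.1 (by omega)) (h.card ▸ hm)
      (h.card ▸ hmo) hLt' hLe'
    rw [Int.card_Icc] at hLc
    have ha := hdisj a (by simp [hab])
    have hb := hdisj b (by simp [hab])
    have ha' := hLS (by simp [hab] : a ∈ Finset.Icc a b)
    have hb' := hLS (by simp [hab] : b ∈ Finset.Icc a b)
    simp only [Finset.mem_insert, Finset.mem_singleton, not_or, Finset.mem_Icc] at ha hb ha' hb'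
    by_cases ha1 : a = 1
    · subst ha1
      exact h.false_of_run hk (y := b) (by omega) (by omega) (by omega) s0 s6 hLt' hLe' hpair
    by_cases hb5 : b = 5
    · subst hb5
      refine h.mirror.false_of_run hk (y := 6 - a) (by omega) (by omega) (by omega) s6 s0 ?_ ?_ ?_
      · rw [gen_mirror_Icc]
        simpa using hLt'
      · intro e he
        rw [gen_mirror_erase]
        have := hLe' (6 - e) (by rw [Finset.mem_Icc] at he ⊢; omega)
        simpa using this
      · intro g g' hg hg'
        exact hpair g g' hg.symm hg'.symm
    · have : ρ 0 = ρ 6 := Equiv.ext fun u => by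
        obtain ⟨x₁, h11, h12⟩ := h.exists_move hLS hLt' (h.good.indep.ne_one m0) (fun j hj => by
          rw [Finset.mem_Icc] at hj
          exact (h.good.str 0 m0 j (hmem j (by omega) (by omega)) (by omega)).symm) u
        obtain ⟨x₀, h01, h02⟩ := h.exists_move hLS hLt' (h.good.indep.ne_one m6) (fun j hj => by
          rw [Finset.mem_Icc] at hj
          exact h.good.str j (hmem j (by omega) (by omega)) 6 m6 (by omega)) u
        exact apply_eq_of_pair (h.invol 0 m0) (h.invol 6 m6) hβ0 hpair h01 h02 h11 h12
      exact absurd (h.good.indep.injOn m0 m6 this) (by norm_num)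
  · -- the end generators act faithfully on the blocks, so they move too many of them
    have e0 : σ 0 ∈ gen σ {0, 6} := mem_gen (by simp)
    have e6 : σ 6 ∈ gen σ {0, 6} := mem_gen (by simp)
    have h7 : norb (gen σ {0, 6}) Set.univ + 1 ≤ m := by
      rw [← h.ncard_univ]
      by_cases s0 : σ 0 = 1
      · obtain ⟨z, hz⟩ := exists_ne_of_ne_one fun s6 => hne ⟨s0, s6⟩
        exact norb_lt_ncard e6 inv_univ trivial hz
      · obtain ⟨z, hz⟩ := exists_ne_of_ne_one s0
        exact norb_lt_ncard e0 inv_univ trivial hz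
    have key : ∀ g ∈ K, (∀ x, β (g x) = β x) → g = 1 := by
      intro g hg hβ
      by_contra hg1
      obtain ⟨x, hx⟩ := exists_ne_of_ne_one hg1
      have := h.norb_lt_of_move hJ hLt hg (hβ x) hx
      rw [← hK] at this
      omega
    have s0 : σ 0 ≠ 1 := fun s => h.good.indep.ne_one m0 <| key _ k0 fun x => by
      rw [h.equiv 0 m0, s]; rfl
    have s6 : σ 6 ≠ 1 := fun s => h.good.indep.ne_one m6 <| key _ k6 fun x => by
      rw [h.equiv 6 m6, s]; rfl
    have s06 : σ 6 ≠ σ 0 := fun s => by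
      have e := key _ (mul_mem k0 k6) fun x => by
        rw [Perm.mul_apply, h.equiv 0 m0, h.equiv 6 m6, s, ← Perm.mul_apply,
          h.invol_block m0]; rfl
      have e' : ρ 0 = ρ 6 := (eq_inv_of_mul_eq_one_left e).trans
        (inv_eq_of_mul_eq_one_right (h.invol 6 m6))
      exact absurd (h.good.indep.injOn m0 m6 e') (by norm_num)
    have := Good.norb_add_two_le (H := gen σ {0, 6}) (Y := Set.univ) inv_univ faith_univ e0 e6 s0 s6 s06
    rw [h.ncard_univ] at this
    omega

end Blocks

end StringPerm

namespace StringPerm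

open Equiv
open scoped Pointwise

variable {X : Type*} {ρ : ℤ → Perm X} {A B C E S T L J : Finset ℤ} {H K : Subgroup (Perm X)}
  {Y Y' W : Set X} [Finite X]

theorem eq_or_of_ncard_three (hW : W.ncard = 3) {a b c d : X} (ha : a ∈ W) (hb : b ∈ W)
    (hc : c ∈ W) (hab : a ≠ b) (hac : a ≠ c) (hbc : b ≠ c) (hd : d ∈ W) :
    d = a ∨ d = b ∨ d = c := by
  have hsub : ({a, b, c} : Set X) ⊆ W := by
    rintro _ (rfl | rfl | rfl) <;> assumption
  have h3 : ({a, b, c} : Set X).ncard = 3 := Set.ncard_eq_three.2 ⟨a, b, c, hab, hac, hbc, rfl⟩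
  have := Set.eq_of_subset_of_ncard_le hsub (by rw [hW, h3])
  rw [← this] at hd
  simpa using hd

theorem Comm.apply_mem_orb (h : Comm ρ A B) {g : Perm X} (hg : g ∈ gen ρ B) {x y : X}
    (hx : x ∈ orb (gen ρ A) y) : g x ∈ orb (gen ρ A) (g y) := by
  obtain ⟨a, ha, rfl⟩ := hx
  refine ⟨a, ha, ?_⟩
  rw [← Perm.mul_apply, (h.commute ha hg).eq, Perm.mul_apply]

theorem apply_ne_of_commute {g t : Perm X} (h : Commute g t) {x : X} (hx : g x ≠ x) :
    g (t x) ≠ t x := by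
  intro e
  rw [← Perm.mul_apply, h.eq, Perm.mul_apply] at e
  exact hx (t.injective e)

theorem Good.false_of_columns (h : Good ρ (Finset.Icc 0 6) Set.univ)
    (hinv : ∀ i ∈ Finset.Icc 0 6, ρ i * ρ i = 1) (hX : (Set.univ : Set X).ncard = 15)
    (htr : Tr (gen ρ (Finset.Icc 0 1 ∪ Finset.Icc 3 6)) Set.univ)
    (hA3 : ∀ x, (orb (gen ρ (Finset.Icc 0 1)) x).ncard = 3)
    (hB5 : ∀ x, (orb (gen ρ (Finset.Icc 3 6)) x).ncard = 5) : False := by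
  have hmem : ∀ i : ℤ, 0 ≤ i → i ≤ 6 → i ∈ Finset.Icc (0 : ℤ) 6 := fun i h1 h2 => by
    rw [Finset.mem_Icc]; exact ⟨h1, h2⟩
  have m0 := hmem 0 (by norm_num) (by norm_num)
  have m1 := hmem 1 (by norm_num) (by norm_num)
  have m2 := hmem 2 (by norm_num) (by norm_num)
  have hcomm : ∀ i j : ℤ, 0 ≤ i → j ≤ 6 → i + 1 < j → Commute (ρ i) (ρ j) := fun i j hi hj hij =>
    h.str i (hmem i hi (by omega)) j (hmem j (by omega) hj) hij
  have hcAB : Comm ρ (Finset.Icc 0 1) (Finset.Icc 3 6) := fun i hi j hj => by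
    rw [Finset.mem_Icc] at hi hj; exact hcomm i j hi.1 hj.2 (by omega)
  have hH : Finset.Icc (4 : ℤ) 6 ⊆ Finset.Icc 3 6 := Finset.Icc_subset_Icc (by norm_num) le_rfl
  have hH5 : Finset.Icc (5 : ℤ) 6 ⊆ Finset.Icc 4 6 := Finset.Icc_subset_Icc (by norm_num) le_rfl
  have hBS : Finset.Icc (3 : ℤ) 6 ⊆ Finset.Icc 0 6 := Finset.Icc_subset_Icc (by norm_num) le_rfl
  have hAS : Finset.Icc (0 : ℤ) 1 ⊆ Finset.Icc 0 6 := Finset.Icc_subset_Icc le_rfl (by norm_num)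
  have hcH2 : ∀ g ∈ gen ρ (Finset.Icc 4 6), Commute g (ρ 2) := fun g hg =>
    commute_gen (fun j hj => by
      rw [Finset.mem_Icc] at hj; exact (hcomm 2 j (by norm_num) hj.2 (by omega)).symm) hg
  have hcB0 : ∀ g ∈ gen ρ (Finset.Icc 3 6), Commute g (ρ 0) := fun g hg =>
    (hcAB.commute (mem_gen (by simp)) hg).symm
  have c02 : Commute (ρ 0) (ρ 2) := hcomm 0 2 le_rfl (by norm_num) (by norm_num)
  have a0m : ρ 0 ∈ gen ρ (Finset.Icc 0 1) := mem_gen (by simp)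
  have a1m : ρ 1 ∈ gen ρ (Finset.Icc 0 1) := mem_gen (by simp)
  have r00 := apply_apply_of_mul_self (hinv 0 m0)
  have r11 := apply_apply_of_mul_self (hinv 1 m1)
  have r22 := apply_apply_of_mul_self (hinv 2 m2)
  have htr' : Tr (gen ρ (Finset.Icc 3 6 ∪ Finset.Icc 0 1)) Set.univ := by
    rwa [Finset.union_comm]
  -- rows and columns meet in single points
  have hdec : ∀ x y, ∃ u ∈ orb (gen ρ (Finset.Icc 3 6)) x, y ∈ orb (gen ρ (Finset.Icc 0 1)) u := by
    intro x y
    obtain ⟨g, hg, rfl⟩ := htr x trivial y trivial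
    obtain ⟨a, ha, b, hb, rfl⟩ := hcAB.exists_mul hg
    exact ⟨b x, apply_mem_orb hb x, apply_mem_orb ha _⟩
  have hrow : ∀ x y, y ∈ orb (gen ρ (Finset.Icc 0 1)) x → y ∈ orb (gen ρ (Finset.Icc 3 6)) x →
      y = x := by
    intro x y h1 h2
    have h3 := h.norb_mul hcAB hAS hBS htr (x := x) trivial
    have h4 := hcAB.norb_eq htr inv_univ (x := x) trivial
    rw [hB5, hX] at h3
    refine Set.injOn_of_ncard_image_eq (f := orb (gen ρ (Finset.Icc 3 6)))
      (s := orb (gen ρ (Finset.Icc 0 1)) x) ?_ (Set.toFinite _) h1 (mem_orb_self x) (orb_eq_of_mem h2)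
    rw [hA3]
    change norb _ _ = 3
    omega
  obtain ⟨x0, -, hx0⟩ := exists_fix_of_odd (W := Set.univ) (hinv 0 m0) (fun _ _ => trivial)
    (by rw [hX]; decide)
  obtain ⟨Y, hY⟩ : ∃ Y, Y = orb (gen ρ (Finset.Icc 3 6)) x0 := ⟨_, rfl⟩
  have hYfix : ∀ y ∈ Y, ρ 0 y = y := by
    rw [hY]
    rintro _ ⟨g, hg, rfl⟩
    exact fix_of_commute (hcB0 g hg).symm hx0
  have hcol : ∀ x, ∃ y ∈ Y, x ∈ orb (gen ρ (Finset.Icc 0 1)) y := fun x => hY ▸ hdec x0 x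
  have hthree : ∀ y u, ρ 0 y = y → u ∈ orb (gen ρ (Finset.Icc 0 1)) y → ρ 0 u = u → u = y := by
    intro y u hy hu hu0
    by_contra hne
    have hf := (h.orbit hcAB.symm htr' hAS (x := y) trivial).faith
    obtain ⟨v, hv, hv0⟩ := hf.exists_ne a0m (h.indep.ne_one m0)
    have hyv : y ≠ v := fun e => hv0 (e ▸ hy)
    have huv : u ≠ v := fun e => hv0 (e ▸ hu0)
    rcases eq_or_of_ncard_three (hA3 y) (mem_orb_self y) hu hv (Ne.symm hne) hyv huv
      (mem_orb_trans hv (apply_mem_orb a0m v)) with e | e | e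
    · exact hyv (by rw [← r00 v, e, hy])
    · exact huv (by rw [← r00 v, e, hu0])
    · exact hv0 e
  have hYiff : ∀ x, ρ 0 x = x → x ∈ Y := by
    intro x hx
    obtain ⟨y, hy, hxy⟩ := hcol x
    rw [hthree y x (hYfix y hy) hxy hx]
    exact hy
  have hcol3 : ∀ x x', ρ 0 x ≠ x → x' ∈ orb (gen ρ (Finset.Icc 0 1)) x →
      x' = x ∨ x' = ρ 0 x ∨ ρ 0 x' = x' := by
    intro x x' hx hx'
    obtain ⟨y, hy, hxy⟩ := hcol x
    have hy0 := hYfix y hy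
    rcases eq_or_of_ncard_three (hA3 y) (mem_orb_self y) hxy (mem_orb_trans hxy (apply_mem_orb a0m x))
      (fun e => hx (e ▸ hy0)) (fun e => hx (by rw [e, r00] at hy0; exact hy0.symm)) (Ne.symm hx)
      (mem_orb_trans hxy hx') with e | e | e
    · exact Or.inr (Or.inr (by rw [e]; exact hy0))
    · exact Or.inl e
    · exact Or.inr (Or.inl e)
  have hYc : Y.ncard = 5 := hY ▸ hB5 x0
  have h2Y : ∀ y ∈ Y, ρ 2 y ∈ Y := fun y hy => hYiff _ (fix_of_commute c02 (hYfix y hy))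
  have hgood : Good ρ (Finset.Icc 3 6) Y := hY ▸ h.orbit hcAB htr hBS trivial
  by_cases hHt : Tr (gen ρ (Finset.Icc 4 6)) Y
  · have hHorb : ∀ x, orb (gen ρ (Finset.Icc 4 6)) x = orb (gen ρ (Finset.Icc 3 6)) x := by
      intro x
      obtain ⟨y, hy, a, ha, rfl⟩ := hcol x
      rw [orb_image_of_commute fun b hb => hcAB.commute ha (gen_mono hH hb),
        orb_image_of_commute fun b hb => hcAB.commute ha hb,
        hHt.orb_eq (hgood.inv.mono (gen_mono hH)) hy, hgood.tr.orb_eq hgood.inv hy]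
    have h2fix : ∀ y ∈ Y, ρ 2 y = y := fun y hy =>
      fix_of_odd (hinv 2 m2) h2Y (by rw [hYc]; decide) hHt hcH2 hy
    obtain ⟨u, hu⟩ := Blocks.exists_ne_of_ne_one (h.indep.ne_one m0)
    have hpts : ∀ x, ρ 0 x ≠ x → ∃ v ∈ orb (gen ρ (Finset.Icc 4 6)) u, x = v ∨ x = ρ 0 v := by
      intro x hx
      obtain ⟨v, hv, hxv⟩ := hdec u x
      have hv0 : ρ 0 v ≠ v := by
        obtain ⟨g, hg, rfl⟩ := hv
        exact apply_ne_of_commute (hcB0 g hg).symm hu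
      rcases hcol3 v x hv0 hxv with e | e | e
      · exact ⟨v, hHorb u ▸ hv, Or.inl e⟩
      · exact ⟨v, hHorb u ▸ hv, Or.inr e⟩
      · exact absurd e hx
    have key : ∀ z : Perm X, z * z = 1 → (∀ g ∈ gen ρ (Finset.Icc 4 6), Commute g z) →
        Commute z (ρ 0) → (∀ y ∈ Y, z y = y) → z u ∈ orb (gen ρ (Finset.Icc 4 6)) u → z = 1 := by
      intro z hz hzH hz0 hzY hzu
      have hfix : ∀ x ∈ orb (gen ρ (Finset.Icc 4 6)) u, z x = x := fun x hx =>
        fix_of_odd hz (fun x hx => by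
          rw [← orb_eq_of_mem hzu, orb_image_of_commute fun g hg => (hzH g hg).symm]
          exact ⟨x, hx, rfl⟩) (by rw [hHorb, hB5]; decide) (tr_orb u) hzH hx
      refine Equiv.ext fun x => ?_
      by_cases hx : ρ 0 x = x
      · exact hzY x (hYiff x hx)
      obtain ⟨v, hv, rfl | rfl⟩ := hpts x hx
      · exact hfix _ hv
      · exact fix_of_commute hz0 (hfix v hv)
    obtain ⟨v, hv, e | e⟩ := hpts (ρ 2 u) (apply_ne_of_commute c02 hu)
    · exact h.indep.ne_one m2 (key _ (hinv 2 m2) hcH2 c02.symm h2fix (e ▸ hv))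
    · have h1 : ρ 0 * ρ 2 = 1 := by
        refine key _ ?_ (fun g hg => (hcB0 g (gen_mono hH hg)).mul_right (hcH2 g hg))
          ((Commute.refl _).mul_left c02.symm) (fun y hy => ?_) ?_
        · rw [mul_assoc, ← mul_assoc (ρ 2), ← c02.eq, mul_assoc, hinv 2 m2, mul_one, hinv 0 m0]
        · rw [Perm.mul_apply, h2fix y hy, hYfix y hy]
        · rw [Perm.mul_apply, e, r00]; exact hv
      have h2 : ρ 0 = ρ 2 := (eq_inv_of_mul_eq_one_left h1).trans
        (inv_eq_of_mul_eq_one_right (hinv 2 m2))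
      exact absurd (h.indep.injOn m0 m2 h2) (by norm_num)
  · have hess : ∀ e ∈ Finset.Icc (3 : ℤ) (6 - 1), ¬ Tr (gen ρ ((Finset.Icc 3 6).erase e)) Y := by
      intro e he ht
      rw [Finset.mem_Icc] at he
      by_cases he3 : e = 3
      · refine hHt (ht.mono (gen_mono fun j hj => ?_))
        rw [Finset.mem_erase, Finset.mem_Icc] at hj
        rw [Finset.mem_Icc]; omega
      · rw [erase_eq_low_union_high] at ht
        refine hgood.not_tr_of_prime (fun i hi => hinv i (hBS hi)) (by norm_num : Nat.Prime 5)
          (by decide) hYc (hgood.str.comm_low_high e) (low_subset e) (high_subset e)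
          ⟨3, mem_low.2 ⟨by simp, by omega⟩⟩ ⟨6, mem_high.2 ⟨by simp, by omega⟩⟩ ht
    have h6 : ∃ p ∈ Y, ρ 6 p ≠ p := hgood.faith.exists_ne (mem_gen (by simp))
      (hgood.indep.ne_one (by simp))
    obtain ⟨W, hWY, hWc, hWt, -, hWf⟩ := exists_tail_orbit (j := 4) hgood.str hgood.inv hgood.tr
      (by rw [hYc]; norm_num) hess h6 (by norm_num) (by norm_num)
    obtain ⟨V, hVY, hVc, hVt, -, hVf⟩ := exists_tail_orbit (j := 5) hgood.str hgood.inv hgood.tr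
      (by rw [hYc]; norm_num) hess h6 (by norm_num) (by norm_num)
    have hmoved : ∀ {G : Subgroup (Perm X)} {U : Set X}, 1 < U.ncard → Tr G U → ∀ y ∈ U,
        ¬ ∀ g ∈ G, g y = y := by
      intro G U hU ht y hy hall
      obtain ⟨z, hz, hne⟩ := Set.exists_ne_of_one_lt_ncard hU y
      obtain ⟨g, hg, e⟩ := ht y hy z hz
      exact hne (e ▸ hall g hg)
    have hWm := hmoved (by omega) hWt
    have hVm := hmoved (by omega) hVt
    have hW1 : (Y \ W).ncard = 1 := by
      have := Set.ncard_sdiff_add_ncard_of_subset hWY; omega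
    have hV2 : (Y \ V).ncard = 2 := by
      have := Set.ncard_sdiff_add_ncard_of_subset hVY; omega
    obtain ⟨a, ha⟩ := Set.ncard_eq_one.1 hW1
    have haY : a ∈ Y \ W := by rw [ha]; rfl
    have haW : ∀ y ∈ Y, y ∉ W → y = a := fun y h1 h2 => by
      have : y ∈ Y \ W := ⟨h1, h2⟩
      rwa [ha] at this
    have haf := hWf a haY.1 haY.2
    have haV : a ∈ Y \ V := ⟨haY.1, fun hav => hVm a hav fun g hg => haf g (gen_mono hH5 hg)⟩
    obtain ⟨b, hb, hba⟩ := Set.exists_ne_of_one_lt_ncard (by omega : 1 < (Y \ V).ncard) a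
    have hbV : ∀ y ∈ Y, y ∉ V → y = a ∨ y = b := fun y h1 h2 => by
      have hsub : ({a, b} : Set X) ⊆ Y \ V := by rintro _ (rfl | rfl) <;> assumption
      have e := Set.eq_of_subset_of_ncard_le hsub (by rw [hV2, Set.ncard_pair hba.symm])
      have : y ∈ Y \ V := ⟨h1, h2⟩
      rw [← e] at this
      simpa using this
    have hbW : b ∈ W := by
      by_contra hn; exact hba (haW b hb.1 hn)
    have hYrow : ∀ y ∈ Y, ∀ y' ∈ Y, y' ∈ orb (gen ρ (Finset.Icc 0 1)) y → y' = y :=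
      fun y hy y' hy' ho => hrow y y' ho (by rw [hgood.tr.orb_eq hgood.inv hy]; exact hy')
    have hfixcol : ∀ {T : Finset ℤ}, T ⊆ Finset.Icc 3 6 → ∀ x y,
        x ∈ orb (gen ρ (Finset.Icc 0 1)) y → (∀ g ∈ gen ρ T, g y = y) → ∀ g ∈ gen ρ T, g x = x := by
      rintro T hT _ y ⟨c, hc, rfl⟩ hy g hg
      exact fix_of_commute (hcAB.commute hc (gen_mono hT hg)).symm (hy g hg)
    have h2a : ∀ x, x ∈ orb (gen ρ (Finset.Icc 0 1)) a → ρ 2 x ∈ orb (gen ρ (Finset.Icc 0 1)) a := by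
      intro x hx
      obtain ⟨y, hy, hxy⟩ := hcol (ρ 2 x)
      have hfx := hfixcol hH x a hx haf
      have hfy := hfixcol hH y (ρ 2 x) (mem_orb_symm hxy) fun g hg =>
        fix_of_commute (hcH2 g hg) (hfx g hg)
      rwa [haW y hy fun hyW => hWm y hyW hfy] at hxy
    have h2b : ∀ x, x ∈ orb (gen ρ (Finset.Icc 0 1)) b → ρ 2 x ∈ orb (gen ρ (Finset.Icc 0 1)) b := by
      intro x hx
      obtain ⟨y, hy, hxy⟩ := hcol (ρ 2 x)
      have hfx := hfixcol (hH5.trans hH) x b hx (hVf b hb.1 hb.2)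
      have hfy := hfixcol (hH5.trans hH) y (ρ 2 x) (mem_orb_symm hxy) fun g hg =>
        fix_of_commute (hcH2 g (gen_mono hH5 hg)) (hfx g hg)
      rcases hbV y hy fun hyV => hVm y hyV hfy with rfl | rfl
      · have := h2a _ hxy
        rw [r22] at this
        exact absurd (hYrow _ hy _ hb.1 (mem_orb_trans this (mem_orb_symm hx))) hba
      · exact hxy
    have h2col : ∀ x, ρ 2 x ∈ orb (gen ρ (Finset.Icc 0 1)) x := by
      intro x
      obtain ⟨y, hy, hxy⟩ := hcol x
      rw [orb_eq_of_mem hxy]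
      by_cases hyW : y ∈ W
      · obtain ⟨g, hg, rfl⟩ := hWt b hbW y hyW
        have h1 := hcAB.apply_mem_orb (inv_mem (gen_mono hH hg)) hxy
        rw [← Perm.mul_apply, inv_mul_cancel, Perm.one_apply] at h1
        have h3 := hcAB.apply_mem_orb (gen_mono hH hg) (h2b _ h1)
        rwa [← Perm.mul_apply, (hcH2 g hg).eq, Perm.mul_apply, ← Perm.mul_apply g,
          mul_inv_cancel, Perm.one_apply] at h3
      · rw [haW y hy hyW] at hxy ⊢
        exact h2a x hxy
    have hor : ∀ x, ρ 2 x = x ∨ ρ 2 x = ρ 0 x := by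
      intro x
      by_cases hx : ρ 0 x = x
      · exact Or.inl (hthree x _ hx (h2col x) (fix_of_commute c02 hx))
      · rcases hcol3 x _ hx (h2col x) with e | e | e
        · exact Or.inl e
        · exact Or.inr e
        · exact absurd e (apply_ne_of_commute c02 hx)
    have hagree : ∀ x u, ρ 2 x ≠ x → u ∈ orb (gen ρ (Finset.Icc 0 1)) x → ρ 2 u = ρ 0 u := by
      intro x u hx hu
      have hx' := (hor x).resolve_left hx
      rcases hcol3 x u (by rw [← hx']; exact hx) hu with rfl | rfl | e
      · exact hx'
      · rw [← hx', ← Perm.mul_apply, ← Perm.mul_apply, c02.eq, Perm.mul_apply, Perm.mul_apply, hx']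
      · rcases hor u with e' | e'
        · rw [e', e]
        · exact e'
    have hconst : ∀ x u, ρ 2 x ≠ x → x ∉ orb (gen ρ (Finset.Icc 0 1)) a →
        u ∉ orb (gen ρ (Finset.Icc 0 1)) a → ρ 2 u = ρ 0 u := by
      intro x u hx hxa hua
      obtain ⟨y, hy, hxy⟩ := hcol x
      obtain ⟨y', hy', huy⟩ := hcol u
      have hyW : y ∈ W := by by_contra hn; exact hxa (haW y hy hn ▸ hxy)
      have hyW' : y' ∈ W := by by_contra hn; exact hua (haW y' hy' hn ▸ huy)
      obtain ⟨g, hg, rfl⟩ := hWt y hyW y' hyW'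
      refine hagree (g x) u (apply_ne_of_commute (hcH2 g hg).symm hx) ?_
      exact mem_orb_trans (mem_orb_symm (hcAB.apply_mem_orb (gen_mono hH hg) hxy)) huy
    have hsub : Finset.Icc (3 : ℤ) 6 ⊆ (Finset.Icc 0 6).erase 0 := by decide
    have hγ : ∀ g ∈ gen ρ (Finset.Icc 3 6), ∀ x y,
        orb (gen ρ (Finset.Icc 0 1)) x = orb (gen ρ (Finset.Icc 0 1)) y →
        orb (gen ρ (Finset.Icc 0 1)) (g x) = orb (gen ρ (Finset.Icc 0 1)) (g y) :=
      fun g hg x y e => orb_eq_iff.2 (hcAB.apply_mem_orb hg (orb_eq_iff.1 e))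
    have hγt : ∀ x y, ∃ g ∈ gen ρ (Finset.Icc 3 6),
        orb (gen ρ (Finset.Icc 0 1)) (g x) = orb (gen ρ (Finset.Icc 0 1)) y := fun x y => by
      obtain ⟨_, ⟨g, hg, rfl⟩, hu⟩ := hdec x y
      exact ⟨g, hg, orb_eq_iff.2 hu⟩
    have hγa : ∀ x, orb (gen ρ (Finset.Icc 0 1)) x = orb (gen ρ (Finset.Icc 0 1)) a ↔
        x ∈ orb (gen ρ (Finset.Icc 0 1)) a := fun x => eq_comm.trans orb_eq_iff
    by_cases hP : ∃ x ∈ orb (gen ρ (Finset.Icc 0 1)) a, ρ 2 x ≠ x <;>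
      by_cases hQ : ∃ x, x ∉ orb (gen ρ (Finset.Icc 0 1)) a ∧ ρ 2 x ≠ x
    · obtain ⟨x, hxa, hx⟩ := hP
      obtain ⟨x', hxa', hx'⟩ := hQ
      have : ρ 2 = ρ 0 := Equiv.ext fun u => by
        by_cases hu : u ∈ orb (gen ρ (Finset.Icc 0 1)) a
        · exact hagree x u hx (mem_orb_trans (mem_orb_symm hxa) hu)
        · exact hconst x' u hx' hxa' hu
      exact absurd (h.indep.injOn m2 m0 this) (by norm_num)
    · obtain ⟨x, hxa, hx⟩ := hP
      push Not at hQ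
      have := zpow_mem_of_classes (γ := orb (gen ρ (Finset.Icc 0 1))) (Set.toFinite _) (w := ρ 0)
        (v := ρ 2) (gen_mono (ρ := ρ) hsub) (mem_gen (by simp)) hcB0
        (fun x => orb_eq_of_mem (apply_mem_orb a0m x)) hγ hγt a 1 0
        (fun u hu => by
          rw [zpow_one]
          exact hagree x u hx (mem_orb_trans (mem_orb_symm hxa) ((hγa u).1 hu)))
        (fun u hu => by rw [zpow_zero]; exact hQ u fun hn => hu ((hγa u).2 hn))
      simp only [mul_zero, sub_zero, zero_add, zpow_one] at this
      exact h.indep 0 m0 this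
    · push Not at hP
      obtain ⟨x, hxa, hx⟩ := hQ
      have hcardA : Nat.card (gen ρ (Finset.Icc 0 1)) ≤ 6 := by
        have hg := h.orbit hcAB.symm htr' hAS (x := a) trivial
        have := card_le_factorial hg.inv hg.faith
        rwa [hA3] at this
      have hne : ¬ Commute (ρ 0) (ρ 1) := by
        intro hc
        have := (h.orbit hcAB.symm htr' hAS (x := a) trivial).two_pow_le_ncard
          (B := Finset.Icc 0 1) (C := Finset.Icc 0 1) le_rfl (fun i hi j hj => by
            have h01 : ∀ l ∈ Finset.Icc (0 : ℤ) 1, l = 0 ∨ l = 1 := fun l hl => by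
              rw [Finset.mem_Icc] at hl; omega
            rcases h01 i hi with rfl | rfl <;> rcases h01 j hj with rfl | rfl
            exacts [Commute.refl _, hc, hc.symm, Commute.refl _])
        rw [hA3] at this
        exact absurd this (by decide)
      have hw3 := pow_three_of_card_le a0m a1m (hinv 0 m0) (hinv 1 m1) hne hcardA
      have hr1 : ρ 1 ∈ gen ρ ((Finset.Icc 0 6).erase 0) := mem_gen (by simp)
      have hr2 : ρ 2 ∈ gen ρ ((Finset.Icc 0 6).erase 0) := mem_gen (by simp)
      have hwB : ∀ g ∈ gen ρ (Finset.Icc 3 6), Commute g (ρ 0 * ρ 1) := fun g hg =>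
        (hcAB.commute (mul_mem a0m a1m) hg).symm
      have := zpow_mem_of_classes (γ := orb (gen ρ (Finset.Icc 0 1))) (Set.toFinite _)
        (w := ρ 0 * ρ 1) (v := (ρ 2 * ρ 1) ^ 2) (gen_mono (ρ := ρ) hsub)
        (pow_mem (mul_mem hr2 hr1) 2) hwB
        (fun x => orb_eq_of_mem (apply_mem_orb (mul_mem a0m a1m) x)) hγ hγt a 0 2
        (fun u hu => by
          rw [hγa] at hu
          have h1 := mem_orb_trans hu (apply_mem_orb a1m u)
          simp only [pow_two, Perm.mul_apply, zpow_zero]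
          rw [hP _ h1, r11, hP _ hu]; rfl)
        (fun u hu => by
          rw [Ne, hγa] at hu
          have hst : ∀ {c : Perm X}, c ∈ gen ρ (Finset.Icc 0 1) → ∀ {y},
              y ∉ orb (gen ρ (Finset.Icc 0 1)) a → c y ∉ orb (gen ρ (Finset.Icc 0 1)) a :=
            fun hc y hy hn => hy (mem_orb_trans hn (mem_orb_symm (apply_mem_orb hc y)))
          have h1 := hst a1m hu
          have h2 := hst a0m h1
          have h3 := hst a1m h2
          rw [zpow_two, pow_two]
          simp only [Perm.mul_apply]
          rw [hconst x _ hx hxa h1, hconst x _ hx hxa h3])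
      have hcols : (Set.range (orb (gen ρ (Finset.Icc 0 1)))).ncard = 5 := by
        have h3 := h.norb_mul hcAB.symm hBS hAS htr' (x := a) trivial
        rw [hA3, hX, norb, Set.image_univ] at h3
        omega
      rw [hcols] at this
      have e8 : (ρ 0 * ρ 1) ^ (((5 : ℕ) : ℤ) * 2 + (0 - 2)) = (ρ 0 * ρ 1)⁻¹ := by
        rw [show (((5 : ℕ) : ℤ) * 2 + (0 - 2)) = ((8 : ℕ) : ℤ) by norm_num, zpow_natCast]
        refine eq_inv_of_mul_eq_one_left ?_
        rw [← pow_succ, show 8 + 1 = 3 * 3 from rfl, pow_mul, hw3, one_pow]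
      rw [e8] at this
      have h0 := mul_mem (inv_mem this) (inv_mem hr1)
      rw [inv_inv, mul_assoc, mul_inv_cancel, mul_one] at h0
      exact h.indep 0 m0 h0
    · push Not at hP hQ
      refine h.indep.ne_one m2 (Equiv.ext fun x => ?_)
      by_cases hx : x ∈ orb (gen ρ (Finset.Icc 0 1)) a
      · exact hP x hx
      · exact hQ x hx

end StringPerm

namespace StringPerm

open Equiv
open scoped Pointwise

variable {X Z : Type*} {ρ : ℤ → Perm X} {σ : ℤ → Perm Z} {β : X → Z} {k m : ℕ} [Finite X]
  [Finite Z]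

theorem low_Icc (s t i : ℤ) (hi : i ≤ t + 1) : low (Finset.Icc s t) i = Finset.Icc s (i - 1) := by
  ext j
  simp only [mem_low, Finset.mem_Icc]
  omega

theorem high_Icc (s t i : ℤ) (hi : s ≤ i + 1) :
    high (Finset.Icc s t) i = Finset.Icc (i + 1) t := by
  ext j
  simp only [mem_high, Finset.mem_Icc]
  omega

theorem Good.not_tr_of_fifteen (h : Good ρ (Finset.Icc 0 6) Set.univ)
    (hinv : ∀ i ∈ Finset.Icc 0 6, ρ i * ρ i = 1) (hX : (Set.univ : Set X).ncard = 15) {i : ℤ}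
    (hi : i ∈ Finset.Icc 0 6) (hi0 : i ≠ 0) (hi6 : i ≠ 6) :
    ¬ Tr (gen ρ ((Finset.Icc 0 6).erase i)) Set.univ := by
  intro htr
  rw [Finset.mem_Icc] at hi
  have hc := h.str.comm_low_high i
  have hA := low_subset (S := Finset.Icc 0 6) i
  have hB := high_subset (S := Finset.Icc 0 6) i
  rw [erase_eq_low_union_high] at htr
  rw [low_Icc _ _ _ (by omega)] at hc hA htr
  rw [high_Icc _ _ _ (by omega)] at hc hB htr
  have htr' : Tr (gen ρ (Finset.Icc (i + 1) 6 ∪ Finset.Icc 0 (i - 1))) Set.univ := by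
    rwa [Finset.union_comm]
  obtain ⟨x, -⟩ := h.nonempty
  have hcA := (h.orbit hc.symm htr' hA (x := x) trivial).card_add_one_le
  have hcB := (h.orbit hc htr hB (x := x) trivial).card_add_one_le
  rw [Int.card_Icc] at hcA hcB
  rcases h.prime_orbits hinv Nat.prime_three Nat.prime_five (by decide) (by decide)
    (by rw [hX]) hc hA hB (by rw [Finset.nonempty_Icc]; omega) (by rw [Finset.nonempty_Icc]; omega)
    htr with ho | ho
  · rw [(ho x trivial).1] at hcA
    rw [(ho x trivial).2] at hcB
    obtain rfl : i = 2 := by omega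
    exact h.false_of_columns hinv hX htr (fun x => (ho x trivial).1) fun x => (ho x trivial).2
  · rw [(ho x trivial).1] at hcA
    rw [(ho x trivial).2] at hcB
    obtain rfl : i = 4 := by omega
    refine h.mirror.false_of_columns (fun i hi => hinv _ ?_) hX ?_ ?_ ?_
    · rw [Finset.mem_Icc] at hi ⊢; omega
    · rw [gen_mirror, Finset.image_union, image_mirror_Icc, image_mirror_Icc]
      exact htr'
    · intro x
      rw [gen_mirror_Icc]
      exact (ho x trivial).2
    · intro x
      rw [gen_mirror_Icc]
      exact (ho x trivial).1

theorem Blocks.card_le_six {t : ℤ} (h : Blocks ρ σ β (Finset.Icc 0 t) k m)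
    (hX : (Set.univ : Set X).ncard = k * m) (hkm : (k = 3 ∧ m = 5) ∨ (k = 5 ∧ m = 3)) :
    (Finset.Icc 0 t).card ≤ 6 := by
  by_contra hlt
  have h15 : (Set.univ : Set X).ncard = 15 := by rcases hkm with ⟨rfl, rfl⟩ | ⟨rfl, rfl⟩ <;> exact hX
  have hmp : m.Prime := by rcases hkm with ⟨-, rfl⟩ | ⟨-, rfl⟩ <;> norm_num
  have hkp : k.Prime := by rcases hkm with ⟨rfl, -⟩ | ⟨rfl, -⟩ <;> norm_num
  have hko : Odd k := by rcases hkm with ⟨rfl, -⟩ | ⟨rfl, -⟩ <;> decide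
  have hmo : Odd m := by rcases hkm with ⟨-, rfl⟩ | ⟨-, rfl⟩ <;> decide
  rw [Int.card_Icc] at hlt
  have hle := h.card_lt_of_primes (by omega) hkp hmp (by omega) (hko.mul hmo) hX
  rw [Int.card_Icc] at hle
  obtain rfl : t = 6 := by omega
  exact h.false_of_essential hko hmp hmo (by omega) (by omega) fun i hi h0 h6 =>
    h.good.not_tr_of_fifteen h.invol h15 hi h0 h6

end StringPerm

namespace StringPerm

open Equiv
open scoped Pointwise

theorem exists_induced {X Z : Type*} [Finite Z] {β : X → Z} (hβ : Function.Surjective β)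
    {g : Perm X} (hg : ∀ x y, β x = β y → β (g x) = β (g y)) :
    ∃ τ : Perm Z, ∀ x, β (g x) = τ (β x) := by
  have hf : ∀ x, β (g (Function.surjInv hβ (β x))) = β (g x) := fun x =>
    hg _ _ (Function.surjInv_eq hβ _)
  have hs : Function.Surjective fun z => β (g (Function.surjInv hβ z)) := by
    intro z
    obtain ⟨x, rfl⟩ := hβ z
    exact ⟨β (g⁻¹ x), by simp only [hf]; simp⟩
  exact ⟨Equiv.ofBijective _ ⟨Finite.injective_iff_surjective.2 hs, hs⟩, fun x => (hf x).symm⟩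

variable {n r k m : ℕ}

/-- A family indexed by `Fin r`, extended by the identity to all integer indices. -/
def extend (ρ : Fin r → Perm (Fin n)) (z : ℤ) : Perm (Fin n) :=
  if h : 0 ≤ z ∧ z < r then ρ ⟨z.toNat, by omega⟩ else 1

theorem extend_natCast (ρ : Fin r → Perm (Fin n)) (i : Fin r) : extend ρ ((i : ℕ) : ℤ) = ρ i := by
  rw [extend, dif_pos ⟨by omega, by omega⟩]
  rfl

theorem exists_fin_of_mem {z : ℤ} (hz : z ∈ Finset.Icc (0 : ℤ) (r - 1)) :
    ∃ i : Fin r, ((i : ℕ) : ℤ) = z := by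
  rw [Finset.mem_Icc] at hz
  exact ⟨⟨z.toNat, by omega⟩, by simp [hz.1]⟩

theorem gen_extend (ρ : Fin r → Perm (Fin n)) {T : Finset ℤ} (hT : T ⊆ Finset.Icc (0 : ℤ) (r - 1)) :
    gen (extend ρ) T = Subgroup.closure (ρ '' {i | ((i : ℕ) : ℤ) ∈ T}) := by
  rw [gen]
  congr 1
  ext g
  constructor
  · rintro ⟨z, hz, rfl⟩
    obtain ⟨i, rfl⟩ := exists_fin_of_mem (hT hz)
    exact ⟨i, hz, (extend_natCast ρ i).symm⟩
  · rintro ⟨i, hi, rfl⟩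
    exact ⟨_, hi, extend_natCast ρ i⟩

theorem gen_extend_Icc (ρ : Fin r → Perm (Fin n)) :
    gen (extend ρ) (Finset.Icc (0 : ℤ) (r - 1)) = Subgroup.closure (Set.range ρ) := by
  rw [gen_extend ρ subset_rfl, ← Set.image_univ]
  congr 2
  ext i
  simp only [Finset.mem_Icc, Set.mem_ofPred_eq, Set.mem_univ, iff_true]
  omega

theorem exists_gen_induced {X Z : Type*} {ρ : ℤ → Perm X} {σ : ℤ → Perm Z} {β : X → Z}
    {S : Finset ℤ} (he : ∀ i ∈ S, ∀ x, β (ρ i x) = σ i (β x)) {g : Perm X} (hg : g ∈ gen ρ S) :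
    ∃ τ ∈ gen σ S, ∀ x, β (g x) = τ (β x) := by
  induction hg using Subgroup.closure_induction with
  | mem _ hx =>
    obtain ⟨i, hi, rfl⟩ := hx
    exact ⟨σ i, mem_gen hi, he i hi⟩
  | one => exact ⟨1, one_mem _, fun _ => rfl⟩
  | mul _ _ _ _ h1 h2 =>
    obtain ⟨a, ha, h1⟩ := h1
    obtain ⟨b, hb, h2⟩ := h2
    exact ⟨a * b, mul_mem ha hb, fun x => by simp only [Perm.mul_apply, h1, h2]⟩
  | inv y _ h1 =>
    obtain ⟨a, ha, h1⟩ := h1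
    refine ⟨a⁻¹, inv_mem ha, fun x => ?_⟩
    rw [Perm.eq_inv_iff_eq, ← h1]
    simp

theorem isBlock_preimage_orb {X Z : Type*} {ρ : ℤ → Perm X} {σ : ℤ → Perm Z} {β : X → Z}
    {S : Finset ℤ} (he : ∀ i ∈ S, ∀ x, β (ρ i x) = σ i (β x)) {N : Subgroup (Perm Z)}
    (hN : ∀ g ∈ gen σ S, ∀ n ∈ N, g * n * g⁻¹ ∈ N) (c : Z) :
    MulAction.IsBlock ↥(gen ρ S) {x | β x ∈ orb N c} := by
  have key : ∀ g ∈ gen ρ S, ∀ x y, β x ∈ orb N c → β (g x) ∈ orb N c → β y ∈ orb N c →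
      β (g y) ∈ orb N c := by
    intro g hg x y hx hgx hy
    obtain ⟨τ, hτ, hgτ⟩ := exists_gen_induced he hg
    obtain ⟨u, hu, hy⟩ := mem_orb_trans (mem_orb_symm hx) hy
    have e : β (g y) = (τ * u * τ⁻¹) (β (g x)) := by
      rw [hgτ y, hgτ x, ← hy]
      simp
    rw [e]
    exact mem_orb_trans hgx (apply_mem_orb (hN τ hτ u hu) _)
  rw [MulAction.isBlock_iff_smul_eq_of_mem]
  intro g a ha hga
  ext y
  rw [Set.mem_smul_set_iff_inv_smul_mem]
  constructor
  · intro hy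
    have := key g g.2 a _ ha hga hy
    rwa [show (g : Perm X) (g⁻¹ • y) = y from smul_inv_smul g y] at this
  · refine fun hy => key _ (g⁻¹).2 (g • a) y hga ?_ hy
    rwa [show ((g⁻¹ : gen ρ S) : Perm X) (g • a) = a from inv_smul_smul g a]

theorem exists_blocks (hn : 0 < n) {ρ : Fin r → Perm (Fin n)} (hstring : IsStringC ρ)
    (htrans : MulAction.IsPretransitive ↥(Subgroup.closure (Set.range ρ)) (Fin n))
    {b : Fin n → Fin m} (hbsurj : Function.Surjective b)
    (hfib : ∀ c : Fin m, Set.ncard {x | b x = c} = k)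
    (hcompat : ∀ g ∈ Subgroup.closure (Set.range ρ), ∀ x y : Fin n,
      b x = b y → b (g x) = b (g y))
    (hmax : ∀ (c : Fin m) (X : Set (Fin n)),
      MulAction.IsBlock ↥(Subgroup.closure (Set.range ρ)) X →
      {x | b x = c} ⊆ X → X = {x | b x = c} ∨ X = Set.univ) :
    ∃ σ : ℤ → Perm (Fin m), Blocks (extend ρ) σ b (Finset.Icc (0 : ℤ) (r - 1)) k m := by
  have hinv : ∀ i, ρ i * ρ i = 1 := fun i => by
    rw [← pow_two, ← hstring.1.1 i, pow_orderOf_eq_one]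
  have hne : ∀ i, ρ i ≠ 1 := fun i e => by
    have := hstring.1.1 i
    rw [e, orderOf_one] at this
    omega
  have hσ : ∀ z, ∃ τ : Perm (Fin m), z ∈ Finset.Icc (0 : ℤ) (r - 1) →
      ∀ x, b (extend ρ z x) = τ (b x) := by
    intro z
    by_cases hz : z ∈ Finset.Icc (0 : ℤ) (r - 1)
    · obtain ⟨τ, hτ⟩ := exists_induced hbsurj
        (hcompat (extend ρ z) (gen_extend_Icc ρ ▸ mem_gen hz))
      exact ⟨τ, fun _ => hτ⟩
    · exact ⟨1, fun h => absurd h hz⟩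
  choose σ hσ using hσ
  refine ⟨σ, ⟨⟨⟨⟨0, hn⟩, trivial⟩, ?_, ?_, inv_univ, ?_, faith_univ⟩, ?_, hσ, hbsurj, hfib,
    by simp, ?_⟩⟩
  · intro i hi j hj hij
    obtain ⟨i, rfl⟩ := exists_fin_of_mem hi
    obtain ⟨j, rfl⟩ := exists_fin_of_mem hj
    rw [extend_natCast, extend_natCast]
    have h2 := hstring.1.2 i j (by rw [lt_abs]; omega)
    rw [pow_two] at h2
    have h3 := eq_inv_of_mul_eq_one_left h2
    rwa [mul_inv_rev, inv_eq_of_mul_eq_one_left (hinv i), inv_eq_of_mul_eq_one_left (hinv j)] at h3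
  · intro i hi hmem
    obtain ⟨i, rfl⟩ := exists_fin_of_mem hi
    rw [gen_extend ρ (Finset.erase_subset _ _), extend_natCast] at hmem
    have h1 : ρ i ∈ Subgroup.closure (ρ '' {i}) := Subgroup.subset_closure ⟨i, rfl, rfl⟩
    have h2 := Subgroup.mem_inf.2 ⟨h1, hmem⟩
    rw [hstring.2] at h2
    have e : ({i} : Set (Fin r)) ∩ {j | ((j : ℕ) : ℤ) ∈
        (Finset.Icc (0 : ℤ) (r - 1)).erase ((i : ℕ) : ℤ)} = ∅ := by
      ext j
      simp
    rw [e, Set.image_empty, Subgroup.closure_empty, Subgroup.mem_bot] at h2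
    exact hne i h2
  · rw [gen_extend_Icc]
    intro x _ y _
    obtain ⟨g, hg⟩ := htrans.exists_smul_eq x y
    exact ⟨g, g.2, hg⟩
  · intro i hi
    obtain ⟨i, rfl⟩ := exists_fin_of_mem hi
    rw [extend_natCast, hinv]
  · intro N _ hN hnorm
    obtain ⟨u, hu, hu1⟩ := (Subgroup.ne_bot_iff_exists_ne_one.1 hN : ∃ a : N, a ≠ 1).elim
      fun a ha => (⟨a, a.2, fun e => ha (Subtype.ext e)⟩ : ∃ u ∈ N, u ≠ 1)
    obtain ⟨c, hc⟩ : ∃ c, u c ≠ c := by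
      by_contra! h
      exact hu1 (Equiv.ext h)
    have hblock := isBlock_preimage_orb hσ hnorm c
    rw [gen_extend_Icc] at hblock
    have hsub : {x | b x = c} ⊆ {x | b x ∈ orb N c} := fun x hx => by
      rw [Set.mem_ofPred_eq, show b x = c from hx]
      exact mem_orb_self c
    have hall : ∀ d, d ∈ orb N c := by
      rcases hmax c _ hblock hsub with h | h
      · obtain ⟨x, hx⟩ := hbsurj (u c)
        have hxm : x ∈ {x | b x ∈ orb N c} := by
          rw [Set.mem_ofPred_eq, hx]
          exact apply_mem_orb hu c
        rw [h] at hxm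
        exact absurd (hx.symm.trans hxm) hc
      · intro d
        obtain ⟨x, rfl⟩ := hbsurj d
        have hxm : x ∈ {x | b x ∈ orb N c} := h ▸ trivial
        exact hxm
    exact fun x _ y _ => mem_orb_trans (mem_orb_symm (hall x)) (hall y)

end StringPerm

theorem stmt11 {n r k m : ℕ} (hn14 : 14 ≤ n)
    (ρ : Fin r → Equiv.Perm (Fin n)) (hstring : IsStringC ρ)
    (htrans : MulAction.IsPretransitive ↥(Subgroup.closure (Set.range ρ)) (Fin n))
    (hr : n / 2 ≤ r)
    (hn : n = k * m) (hk : 2 ≤ k) (hm : 2 ≤ m)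
    (b : Fin n → Fin m) (hbsurj : Function.Surjective b)
    (hfib : ∀ c : Fin m, Set.ncard {x | b x = c} = k)
    (hcompat : ∀ g ∈ Subgroup.closure (Set.range ρ), ∀ x y : Fin n,
      b x = b y → b (g x) = b (g y))
    -- every fiber of b is a maximal block
    (hmax : ∀ (c : Fin m) (X : Set (Fin n)),
      MulAction.IsBlock ↥(Subgroup.closure (Set.range ρ)) X →
      {x | b x = c} ⊆ X → X = {x | b x = c} ∨ X = Set.univ) :
    k = 2 ∨ m = 2 := by
  by_contra! hkm
  obtain ⟨σ, h⟩ := StringPerm.exists_blocks (by omega) hstring htrans hbsurj hfib hcompat hmax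
  have hk3 : 3 ≤ k := by omega
  have hm3 : 3 ≤ m := by omega
  have hX : (Set.univ : Set (Fin n)).ncard = k * m := by rw [Set.ncard_univ, Nat.card_fin, hn]
  have hcard : (Finset.Icc (0 : ℤ) (r - 1)).card = r := by rw [Int.card_Icc]; omega
  have hadd := h.card_le_add hm3
  have hlt := h.card_lt hm3
  have hprimes := fun hk hm => h.card_lt_of_primes (by omega) (k := k) (m := m) hk hm
  have hsix := h.card_le_six hX
  rw [hcard] at hadd hlt hprimes hsix
  have hbound : n < 2 * r + 2 := by omega
  rcases hadd with hadd | ⟨hm12, hadd⟩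
  · by_cases hm8 : 8 ≤ m
    · nlinarith
    by_cases hk8 : 8 ≤ k
    · nlinarith
    have hm8' : m ≤ 7 := by omega
    have hk8' : k ≤ 7 := by omega
    have hk7 : k = 7 → m = 3 → r < k + m := by
      rintro rfl rfl
      exact hprimes (by norm_num) (by norm_num) (by norm_num) (by decide) hX
    clear hprimes h hX
    interval_cases k <;> interval_cases m <;> omega
  · nlinarith
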